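/- Let n ≥ 1, 1 < p < ∞ and α ∈ ℝ. There exist constants c, C > 0 (depending only on n, p, α) such that for every Schwartz function f on ℝ^{n+1}: c·‖𝓕⁻¹(m_α·𝓕f)‖_{Lᵖ} ≤ ‖𝓕⁻¹(m_{α−1}·𝓕f)‖_{Lᵖ} + Σ_{k=1}^{n} ‖𝓕⁻¹(m_{α−1}·𝓕(∂_{X_k}f))‖_{Lᵖ} + ‖𝓕⁻¹(m_{α−1}·|τ|^{1/2}·𝓕f)‖_{Lᵖ} ≤ C·‖𝓕⁻¹(m_α·𝓕f)‖_{Lᵖ}. (This is the parabolic Sobolev-space equivalence ‖f‖_{𝓛^p_α} ≈ ‖f‖_{𝓛^p_{α−1}} + Σ_k‖D_{X_k}f‖_{𝓛^p_{α−1}} + ‖D_t^{1/2}f‖_{𝓛^p_{α−1}}.) -/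

import Mathlib

noncomputable section

open MeasureTheory Real Complex
open scoped ENNReal NNReal Real BigOperators

/-- Euclidean space `ℝⁿ`. -/
abbrev Rn (n : ℕ) : Type := EuclideanSpace ℝ (Fin n)

/-- The space `ℝ^{n+1} = ℝⁿ × ℝ`, points written `(X, t)`. -/
abbrev Rn1 (n : ℕ) : Type := EuclideanSpace ℝ (Fin n) × ℝ

/-- Fourier transform on `ℝ^{n+1}`:
`𝓕f(ξ,τ) = ∫ e^{−2πi(X·ξ + tτ)} f(X,t) dX dt`. -/
def FT1 {n : ℕ} (f : Rn1 n → ℂ) (q : Rn1 n) : ℂ :=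
  ∫ p : Rn1 n,
    Complex.exp (-(2 * (π : ℂ) * Complex.I) *
      (((∑ k, p.1 k * q.1 k) + p.2 * q.2 : ℝ) : ℂ)) * f p

/-- Inverse Fourier transform on `ℝ^{n+1}`. -/
def IFT1 {n : ℕ} (f : Rn1 n → ℂ) (x : Rn1 n) : ℂ :=
  ∫ q : Rn1 n,
    Complex.exp ((2 * (π : ℂ) * Complex.I) *
      (((∑ k, q.1 k * x.1 k) + q.2 * x.2 : ℝ) : ℂ)) * f q

/-- The Fourier multiplier operator `f ↦ 𝓕⁻¹(m · 𝓕 f)` on `ℝ^{n+1}`. -/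
def MOp {n : ℕ} (m : Rn1 n → ℂ) (f : Rn1 n → ℂ) : Rn1 n → ℂ :=
  IFT1 (fun q => m q * FT1 f q)

/-- The symbol `m_α(ξ,τ) = (1 + 4π²|ξ|² + iτ)^{α/2}` (principal branch). -/
def mSym {n : ℕ} (α : ℝ) (q : Rn1 n) : ℂ :=
  (1 + 4 * (π : ℂ) ^ 2 * (‖q.1‖ : ℂ) ^ 2 + Complex.I * (q.2 : ℂ)) ^ ((α : ℂ) / 2)

/-- Partial derivative `∂_{X_k}`. -/
def dX {n : ℕ} (k : Fin n) (f : Rn1 n → ℂ) : Rn1 n → ℂ :=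
  fun x => fderiv ℝ f x (EuclideanSpace.single k 1, 0)

/-- Partial derivative `∂_t`. -/
def dT {n : ℕ} (f : Rn1 n → ℂ) : Rn1 n → ℂ :=
  fun x => fderiv ℝ f x (0, 1)

/-- Iterated spatial derivative `D_X^β` for a multi-index `β`. -/
def dXmulti {n : ℕ} (β : Fin n → ℕ) (f : Rn1 n → ℂ) : Rn1 n → ℂ :=
  (List.finRange n).foldr (fun k g => (dX k)^[β k] g) f

/-- The half time-derivative `D_t^{1/2} f = 𝓕⁻¹(|τ|^{1/2}·𝓕f)`. -/
def halfDt {n : ℕ} (f : Rn1 n → ℂ) : Rn1 n → ℂ :=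
  MOp (fun q => ((|q.2| ^ ((1 : ℝ) / 2) : ℝ) : ℂ)) f

/-- The `Lᵖ(ℝ^{n+1})` norm (as a value in `ℝ≥0∞`), `p` a real exponent. -/
def pNorm {n : ℕ} (p : ℝ) (f : Rn1 n → ℂ) : ℝ≥0∞ :=
  eLpNorm f (ENNReal.ofReal p) volume

/-- Multi-indices `β ∈ ℕⁿ` with `|β| = N`. -/
def multiIdx (n N : ℕ) : Finset (Fin n → ℕ) :=
  (Fintype.piFinset fun _ : Fin n => Finset.range (N + 1)).filter fun β => (∑ k, β k) = N

/-- Convolution on `ℝ^{n+1}`. -/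
def conv1 {n : ℕ} (g f : Rn1 n → ℂ) : Rn1 n → ℂ :=
  fun x => ∫ y : Rn1 n, g (x - y) * f y

/-- A parabolic Littlewood–Paley family on `ℝ^{n+1}`. -/
structure ParabolicLP (n : ℕ) where
  φ : SchwartzMap (Rn1 n) ℂ
  ψ : SchwartzMap (Rn1 n) ℂ
  ft_pos : ∀ q : Rn1 n,
    1 / 2 < ‖q.1‖ + |q.2| ^ ((1 : ℝ) / 2) → ‖q.1‖ + |q.2| ^ ((1 : ℝ) / 2) < 2 →
      0 < (FT1 (⇑φ) q).re ∧ (FT1 (⇑φ) q).im = 0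
  ft_supp : ∀ q : Rn1 n,
    ¬(1 / 2 < ‖q.1‖ + |q.2| ^ ((1 : ℝ) / 2) ∧ ‖q.1‖ + |q.2| ^ ((1 : ℝ) / 2) < 2) →
      FT1 (⇑φ) q = 0
  ft_sum : ∀ q : Rn1 n, q ≠ 0 →
    ∑' i : ℤ, FT1 (⇑φ) (((2 : ℝ) ^ (-i)) • q.1, ((2 : ℝ) ^ (-(2 * i))) * q.2) = 1
  ft_psi : ∀ q : Rn1 n,
    FT1 (⇑ψ) q =
      1 - ∑' i : ℕ,
        FT1 (⇑φ) (((2 : ℝ) ^ (-((i : ℤ) + 1))) • q.1, ((2 : ℝ) ^ (-(2 * ((i : ℤ) + 1)))) * q.2)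

/-- The dilate `φ_i`, whose Fourier transform is `𝓕φ(2^{−i}ξ, 2^{−2i}τ)`. -/
def lpPhi {n : ℕ} (P : ParabolicLP n) (i : ℕ) : Rn1 n → ℂ :=
  fun x => (((2 : ℝ) ^ (i * (n + 2)) : ℝ) : ℂ) *
    P.φ (((2 : ℝ) ^ i) • x.1, ((2 : ℝ) ^ (2 * i)) * x.2)

/-- Parabolic Besov norm `N_{s,p}(f)` on `ℝ^{n+1}`, `1 ≤ p < ∞`. -/
def pBesov {n : ℕ} (P : ParabolicLP n) (s p : ℝ) (f : Rn1 n → ℂ) : ℝ≥0∞ :=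
  eLpNorm (conv1 (⇑P.ψ) f) (ENNReal.ofReal p) volume +
  (∑' i : ℕ,
    (ENNReal.ofReal ((2 : ℝ) ^ (s * ((i : ℝ) + 1))) *
      eLpNorm (conv1 (lpPhi P (i + 1)) f) (ENNReal.ofReal p) volume) ^ p) ^ (1 / p)

/-- Parabolic Besov norm `N_{s,∞}(f)` on `ℝ^{n+1}`. -/
def pBesovInf {n : ℕ} (P : ParabolicLP n) (s : ℝ) (f : Rn1 n → ℂ) : ℝ≥0∞ :=
  max (eLpNorm (conv1 (⇑P.ψ) f) ⊤ volume)
    (⨆ i : ℕ, ENNReal.ofReal ((2 : ℝ) ^ (s * ((i : ℝ) + 1))) *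
      eLpNorm (conv1 (lpPhi P (i + 1)) f) ⊤ volume)

/-- The time interval `(0, T)` for `0 < T ≤ ∞`. -/
def tSet (T : ℝ≥0∞) : Set ℝ := {t : ℝ | 0 < t ∧ ENNReal.ofReal t < T}

/-- Lebesgue measure restricted to the strip `ℝⁿ × (0,T)`. -/
def stripMeasure (n : ℕ) (T : ℝ≥0∞) : Measure (Rn1 n) :=
  volume.restrict {x : Rn1 n | x.2 ∈ tSet T}

/-- The parabolic Sobolev norm `‖g‖_{W^{2i,i}_p(ℝⁿ_T)}`. -/
def wNorm {n : ℕ} (i : ℕ) (p : ℝ) (T : ℝ≥0∞) (g : Rn1 n → ℂ) : ℝ≥0∞ :=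
  ∑ l ∈ Finset.range (i + 1),
    ∑ β ∈ (Fintype.piFinset fun _ : Fin n => Finset.range (2 * i + 1)).filter
        (fun β => (∑ k, β k) + 2 * l ≤ 2 * i),
      eLpNorm (dXmulti β (dT^[l] g)) (ENNReal.ofReal p) (stripMeasure n T)

/-- Time-regularity seminorm `[g]_{t,β,p,T}`. -/
def semT {n : ℕ} (b p : ℝ) (T : ℝ≥0∞) (g : Rn1 n → ℂ) : ℝ≥0∞ :=
  (∫⁻ X : Rn n, ∫⁻ t in tSet T, ∫⁻ s in tSet T,
      ENNReal.ofReal (‖g (X, t) - g (X, s)‖ ^ p / |t - s| ^ (1 + p * b / 2))) ^ (1 / p)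

/-- Space-regularity seminorm `[g]_{x,β,p,T}`. -/
def semX {n : ℕ} (b p : ℝ) (T : ℝ≥0∞) (g : Rn1 n → ℂ) : ℝ≥0∞ :=
  (∫⁻ t in tSet T, ∫⁻ X : Rn n, ∫⁻ Y : Rn n,
      ENNReal.ofReal (‖g (X + Y, t) - 2 * g (X, t) + g (X - Y, t)‖ ^ p /
        ‖Y‖ ^ ((n : ℝ) + p * b))) ^ (1 / p)

/-- The parabolic Besov norm `‖g‖_{B^{α,α/2}_p(ℝⁿ_T)}`, formed with index `i` where
`2i < α < 2i+2`. -/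
def pbNorm {n : ℕ} (i : ℕ) (α p : ℝ) (T : ℝ≥0∞) (g : Rn1 n → ℂ) : ℝ≥0∞ :=
  wNorm i p T g +
  ∑ l ∈ Finset.range (i + 1),
    ∑ β ∈ (Fintype.piFinset fun _ : Fin n => Finset.range (2 * i + 1)).filter
        (fun β => (∑ k, β k) + 2 * l = 2 * i),
      (semT (α - 2 * i) p T (dXmulti β (dT^[l] g)) +
        semX (α - 2 * i) p T (dXmulti β (dT^[l] g)))

/-- Fourier transform on `ℝⁿ`. -/
def FTn {n : ℕ} (f : Rn n → ℂ) (ξ : Rn n) : ℂ :=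
  ∫ x : Rn n, Complex.exp (-(2 * (π : ℂ) * Complex.I) * (((∑ k, x k * ξ k : ℝ)) : ℂ)) * f x

/-- Inverse Fourier transform on `ℝⁿ`. -/
def IFTn {n : ℕ} (f : Rn n → ℂ) (x : Rn n) : ℂ :=
  ∫ ξ : Rn n, Complex.exp ((2 * (π : ℂ) * Complex.I) * (((∑ k, ξ k * x k : ℝ)) : ℂ)) * f ξ

/-- Convolution on `ℝⁿ`. -/
def convn {n : ℕ} (g f : Rn n → ℂ) : Rn n → ℂ := fun x => ∫ y : Rn n, g (x - y) * f y

/-- A Littlewood–Paley family on `ℝⁿ`. -/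
structure LPFamily (n : ℕ) where
  φ : SchwartzMap (Rn n) ℂ
  ψ : SchwartzMap (Rn n) ℂ
  ft_pos : ∀ ξ : Rn n, 1 / 2 < ‖ξ‖ → ‖ξ‖ < 2 →
    0 < (FTn (⇑φ) ξ).re ∧ (FTn (⇑φ) ξ).im = 0
  ft_supp : ∀ ξ : Rn n, ¬(1 / 2 < ‖ξ‖ ∧ ‖ξ‖ < 2) → FTn (⇑φ) ξ = 0
  ft_sum : ∀ ξ : Rn n, ξ ≠ 0 → ∑' i : ℤ, FTn (⇑φ) (((2 : ℝ) ^ (-i)) • ξ) = 1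
  ft_psi : ∀ ξ : Rn n,
    FTn (⇑ψ) ξ = 1 - ∑' i : ℕ, FTn (⇑φ) (((2 : ℝ) ^ (-((i : ℤ) + 1))) • ξ)

/-- The dilate `φ′_i(x) = 2^{in} φ′(2^i x)`. -/
def lpPhin {n : ℕ} (P : LPFamily n) (i : ℕ) : Rn n → ℂ :=
  fun x => (((2 : ℝ) ^ (i * n) : ℝ) : ℂ) * P.φ (((2 : ℝ) ^ i) • x)

/-- Besov norm `B_{s,p}(f)` on `ℝⁿ`, `1 ≤ p < ∞`. -/
def besovN {n : ℕ} (P : LPFamily n) (s p : ℝ) (f : Rn n → ℂ) : ℝ≥0∞ :=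
  eLpNorm (convn (⇑P.ψ) f) (ENNReal.ofReal p) volume +
  (∑' i : ℕ,
    (ENNReal.ofReal ((2 : ℝ) ^ (s * ((i : ℝ) + 1))) *
      eLpNorm (convn (lpPhin P (i + 1)) f) (ENNReal.ofReal p) volume) ^ p) ^ (1 / p)

/-- The heat kernel `Γ(X,t)` on `ℝⁿ` (zero for `t ≤ 0`). -/
def heatKer (n : ℕ) (X : Rn n) (t : ℝ) : ℝ :=
  if 0 < t then (4 * π * t) ^ (-(n : ℝ) / 2) * Real.exp (-‖X‖ ^ 2 / (4 * t)) else 0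

/-- The heat extension `u(X,t) = ∫ Γ(X−Y,t) f(Y) dY`. -/
def heatExt {n : ℕ} (f : Rn n → ℂ) : Rn1 n → ℂ :=
  fun x => ∫ Y : Rn n, (heatKer n (x.1 - Y) x.2 : ℂ) * f Y

/-- The bilinear pairing between frequency and space variables on `ℝ^{n+1}`. -/
def pairing {n : ℕ} (q x : Rn1 n) : ℝ := (∑ k, q.1 k * x.1 k) + q.2 * x.2

/-- The character `e^{2πi q·x}`. -/
def character {n : ℕ} (q x : Rn1 n) : ℂ :=
  Complex.exp ((2 * (π : ℂ) * Complex.I) * (pairing q x : ℂ))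

section Characters
variable {n : ℕ}

instance : (volume : Measure (Rn1 n)).IsAddHaarMeasure :=
  inferInstanceAs ((volume : Measure (Rn n)).prod (volume : Measure ℝ)).IsAddHaarMeasure

lemma pairing_comm (q x : Rn1 n) : pairing q x = pairing x q := by
  simp only [pairing, mul_comm]

lemma pairing_sub (q x y : Rn1 n) : pairing q (x - y) = pairing q x - pairing q y := by
  simp only [pairing, Prod.fst_sub, Prod.snd_sub, PiLp.sub_apply, mul_sub,
    Finset.sum_sub_distrib]
  ring

lemma pairing_neg (q x : Rn1 n) : pairing q (-x) = -pairing q x := by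
  simp only [pairing, Prod.fst_neg, Prod.snd_neg, PiLp.neg_apply, mul_neg,
    Finset.sum_neg_distrib]
  ring

lemma continuous_pairing : Continuous fun z : Rn1 n × Rn1 n => pairing z.1 z.2 := by
  unfold pairing; fun_prop

lemma continuous_character : Continuous fun z : Rn1 n × Rn1 n => character z.1 z.2 := by
  unfold character
  have := @continuous_pairing n
  fun_prop

lemma norm_character (q x : Rn1 n) : ‖character q x‖ = 1 := by
  have : (2 * (π : ℂ) * Complex.I) * (pairing q x : ℂ)
      = ((2 * π * pairing q x : ℝ) : ℂ) * Complex.I := by push_cast; ring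
  rw [character, this, Complex.norm_exp_ofReal_mul_I]

lemma character_sub (q x y : Rn1 n) :
    character q (x - y) = character q x * character q (-y) := by
  rw [character, character, character, ← Complex.exp_add, pairing_sub, pairing_neg]
  congr 1; push_cast; ring

lemma character_comm (q x : Rn1 n) : character q x = character x q := by
  rw [character, pairing_comm, character]

lemma IFT1_eq (f : Rn1 n → ℂ) (x : Rn1 n) : IFT1 f x = ∫ q, character q x * f q := rfl

lemma FT1_eq (f : Rn1 n → ℂ) (q : Rn1 n) : FT1 f q = ∫ y, character q (-y) * f y := by
  unfold FT1 character
  congr 1; ext y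
  congr 2
  rw [pairing_neg, pairing_comm, pairing]
  push_cast; ring

lemma continuous_character_left (x : Rn1 n) : Continuous fun q : Rn1 n => character q x :=
  continuous_character.comp (by fun_prop : Continuous fun q : Rn1 n => (q, x))

lemma continuous_character_right (q : Rn1 n) : Continuous fun x : Rn1 n => character q x :=
  continuous_character.comp (by fun_prop : Continuous fun x : Rn1 n => (q, x))

lemma integrable_character_mul {F : Rn1 n → ℂ} (hF : Integrable F) (x : Rn1 n) :
    Integrable fun q => character q x * F q :=
  hF.bdd_mul (c := 1) (continuous_character_left x).aestronglyMeasurable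
    (Filter.Eventually.of_forall fun q => (norm_character q x).le)

lemma continuous_IFT1 {F : Rn1 n → ℂ} (hF : Integrable F) : Continuous (IFT1 F) := by
  have : IFT1 F = fun x => ∫ q, character q x * F q := rfl
  rw [this]
  refine continuous_of_dominated (bound := fun q => ‖F q‖)
    (fun x => (integrable_character_mul hF x).aestronglyMeasurable)
    (fun x => Filter.Eventually.of_forall fun q => ?_) hF.norm
    (Filter.Eventually.of_forall fun q => ?_)
  · rw [norm_mul, norm_character, one_mul]
  · exact (continuous_character_right q).mul continuous_const

lemma norm_IFT1_le (F : Rn1 n → ℂ) (x : Rn1 n) : ‖IFT1 F x‖ ≤ ∫ q, ‖F q‖ := by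
  rw [IFT1_eq]
  refine (norm_integral_le_integral_norm _).trans_eq ?_
  simp [norm_character]

lemma IFT1_add {F G : Rn1 n → ℂ} (hF : Integrable F) (hG : Integrable G) :
    IFT1 (fun q => F q + G q) = IFT1 F + IFT1 G := by
  ext x
  simp only [IFT1_eq, Pi.add_apply, mul_add]
  exact integral_add (integrable_character_mul hF x) (integrable_character_mul hG x)

lemma IFT1_const_mul (c : ℂ) (F : Rn1 n → ℂ) : IFT1 (fun q => c * F q) = c • IFT1 F := by
  ext x
  simp only [IFT1_eq, Pi.smul_apply, smul_eq_mul]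
  rw [← integral_const_mul]
  congr 1; ext q; ring

lemma IFT1_character_mul (F : Rn1 n → ℂ) (x y : Rn1 n) :
    IFT1 (fun q => character q (-y) * F q) x = IFT1 F (x - y) := by
  simp only [IFT1_eq, character_sub, mul_assoc]

end Characters

/-- Jensen's inequality for `t ↦ t ^ p` and a finite measure. -/
lemma lintegral_rpow_le_measure_univ {Y : Type*} [MeasurableSpace Y] (ν : Measure Y)
    {p : ℝ} (hp : 1 ≤ p) {a : Y → ℝ≥0∞} (ha : AEMeasurable a ν) :
    (∫⁻ y, a y ∂ν) ^ p ≤ ν Set.univ ^ (p - 1) * ∫⁻ y, a y ^ p ∂ν := by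
  rcases hp.eq_or_lt with rfl | hp
  · simp
  have hpq := Real.HolderConjugate.conjExponent hp
  have h := ENNReal.lintegral_mul_le_Lp_mul_Lq ν hpq ha (aemeasurable_const (b := (1 : ℝ≥0∞)))
  simp only [Pi.mul_apply, mul_one, ENNReal.one_rpow, lintegral_const, one_mul] at h
  have hp0 : 0 < p := by linarith
  calc (∫⁻ y, a y ∂ν) ^ p
      ≤ ((∫⁻ y, a y ^ p ∂ν) ^ (1 / p) * ν Set.univ ^ (1 / p.conjExponent)) ^ p :=
        ENNReal.rpow_le_rpow h hp0.le
    _ = _ := by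
        rw [ENNReal.mul_rpow_of_nonneg _ _ hp0.le, ← ENNReal.rpow_mul, ← ENNReal.rpow_mul,
          one_div_mul_cancel hp0.ne', ENNReal.rpow_one, mul_comm]
        congr 2
        rw [Real.conjExponent]
        field_simp

/-- Minkowski's integral inequality when the inner `L^p` norms are uniformly bounded. -/
lemma lintegral_lintegral_rpow_le {X Y : Type*} [MeasurableSpace X] [MeasurableSpace Y]
    (μ : Measure X) (ν : Measure Y) [SFinite μ] [SFinite ν]
    {p : ℝ} (hp : 1 ≤ p) {a : X → Y → ℝ≥0∞} (ha : Measurable (Function.uncurry a))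
    {M : ℝ≥0∞} (hM : ∀ y, ∫⁻ x, a x y ^ p ∂μ ≤ M) :
    ∫⁻ x, (∫⁻ y, a x y ∂ν) ^ p ∂μ ≤ ν Set.univ ^ p * M := by
  have hm : Measurable (Function.uncurry fun x y => a x y ^ p) := ha.pow_const p
  calc ∫⁻ x, (∫⁻ y, a x y ∂ν) ^ p ∂μ
      ≤ ∫⁻ x, ν Set.univ ^ (p - 1) * ∫⁻ y, a x y ^ p ∂ν ∂μ :=
        lintegral_mono fun x => lintegral_rpow_le_measure_univ ν hp
          (ha.comp measurable_prodMk_left).aemeasurable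
    _ = ν Set.univ ^ (p - 1) * ∫⁻ y, ∫⁻ x, a x y ^ p ∂μ ∂ν := by
        rw [lintegral_const_mul _ hm.lintegral_prod_right, lintegral_lintegral_swap hm.aemeasurable]
    _ ≤ ν Set.univ ^ (p - 1) * (M * ν Set.univ) := by
        gcongr
        refine (lintegral_mono hM).trans_eq ?_
        rw [lintegral_const]
    _ ≤ _ := by
        rw [mul_comm M, ← mul_assoc]
        gcongr
        by_cases h0 : ν Set.univ = 0
        · simp [h0]
        by_cases h1 : ν Set.univ = ∞
        · rw [h1, ENNReal.top_rpow_of_pos (by linarith : 0 < p)]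
          exact le_top
        · conv_lhs => rw [← ENNReal.rpow_one (ν Set.univ), ← ENNReal.rpow_mul, one_mul,
            ← ENNReal.rpow_add _ _ h0 h1]
          simp

section PNorm
variable {n : ℕ}

lemma pNorm_eq_lintegral {p : ℝ} (hp : 0 < p) (f : Rn1 n → ℂ) :
    pNorm p f = (∫⁻ x, ‖f x‖ₑ ^ p) ^ (1 / p) := by
  rw [pNorm, eLpNorm_eq_lintegral_rpow_enorm_toReal (by simpa using hp) ENNReal.ofReal_ne_top,
    ENNReal.toReal_ofReal hp.le]

lemma pNorm_rpow {p : ℝ} (hp : 0 < p) (f : Rn1 n → ℂ) :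
    pNorm p f ^ p = ∫⁻ x, ‖f x‖ₑ ^ p := by
  rw [pNorm_eq_lintegral hp, ← ENNReal.rpow_mul, one_div_mul_cancel hp.ne', ENNReal.rpow_one]

lemma pNorm_add_le {p : ℝ} (hp : 1 ≤ p) {f g : Rn1 n → ℂ} (hf : Continuous f)
    (hg : Continuous g) : pNorm p (f + g) ≤ pNorm p f + pNorm p g :=
  eLpNorm_add_le hf.aestronglyMeasurable hg.aestronglyMeasurable (by simpa using hp)

lemma pNorm_const_smul (p : ℝ) (c : ℂ) (f : Rn1 n → ℂ) :
    pNorm p (c • f) = ‖c‖ₑ * pNorm p f := eLpNorm_const_smul _ _ _ _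

lemma pNorm_comp_sub (p : ℝ) (f : Rn1 n → ℂ) (hf : Continuous f) (y : Rn1 n) :
    pNorm p (fun x => f (x - y)) = pNorm p f :=
  eLpNorm_comp_measurePreserving hf.aestronglyMeasurable (measurePreserving_sub_right volume y)

/-- A bounded symbol whose multiplier operator is bounded on `L^p` with constant `C`. -/
structure IsLpMult {n : ℕ} (p : ℝ) (m : Rn1 n → ℂ) (C : ℝ≥0) : Prop where
  measurable : Measurable m
  bounded : ∃ B : ℝ, ∀ q, ‖m q‖ ≤ B
  le : ∀ F : Rn1 n → ℂ, Measurable F → Integrable F →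
    pNorm p (IFT1 fun q => m q * F q) ≤ C * pNorm p (IFT1 F)

/-- The class of `L^p` Fourier multipliers. -/
def LpMult {n : ℕ} (p : ℝ) (m : Rn1 n → ℂ) : Prop := ∃ C : ℝ≥0, IsLpMult p m C

end PNorm

namespace IsLpMult
variable {n : ℕ} {p : ℝ} {m m₁ m₂ : Rn1 n → ℂ} {C C₁ C₂ : ℝ≥0}

lemma integrable_mul (h : IsLpMult p m C) {F : Rn1 n → ℂ} (hF : Integrable F) :
    Integrable fun q => m q * F q := by
  obtain ⟨B, hB⟩ := h.bounded
  exact hF.bdd_mul h.measurable.aestronglyMeasurable (Filter.Eventually.of_forall hB)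

lemma mono (h : IsLpMult p m C₁) (hC : C₁ ≤ C₂) : IsLpMult p m C₂ :=
  ⟨h.measurable, h.bounded, fun F hF hF' => (h.le F hF hF').trans (by gcongr)⟩

lemma const (c : ℂ) : IsLpMult (n := n) p (fun _ => c) ‖c‖₊ :=
  ⟨measurable_const, ⟨‖c‖, fun _ => le_rfl⟩, fun F _ _ => by
    rw [IFT1_const_mul, pNorm_const_smul]; rfl⟩

lemma add (hp : 1 ≤ p) (h₁ : IsLpMult p m₁ C₁) (h₂ : IsLpMult p m₂ C₂) :
    IsLpMult p (fun q => m₁ q + m₂ q) (C₁ + C₂) := by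
  refine ⟨h₁.measurable.add h₂.measurable, ?_, fun F hF hF' => ?_⟩
  · obtain ⟨B₁, hB₁⟩ := h₁.bounded
    obtain ⟨B₂, hB₂⟩ := h₂.bounded
    exact ⟨B₁ + B₂, fun q => (norm_add_le _ _).trans (add_le_add (hB₁ q) (hB₂ q))⟩
  · have i₁ := h₁.integrable_mul hF'
    have i₂ := h₂.integrable_mul hF'
    simp only [add_mul]
    rw [IFT1_add i₁ i₂]
    refine (pNorm_add_le hp (continuous_IFT1 i₁) (continuous_IFT1 i₂)).trans ?_
    push_cast
    rw [add_mul]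
    exact add_le_add (h₁.le F hF hF') (h₂.le F hF hF')

lemma mul (h₁ : IsLpMult p m₁ C₁) (h₂ : IsLpMult p m₂ C₂) :
    IsLpMult p (fun q => m₁ q * m₂ q) (C₁ * C₂) := by
  refine ⟨h₁.measurable.mul h₂.measurable, ?_, fun F hF hF' => ?_⟩
  · obtain ⟨B₁, hB₁⟩ := h₁.bounded
    obtain ⟨B₂, hB₂⟩ := h₂.bounded
    refine ⟨B₁ * B₂, fun q => ?_⟩
    rw [norm_mul]
    exact mul_le_mul (hB₁ q) (hB₂ q) (norm_nonneg _) ((norm_nonneg _).trans (hB₁ q))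
  · simp only [mul_assoc]
    refine (h₁.le _ (h₂.measurable.mul hF) (h₂.integrable_mul hF')).trans ?_
    push_cast
    rw [mul_assoc]
    gcongr
    exact h₂.le F hF hF'

lemma of_tendsto {M : ℕ → Rn1 n → ℂ} {B : ℝ} (hm : Measurable m) (h : ∀ j, IsLpMult p (M j) C)
    (hB : ∀ j q, ‖M j q‖ ≤ B) (hB' : ∀ q, ‖m q‖ ≤ B)
    (hlim : ∀ᵐ q, Filter.Tendsto (fun j => M j q) Filter.atTop (nhds (m q))) :
    IsLpMult p m C := by
  refine ⟨hm, ⟨B, hB'⟩, fun F hF hF' => ?_⟩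
  have key : ∀ x, Filter.Tendsto (fun j => IFT1 (fun q => M j q * F q) x) Filter.atTop
      (nhds (IFT1 (fun q => m q * F q) x)) := by
    intro x
    simp only [IFT1_eq]
    refine tendsto_integral_of_dominated_convergence (fun q => B * ‖F q‖)
      (fun j => (integrable_character_mul ((h j).integrable_mul hF') x).aestronglyMeasurable)
      (hF'.norm.const_mul B) (fun j => Filter.Eventually.of_forall fun q => ?_) ?_
    · rw [norm_mul, norm_character, one_mul, norm_mul]
      exact mul_le_mul_of_nonneg_right (hB j q) (norm_nonneg _)
    · filter_upwards [hlim] with q hq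
      exact (hq.mul_const _).const_mul _
  refine (Lp.eLpNorm_lim_le_liminf_eLpNorm
    (fun j => (continuous_IFT1 ((h j).integrable_mul hF')).aestronglyMeasurable) _
    (Filter.Eventually.of_forall key)).trans ?_
  refine (Filter.liminf_le_liminf (Filter.Eventually.of_forall fun j => (h j).le F hF hF')).trans ?_
  simp

lemma character (y : Rn1 n) : IsLpMult p (fun q => character q (-y)) 1 := by
  refine ⟨(continuous_character_left _).measurable, ⟨1, fun q => (norm_character _ _).le⟩,
    fun F hF hF' => ?_⟩
  have : IFT1 (fun q => _root_.character q (-y) * F q) = fun x => IFT1 F (x - y) :=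
    funext fun x => IFT1_character_mul F x y
  rw [this, pNorm_comp_sub p _ (continuous_IFT1 hF')]
  simp

/-- Absolutely convergent averages of uniformly bounded multipliers. -/
lemma average {Y : Type*} [MeasurableSpace Y] {μ : Measure Y} [SFinite μ] (hp : 1 ≤ p)
    {w : Y → ℂ} (hw : Integrable w μ) (hwm : Measurable w) {M : Y → Rn1 n → ℂ}
    (hM : Measurable (Function.uncurry M)) {B : ℝ} (hB : ∀ v q, ‖M v q‖ ≤ B)
    (h : ∀ v, IsLpMult p (M v) C) :
    IsLpMult p (fun q => ∫ v, w v * M v q ∂μ) (C * (∫ v, ‖w v‖ ∂μ).toNNReal) := by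
  have hMw : Measurable (fun z : Rn1 n × Y => w z.2 * M z.2 z.1) :=
    (hwm.comp measurable_snd).mul (hM.comp measurable_swap)
  refine ⟨hMw.stronglyMeasurable.integral_prod_right.measurable,
    ⟨(∫ v, ‖w v‖ ∂μ) * B, fun q => ?_⟩, fun F hF hF' => ?_⟩
  · refine (norm_integral_le_integral_norm _).trans ?_
    rw [← integral_mul_const]
    refine integral_mono_of_nonneg (Filter.Eventually.of_forall fun v => norm_nonneg _)
      (hw.norm.mul_const B) (Filter.Eventually.of_forall fun v => ?_)
    simp only [norm_mul]
    exact mul_le_mul_of_nonneg_left (hB v q) (norm_nonneg _)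
  have hp0 : 0 < p := by linarith
  have hid : ∀ x, IFT1 (fun q => (∫ v, w v * M v q ∂μ) * F q) x
      = ∫ v, w v * IFT1 (fun q => M v q * F q) x ∂μ := by
    intro x
    simp only [IFT1_eq, ← integral_const_mul, ← integral_mul_const]
    rw [integral_integral_swap]
    · congr 1; ext v; congr 1; ext q; ring
    · have hmeas : Measurable (fun z : Rn1 n × Y =>
          _root_.character z.1 x * (w z.2 * M z.2 z.1 * F z.1)) :=
        ((continuous_character_left x).measurable.comp measurable_fst).mul
          (hMw.mul (hF.comp measurable_fst))
      refine Integrable.mono' ((hF'.norm.mul_prod hw.norm).const_mul B)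
        hmeas.aestronglyMeasurable (Filter.Eventually.of_forall fun z => ?_)
      simp only [Function.uncurry, norm_mul, norm_character, one_mul]
      have := mul_le_mul_of_nonneg_left (hB z.2 z.1)
        (mul_nonneg (norm_nonneg (w z.2)) (norm_nonneg (F z.1)))
      linarith
  have hmi : Measurable (Function.uncurry fun (x : Rn1 n) (v : Y) =>
      ‖IFT1 (fun q => M v q * F q) x‖ₑ) := by
    have : StronglyMeasurable (fun z : (Rn1 n × Y) × Rn1 n =>
        _root_.character z.2 z.1.1 * (M z.1.2 z.2 * F z.2)) := by
      refine Measurable.stronglyMeasurable ?_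
      refine (continuous_character.measurable.comp
        (measurable_snd.prodMk (measurable_fst.comp measurable_fst))).mul ?_
      exact (hM.comp ((measurable_snd.comp measurable_fst).prodMk measurable_snd)).mul
        (hF.comp measurable_snd)
    exact this.integral_prod_right.measurable.enorm
  set ν := μ.withDensity fun v => ‖w v‖ₑ with hν
  have hνu : ν Set.univ = ENNReal.ofReal (∫ v, ‖w v‖ ∂μ) := by
    rw [hν, withDensity_apply _ MeasurableSet.univ, Measure.restrict_univ,
      ofReal_integral_norm_eq_lintegral_enorm hw]
  have hk : ∀ x, ‖IFT1 (fun q => (∫ v, w v * M v q ∂μ) * F q) x‖ₑ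
      ≤ ∫⁻ v, ‖IFT1 (fun q => M v q * F q) x‖ₑ ∂ν := by
    intro x
    have hx : Measurable fun v => ‖IFT1 (fun q => M v q * F q) x‖ₑ :=
      hmi.of_uncurry_left
    rw [hid, hν, lintegral_withDensity_eq_lintegral_mul _ hwm.enorm hx]
    refine (enorm_integral_le_lintegral_enorm _).trans_eq ?_
    simp [enorm_mul]
  rw [← ENNReal.rpow_le_rpow_iff hp0, pNorm_rpow hp0]
  refine (lintegral_mono fun x => ENNReal.rpow_le_rpow (hk x) hp0.le).trans ?_
  refine (lintegral_lintegral_rpow_le volume ν hp hmi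
    (M := (C * pNorm p (IFT1 F)) ^ p) fun v => ?_).trans_eq ?_
  · rw [← pNorm_rpow hp0]
    exact ENNReal.rpow_le_rpow ((h v).le F hF hF') hp0.le
  · rw [hνu, ← ENNReal.mul_rpow_of_nonneg _ _ hp0.le]
    congr 1
    rw [ENNReal.coe_mul, ENNReal.ofReal]
    ring

end IsLpMult

section Kernels
variable {n : ℕ}

lemma IsLpMult.FT1 {p : ℝ} (hp : 1 ≤ p) {K : Rn1 n → ℂ} (hK : Integrable K) (hKm : Measurable K) :
    IsLpMult p (FT1 K) (∫ y, ‖K y‖).toNNReal := by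
  have := IsLpMult.average (n := n) (C := 1) hp hK hKm (M := fun y q => _root_.character q (-y))
    (B := 1) ((continuous_character.comp (by fun_prop :
      Continuous fun z : Rn1 n × Rn1 n => (z.2, -z.1))).measurable)
    (fun v q => (norm_character _ _).le) (fun v => IsLpMult.character v)
  rw [one_mul] at this
  convert this using 1
  ext q
  rw [FT1_eq]
  congr 1; ext y; ring

lemma IFT1_FT1_mul {K F : Rn1 n → ℂ} (hK : Integrable K) (hF : Integrable F) (x : Rn1 n) :
    IFT1 (fun q => FT1 K q * F q) x = ∫ y, K y * IFT1 F (x - y) := by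
  simp only [← IFT1_character_mul]
  simp only [IFT1_eq, FT1_eq, ← integral_const_mul, ← integral_mul_const]
  rw [integral_integral_swap]
  · congr 1; ext v; congr 1; ext q; ring
  · have h1 : Integrable (fun z : Rn1 n × Rn1 n => F z.1 * K z.2) (volume.prod volume) :=
      hF.mul_prod hK
    have h2 : Continuous fun z : Rn1 n × Rn1 n => character z.1 x * character z.1 (-z.2) :=
      (continuous_character.comp (by fun_prop : Continuous fun z : Rn1 n × Rn1 n => (z.1, x))).mul
      (continuous_character.comp (by fun_prop : Continuous fun z : Rn1 n × Rn1 n => (z.1, -z.2)))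
    convert h1.bdd_mul (c := 1) h2.aestronglyMeasurable
      (Filter.Eventually.of_forall fun z => ?_) using 1
    · ext z; simp only [Function.uncurry]; ring
    · simp [norm_character]

/-- The anisotropic dilation `(X, t) ↦ (aX, bt)`. -/
def dilation (n : ℕ) {a b : ℝ} (ha : 0 < a) (hb : 0 < b) : Rn1 n ≃L[ℝ] Rn1 n :=
  (ContinuousLinearEquiv.smulLeft (Units.mk0 a ha.ne')).prodCongr
    (ContinuousLinearEquiv.smulLeft (Units.mk0 b hb.ne'))

lemma dilation_apply {a b : ℝ} (ha : 0 < a) (hb : 0 < b) (q : Rn1 n) :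
    dilation n ha hb q = (a • q.1, b * q.2) := rfl

lemma pairing_dilation {a b : ℝ} (ha : 0 < a) (hb : 0 < b) (q x : Rn1 n) :
    pairing (dilation n ha hb q) x = pairing q (dilation n ha hb x) := by
  simp only [pairing, dilation_apply, PiLp.smul_apply, smul_eq_mul]
  congr 1
  · congr 1; ext k; ring
  · ring

lemma exists_map_dilation {a b : ℝ} (ha : 0 < a) (hb : 0 < b) : ∃ c : ℝ≥0, c ≠ 0 ∧
    (volume : Measure (Rn1 n)).map (dilation n ha hb) = c • volume := by
  have := (dilation n ha hb).isAddHaarMeasure_map (volume : Measure (Rn1 n))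
  refine ⟨_, ?_, Measure.isAddLeftInvariant_eq_smul _ _⟩
  exact (Measure.addHaarScalarFactor_pos_of_isAddHaarMeasure _ _).ne'

lemma IsLpMult.dilate {p : ℝ} (hp : 1 ≤ p) {m : Rn1 n → ℂ} {C : ℝ≥0} (h : IsLpMult p m C)
    {a b : ℝ} (ha : 0 < a) (hb : 0 < b) :
    IsLpMult p (fun q => m (a • q.1, b * q.2)) C := by
  obtain ⟨c, hc, hmap⟩ := exists_map_dilation (n := n) ha hb
  set δ := dilation n ha hb with hδ
  have hme : MeasurableEmbedding δ := δ.toHomeomorph.measurableEmbedding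
  have hme' : MeasurableEmbedding δ.symm := δ.symm.toHomeomorph.measurableEmbedding
  have hint : ∀ G : Rn1 n → ℂ, ∫ q, G (δ q) = c • ∫ q, G q := fun G => by
    rw [← hme.integral_map, hmap, integral_smul_nnreal_measure]
  have hpn : ∀ G : Rn1 n → ℂ, Continuous G →
      pNorm p G = (c : ℝ≥0∞) ^ (1 / p) * pNorm p (G ∘ δ.symm) := fun G hG => by
    have h1 : pNorm p G = eLpNorm (G ∘ δ.symm) (ENNReal.ofReal p) (volume.map δ) := by
      rw [hme.eLpNorm_map_measure, pNorm]
      congr 1; ext x; simp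
    rw [h1, hmap, eLpNorm_smul_measure_of_ne_top' ENNReal.ofReal_ne_top,
      ENNReal.toReal_ofReal (by linarith), ENNReal.smul_def, smul_eq_mul,
      ENNReal.coe_rpow_of_ne_zero hc, one_div]
    rfl
  refine ⟨h.measurable.comp δ.continuous.measurable, ?_, fun F hF hF' => ?_⟩
  · obtain ⟨B, hB⟩ := h.bounded
    exact ⟨B, fun q => hB _⟩
  have hG : Integrable (F ∘ δ.symm) := by
    have h0 : Integrable (F ∘ δ.symm) (volume.map δ) := by
      rw [hme.integrable_map_iff]
      convert hF' using 1
      ext x; simp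
    rw [hmap] at h0
    exact (integrable_smul_measure (μ := volume) (c := (c : ℝ≥0∞)) (by simpa using hc)
      ENNReal.coe_ne_top).1 h0
  have hchar : ∀ (q x : Rn1 n), _root_.character (δ q) (δ.symm x) = _root_.character q x := by
    intro q x
    rw [_root_.character, hδ, pairing_dilation]
    simp [_root_.character]
  have hI : ∀ G : Rn1 n → ℂ, IFT1 (G ∘ δ) = ((c : ℝ) : ℂ) • (IFT1 G ∘ δ.symm) := by
    intro G; ext x
    have := hint (fun q => _root_.character q (δ.symm x) * G q)
    simp only [hchar] at this
    rw [IFT1_eq]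
    simp only [Function.comp_apply, this, Pi.smul_apply, IFT1_eq, smul_eq_mul]
    rfl
  set G := F ∘ δ.symm with hGdef
  have hF1 : F = G ∘ δ := by ext x; simp [hGdef]
  have hm1 : (fun q => m (a • q.1, b * q.2) * F q) = (fun q => m q * G q) ∘ δ := by
    ext q
    change _ = m (δ q) * F (δ.symm (δ q))
    rw [δ.symm_apply_apply]
    rfl
  have hGm : Measurable G := hF.comp δ.symm.continuous.measurable
  rw [hm1, hF1, hI, hI, pNorm_const_smul, pNorm_const_smul]
  have h2 := h.le G hGm hG
  rw [hpn _ (continuous_IFT1 (h.integrable_mul hG)), hpn _ (continuous_IFT1 hG)] at h2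
  have hc1 : (c : ℝ≥0∞) ^ (1 / p) ≠ 0 := by
    simp [ENNReal.rpow_eq_zero_iff, hc]
  have hc2 : (c : ℝ≥0∞) ^ (1 / p) ≠ ∞ :=
    ENNReal.rpow_ne_top_of_nonneg (by positivity) ENNReal.coe_ne_top
  rw [mul_left_comm, ENNReal.mul_le_mul_iff_right hc1 hc2] at h2
  rw [mul_left_comm]
  gcongr

end Kernels

section Dyadic
variable {n : ℕ}

/-- The index of the parabolic dyadic cell of generation `k` (spatial side `2^k`, temporal side
`4^k`) containing `z`. -/
def cellIndex (k : ℤ) (z : Rn1 n) : (Fin n → ℤ) × ℤ :=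
  (fun i => ⌊z.1 i / 2 ^ k⌋, ⌊z.2 / 4 ^ k⌋)

/-- The parabolic dyadic cell of generation `k` containing `z`. -/
def dyadicCell (k : ℤ) (z : Rn1 n) : Set (Rn1 n) := {y | cellIndex k y = cellIndex k z}

lemma measurable_cellIndex (k : ℤ) : Measurable (cellIndex (n := n) k) := by
  refine Measurable.prodMk (measurable_pi_lambda _ fun i => Int.measurable_floor.comp ?_)
    (Int.measurable_floor.comp (measurable_snd.div_const _))
  exact Measurable.div_const (by fun_prop) _

lemma measurableSet_dyadicCell (k : ℤ) (z : Rn1 n) : MeasurableSet (dyadicCell k z) :=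
  measurable_cellIndex k (measurableSet_singleton _)

/-- The volume of a dyadic cell of generation `k`. -/
def cellVolume (n : ℕ) (k : ℤ) : ℝ := (2 ^ k) ^ n * 4 ^ k

lemma cellVolume_pos (k : ℤ) : 0 < cellVolume n k := by unfold cellVolume; positivity

lemma cellVolume_succ (k : ℤ) : cellVolume n (k + 1) = 2 ^ (n + 2) * cellVolume n k := by
  unfold cellVolume
  rw [zpow_add_one₀ (by norm_num), zpow_add_one₀ (by norm_num), mul_pow, pow_add]
  ring

lemma floor_div_eq_iff {x s : ℝ} (hs : 0 < s) (j : ℤ) :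
    ⌊x / s⌋ = j ↔ x ∈ Set.Ico (j * s) (j * s + s) := by
  rw [Int.floor_eq_iff, le_div_iff₀ hs, div_lt_iff₀ hs, Set.mem_Ico, add_mul, one_mul]

lemma volume_dyadicCell (k : ℤ) (z : Rn1 n) :
    volume (dyadicCell k z) = ENNReal.ofReal (cellVolume n k) := by
  have h : dyadicCell k z = ((WithLp.ofLp : Rn n → Fin n → ℝ) ⁻¹' (Set.univ.pi fun i =>
      Set.Ico ((cellIndex k z).1 i * (2:ℝ) ^ k) ((cellIndex k z).1 i * (2:ℝ) ^ k + 2 ^ k))) ×ˢ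
      Set.Ico ((cellIndex k z).2 * (4:ℝ) ^ k) ((cellIndex k z).2 * (4:ℝ) ^ k + 4 ^ k) := by
    ext y
    simp only [dyadicCell, Set.mem_ofPred_eq, Set.mem_prod, Set.mem_preimage, Set.mem_pi,
      Set.mem_univ, true_imp_iff]
    rw [Prod.ext_iff, funext_iff]
    simp only [cellIndex]
    rw [floor_div_eq_iff (by positivity)]
    refine and_congr (forall_congr' fun i => ?_) Iff.rfl
    exact floor_div_eq_iff (by positivity) _
  rw [h, Measure.volume_eq_prod, Measure.prod_prod,
    (PiLp.volume_preserving_ofLp (Fin n)).measure_preimage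
      (MeasurableSet.univ_pi fun _ => measurableSet_Ico).nullMeasurableSet, Real.volume_pi_Ico,
    Real.volume_Ico]
  simp only [add_sub_cancel_left, Finset.prod_const, Finset.card_univ, Fintype.card_fin]
  rw [← ENNReal.ofReal_pow (by positivity), ← ENNReal.ofReal_mul (by positivity), cellVolume]

lemma floor_div_mul_natCast (x s : ℝ) (m : ℕ) : ⌊x / (s * m)⌋ = ⌊x / s⌋ / (m : ℤ) := by
  rw [← div_div, Int.floor_div_natCast]

lemma cellIndex_eq_of_le {k l : ℤ} (hkl : k ≤ l) {y z : Rn1 n}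
    (h : cellIndex k y = cellIndex k z) : cellIndex l y = cellIndex l z := by
  induction l, hkl using Int.leInduction with
  | base => exact h
  | succ l _ ih =>
    have e : ∀ w : Rn1 n, cellIndex (l + 1) w
        = (fun i => (cellIndex l w).1 i / 2, (cellIndex l w).2 / 4) := by
      intro w
      simp only [cellIndex]
      refine Prod.ext (funext fun i => ?_) ?_
      · simp only [zpow_add_one₀ (two_ne_zero' ℝ)]
        exact floor_div_mul_natCast _ _ 2
      · simp only [zpow_add_one₀ (four_ne_zero' ℝ)]
        exact floor_div_mul_natCast _ _ 4
    rw [e, e, ih]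

lemma dyadicCell_subset {k l : ℤ} (hkl : k ≤ l) (z : Rn1 n) :
    dyadicCell k z ⊆ dyadicCell l z := fun _ hy => cellIndex_eq_of_le hkl hy

lemma dyadicCell_eq {k : ℤ} {y z : Rn1 n} (h : cellIndex k y = cellIndex k z) :
    dyadicCell k y = dyadicCell k z := by simp only [dyadicCell, h]

lemma norm_sub_le_of_cellIndex_eq {k : ℤ} {y z : Rn1 n} (h : cellIndex k y = cellIndex k z) :
    ‖y.1 - z.1‖ ≤ n * 2 ^ k ∧ |y.2 - z.2| ≤ 4 ^ k := by
  have key : ∀ {s a b : ℝ}, 0 < s → ⌊a / s⌋ = ⌊b / s⌋ → |a - b| ≤ s := by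
    intro s a b hs hab
    have := Int.abs_sub_lt_one_of_floor_eq_floor hab
    rw [← sub_div, abs_div, abs_of_pos hs, div_lt_one hs] at this
    exact this.le
  rw [Prod.ext_iff, funext_iff] at h
  refine ⟨?_, key (by positivity) h.2⟩
  rw [EuclideanSpace.norm_eq, Real.sqrt_le_left (by positivity)]
  have h1 : ∀ i ∈ Finset.univ, ‖(y.1 - z.1) i‖ ^ 2 ≤ ((2 : ℝ) ^ k) ^ 2 := fun i _ =>
    pow_le_pow_left₀ (norm_nonneg _) (key (by positivity) (h.1 i)) 2
  refine (Finset.sum_le_card_nsmul _ _ _ h1).trans ?_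
  simp only [Finset.card_univ, Fintype.card_fin, nsmul_eq_mul, mul_pow]
  gcongr
  exact_mod_cast Nat.le_self_pow two_ne_zero n

/-- The Calderón–Zygmund covering of `{|h| > α}` by disjoint parabolic cells on which `|h|` has
average comparable to `α`. -/
theorem exists_cz_cover {h : Rn1 n → ℂ} (hc : Continuous h) {p : ℝ} (hp : 1 ≤ p)
    (hN : ∫⁻ x, ‖h x‖ₑ ^ p ≠ ∞) {α : ℝ≥0} (hα : 0 < α) :
    ∃ (ι : Type) (_ : Countable ι) (P : ι → Set (Rn1 n)) (c : ι → Rn1 n) (ρ : ι → ℝ),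
      (∀ i, MeasurableSet (P i)) ∧ Pairwise (Function.onFun Disjoint P) ∧ (∀ i, 0 < ρ i) ∧
      (∀ i, ∀ z ∈ P i, ‖z.1 - (c i).1‖ ≤ ρ i ∧ |z.2 - (c i).2| ≤ ρ i ^ 2) ∧
      (∀ i, ENNReal.ofReal (ρ i ^ (n + 2)) = (n + 1) ^ (n + 2) * volume (P i)) ∧
      (∀ i, α * volume (P i) ≤ ∫⁻ z in P i, ‖h z‖ₑ) ∧
      (∀ i, ∫⁻ z in P i, ‖h z‖ₑ ≤ 2 ^ (n + 2) * (α * volume (P i))) ∧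
      ∀ z ∉ ⋃ i, P i, ‖h z‖ₑ ≤ α := by
  have hp0 : 0 < p := by linarith
  set Bad : ℤ → Rn1 n → Prop := fun k z =>
    α * volume (dyadicCell k z) < ∫⁻ y in dyadicCell k z, ‖h y‖ₑ with hBad
  have hBad_congr : ∀ {k} {y z : Rn1 n}, cellIndex k y = cellIndex k z → Bad k y → Bad k z := by
    intro k y z hyz hb
    simpa only [hBad, dyadicCell_eq hyz] using hb
  obtain ⟨k₀, hk₀⟩ : ∃ k₀ : ℤ, ∀ k z, k₀ ≤ k → ¬ Bad k z := by
    obtain ⟨N, hN'⟩ := exists_nat_gt ((∫⁻ x, ‖h x‖ₑ ^ p).toReal / (α : ℝ) ^ p)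
    refine ⟨N, fun k z hk hb => ?_⟩
    have hV : (N : ℝ) ≤ cellVolume n k := by
      unfold cellVolume
      have h2 : (1 : ℝ) ≤ (2 ^ k) ^ n :=
        one_le_pow₀ (one_le_zpow₀ (by norm_num) (by lia))
      have h4 : ((4 : ℝ) ^ N) ≤ 4 ^ k := by
        rw [← zpow_natCast]; exact zpow_le_zpow_right₀ (by norm_num) hk
      have h5 : (N : ℝ) ≤ 4 ^ N := by exact_mod_cast (Nat.lt_pow_self (by norm_num)).le
      have : (0:ℝ) < 4 ^ k := by positivity
      nlinarith
    have h1 := lintegral_rpow_le_measure_univ (volume.restrict (dyadicCell k z)) hp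
      (a := fun y => ‖h y‖ₑ) hc.enorm.aemeasurable
    rw [Measure.restrict_apply_univ] at h1
    have h2 := (ENNReal.rpow_lt_rpow hb hp0).trans_le
      (h1.trans (mul_le_mul_right (setLIntegral_le_lintegral _ _) _))
    set N' := ∫⁻ x, ‖h x‖ₑ ^ p
    rw [volume_dyadicCell, ENNReal.mul_rpow_of_nonneg _ _ hp0.le] at h2
    have hVp : 0 < cellVolume n k := cellVolume_pos k
    rw [ENNReal.ofReal_rpow_of_pos hVp, ENNReal.ofReal_rpow_of_pos hVp, ← ENNReal.ofReal_toReal hN,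
      ← ENNReal.ofReal_coe_nnreal, ENNReal.ofReal_rpow_of_pos (by exact_mod_cast hα),
      ← ENNReal.ofReal_mul (by positivity), ← ENNReal.ofReal_mul (by positivity),
      ENNReal.ofReal_lt_ofReal_iff_of_nonneg (by positivity), Real.rpow_sub hVp, Real.rpow_one] at h2
    rw [div_lt_iff₀ (by positivity)] at hN'
    have h3 : (α : ℝ) ^ p * cellVolume n k < N'.toReal := by
      have : (0:ℝ) < cellVolume n k ^ p / cellVolume n k := by positivity
      refine lt_of_mul_lt_mul_left ?_ this.le
      refine lt_of_eq_of_lt ?_ h2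
      field_simp
    have : (0:ℝ) < (α:ℝ)^p := by positivity
    nlinarith
  set Sel : ℤ → Rn1 n → Prop := fun k z => Bad k z ∧ ∀ l, k < l → ¬ Bad l z
  set ι := {a : ℤ × ((Fin n → ℤ) × ℤ) // ∃ z, cellIndex a.1 z = a.2 ∧ Sel a.1 z}
  choose c hcI hcS using fun i : ι => i.2
  refine ⟨ι, inferInstance, fun i => dyadicCell i.1.1 (c i), c, fun i => (n + 1) * 2 ^ i.1.1,
    fun i => measurableSet_dyadicCell _ _, ?_, fun i => by positivity, fun i z hz => ?_,
    fun i => ?_, fun i => (hcS i).1.le, fun i => ?_, fun z hz => ?_⟩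
  · have aux : ∀ i j : ι, i.1.1 < j.1.1 → ∀ y, y ∈ dyadicCell i.1.1 (c i) →
        y ∉ dyadicCell j.1.1 (c j) := by
      intro i j hij y hi hj
      have e1 : cellIndex j.1.1 y = cellIndex j.1.1 (c i) := cellIndex_eq_of_le hij.le hi
      exact (hcS i).2 _ hij (hBad_congr (Eq.trans (Eq.symm hj) e1) (hcS j).1)
    intro i j hij
    rw [Function.onFun, Set.disjoint_left]
    intro y hi hj
    rcases lt_trichotomy i.1.1 j.1.1 with hlt | heq | hlt
    · exact aux i j hlt y hi hj
    · refine hij (Subtype.ext (Prod.ext heq ?_))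
      have hi' : cellIndex i.1.1 y = cellIndex i.1.1 (c i) := hi
      have hj' : cellIndex j.1.1 y = cellIndex j.1.1 (c j) := hj
      rw [← hcI i, ← hcI j, ← hi', ← hj', heq]
    · exact aux j i hlt y hj hi
  · obtain ⟨h1, h2⟩ := norm_sub_le_of_cellIndex_eq hz
    have h4 : ((4:ℝ) ^ i.1.1) = (2 ^ i.1.1) ^ 2 := by
      rw [← zpow_natCast, zpow_comm]; norm_num
    have h5 : (0:ℝ) < 2 ^ i.1.1 := by positivity
    refine ⟨h1.trans (by nlinarith), h2.trans ?_⟩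
    rw [h4, mul_pow]
    have : (1:ℝ) ≤ (n + 1) ^ 2 := one_le_pow₀ (by linarith [(Nat.cast_nonneg n : (0:ℝ) ≤ n)])
    nlinarith [sq_nonneg ((2:ℝ) ^ i.1.1)]
  · have h4 : ((4:ℝ) ^ i.1.1) = (2 ^ i.1.1) ^ 2 := by
      rw [← zpow_natCast, zpow_comm]; norm_num
    rw [volume_dyadicCell, cellVolume, h4, ← pow_add, mul_pow,
      ENNReal.ofReal_mul (by positivity), ENNReal.ofReal_pow (by positivity)]
    congr 2
    rw [ENNReal.ofReal_add (by positivity) (by norm_num)]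
    simp
  · have h1 := (hcS i).2 (i.1.1 + 1) (by lia)
    simp only [hBad, not_lt] at h1
    refine (lintegral_mono_set (dyadicCell_subset (by lia) _)).trans (h1.trans_eq ?_)
    rw [volume_dyadicCell, volume_dyadicCell, cellVolume_succ, ENNReal.ofReal_mul (by positivity),
      ENNReal.ofReal_pow (by norm_num), ENNReal.ofReal_ofNat]
    ring
  · have hnb : ∀ k, ¬ Bad k z := by
      by_contra hcon
      push Not at hcon
      obtain ⟨k, hk⟩ := hcon
      obtain ⟨m, hm, hmax⟩ := Int.exists_greatest_of_bdd (P := fun k => Bad k z)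
        ⟨k₀, fun l hl => by by_contra hlt; exact hk₀ l z (by lia) hl⟩ ⟨k, hk⟩
      have hs : Sel m z := ⟨hm, fun l hl hb => absurd (hmax l hb) (by lia)⟩
      refine hz (Set.mem_iUnion.2 ⟨⟨(m, cellIndex m z), z, rfl, hs⟩, ?_⟩)
      exact (hcI ⟨(m, cellIndex m z), z, rfl, hs⟩).symm
    by_contra hlt
    rw [not_le] at hlt
    obtain ⟨β, hβ1, hβ2⟩ := exists_between hlt
    have hnhds : {y | β < ‖h y‖ₑ} ∈ nhds z :=
      (isOpen_lt continuous_const hc.enorm).mem_nhds hβ2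
    rw [Metric.mem_nhds_iff] at hnhds
    obtain ⟨ε, hε, hball⟩ := hnhds
    obtain ⟨N, hN'⟩ := exists_pow_lt_of_lt_one (show 0 < ε / (n + 1) by positivity)
      (show (1 / 2 : ℝ) < 1 by norm_num)
    refine hnb (-N) ?_
    have h2N : ((2:ℝ) ^ (-(N:ℤ))) = (1 / 2) ^ N := by
      rw [zpow_neg, zpow_natCast, one_div, inv_pow]
    have h4N : ((4:ℝ) ^ (-(N:ℤ))) ≤ (1 / 2) ^ N := by
      rw [zpow_neg, zpow_natCast, ← inv_pow]
      exact pow_le_pow_left₀ (by norm_num) (by norm_num) _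
    rw [lt_div_iff₀ (by positivity)] at hN'
    have hsub : dyadicCell (-(N:ℤ)) z ⊆ {y | β < ‖h y‖ₑ} := by
      refine Set.Subset.trans (fun y hy => ?_) hball
      obtain ⟨h1, h2⟩ := norm_sub_le_of_cellIndex_eq hy
      rw [h2N] at h1
      have hpos : (0:ℝ) < (1 / 2) ^ N := by positivity
      have hn0 : (0:ℝ) ≤ n := Nat.cast_nonneg n
      rw [Metric.mem_ball, Prod.dist_eq, max_lt_iff, dist_eq_norm, Real.dist_eq]
      constructor <;> nlinarith
    have hpos : volume (dyadicCell (-(N:ℤ)) z) ≠ 0 := by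
      rw [volume_dyadicCell]; simpa using cellVolume_pos _
    have hfin : volume (dyadicCell (-(N:ℤ)) z) ≠ ∞ := by
      rw [volume_dyadicCell]; simp
    calc (α : ℝ≥0∞) * volume (dyadicCell (-(N:ℤ)) z)
        < β * volume (dyadicCell (-(N:ℤ)) z) := by
          rwa [ENNReal.mul_lt_mul_iff_left hpos hfin]
      _ = ∫⁻ y in dyadicCell (-(N:ℤ)) z, β := by rw [setLIntegral_const]
      _ ≤ _ := setLIntegral_mono hc.enorm.measurable fun y hy => (hsub hy).le

end Dyadic

section CalderonZygmund
variable {n : ℕ}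

/-- Uniform quantitative Calderón–Zygmund hypotheses for an integrable convolution kernel:
an `L²` bound and the parabolic Hörmander condition. -/
structure IsCZKernel (K : Rn1 n → ℂ) (A H : ℝ≥0) : Prop where
  integrable : Integrable K
  measurable : Measurable K
  l2 : ∀ g : Rn1 n → ℂ, Measurable g → (∃ B, ∀ z, ‖g z‖ ≤ B) →
    ∫⁻ x, ‖conv1 K g x‖ₑ ^ 2 ≤ A * ∫⁻ x, ‖g x‖ₑ ^ 2
  hormander : ∀ ρ : ℝ, 0 < ρ → ∀ y : Rn1 n, ‖y.1‖ ≤ ρ → |y.2| ≤ ρ ^ 2 →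
    ∫⁻ z in {z : Rn1 n | 2 * ρ < ‖z.1‖ ∨ 4 * ρ ^ 2 < |z.2|}, ‖K (z - y) - K z‖ₑ ≤ H

lemma integrable_conv_aux {K g : Rn1 n → ℂ} (hK : Integrable K) (hg : Measurable g) {B : ℝ}
    (hB : ∀ z, ‖g z‖ ≤ B) (x : Rn1 n) : Integrable fun y => K (x - y) * g y :=
  (hK.comp_sub_left x).mul_bdd (c := B) hg.aestronglyMeasurable (Filter.Eventually.of_forall hB)

lemma measurable_conv1 {K g : Rn1 n → ℂ} (hK : Measurable K) (hg : Measurable g) :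
    Measurable (conv1 K g) := by
  have : Measurable fun z : Rn1 n × Rn1 n => K (z.1 - z.2) * g z.2 :=
    (hK.comp (measurable_fst.sub measurable_snd)).mul (hg.comp measurable_snd)
  exact this.stronglyMeasurable.integral_prod_right.measurable

lemma volume_parabolic_box_le (c : Rn1 n) {ρ : ℝ} (hρ : 0 < ρ) :
    volume {x : Rn1 n | ¬ (2 * ρ < ‖(x - c).1‖ ∨ 4 * ρ ^ 2 < |(x - c).2|)} ≤
      ENNReal.ofReal (2 ^ n * 8) * volume (Metric.ball (0 : Rn n) 1) *
        ENNReal.ofReal (ρ ^ (n + 2)) := by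
  have h : {x : Rn1 n | ¬ (2 * ρ < ‖(x - c).1‖ ∨ 4 * ρ ^ 2 < |(x - c).2|)}
      ⊆ Metric.closedBall c.1 (2 * ρ) ×ˢ Metric.closedBall c.2 (4 * ρ ^ 2) := by
    intro x hx
    simp only [Set.mem_ofPred_eq, not_or, not_lt, Prod.fst_sub, Prod.snd_sub] at hx
    rw [Set.mem_prod, Metric.mem_closedBall, Metric.mem_closedBall, dist_eq_norm, Real.dist_eq]
    exact hx
  refine (measure_mono h).trans_eq ?_
  rw [Measure.volume_eq_prod, Measure.prod_prod, Measure.addHaar_closedBall _ _ (by positivity),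
    Real.volume_closedBall, finrank_euclideanSpace_fin]
  rw [mul_right_comm, mul_right_comm (ENNReal.ofReal (2 ^ n * 8)),
    ← ENNReal.ofReal_mul (by positivity), ← ENNReal.ofReal_mul (by positivity)]
  congr 2
  ring

lemma lintegral_compl_box_le {K : Rn1 n → ℂ} {A H : ℝ≥0} (hK : IsCZKernel K A H) {ρ : ℝ}
    (hρ : 0 < ρ) (c y : Rn1 n) (h1 : ‖y.1 - c.1‖ ≤ ρ) (h2 : |y.2 - c.2| ≤ ρ ^ 2) :
    ∫⁻ x in {x : Rn1 n | 2 * ρ < ‖(x - c).1‖ ∨ 4 * ρ ^ 2 < |(x - c).2|},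
      ‖K (x - y) - K (x - c)‖ₑ ≤ H := by
  refine le_of_eq_of_le ?_ (hK.hormander ρ hρ (y - c) h1 h2)
  set S := {z : Rn1 n | 2 * ρ < ‖z.1‖ ∨ 4 * ρ ^ 2 < |z.2|} with hS
  have hSm : MeasurableSet S :=
    (measurableSet_lt measurable_const measurable_fst.norm).union
      (measurableSet_lt measurable_const measurable_snd.norm)
  have hmp := measurePreserving_sub_right (volume : Measure (Rn1 n)) c
  have := hmp.setLIntegral_comp_preimage_emb (MeasurableEquiv.subRight c).measurableEmbedding
    (fun z => ‖K (z - (y - c)) - K z‖ₑ) S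
  rw [← this]
  simp only [sub_sub_sub_cancel_right]
  rfl

/-- The Calderón–Zygmund estimate for the distribution function of `K * h`. -/
theorem exists_cz_distribution (n : ℕ) (A H : ℝ≥0) : ∃ C : ℝ≥0∞, C ≠ ∞ ∧
    ∀ K : Rn1 n → ℂ, IsCZKernel K A H → ∀ h : Rn1 n → ℂ, Continuous h → (∃ B, ∀ z, ‖h z‖ ≤ B) →
    ∀ p : ℝ, 1 ≤ p → ∫⁻ x, ‖h x‖ₑ ^ p ≠ ∞ → ∀ α : ℝ≥0, 0 < α →
    volume {x | α < ‖conv1 K h x‖ₑ} ≤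
      C * ((α : ℝ≥0∞)⁻¹ ^ 2 * ∫⁻ x in {x | ‖h x‖ₑ ≤ α}, ‖h x‖ₑ ^ 2) +
      C * ((α : ℝ≥0∞)⁻¹ * ∫⁻ x in {x | (α / 2 : ℝ≥0∞) < ‖h x‖ₑ}, ‖h x‖ₑ) := by
  set W : ℝ≥0∞ := ENNReal.ofReal (2 ^ n * 8) * volume (Metric.ball (0 : Rn n) 1) with hW
  have hWt : W ≠ ∞ := ENNReal.mul_ne_top ENNReal.ofReal_ne_top measure_ball_lt_top.ne
  set D : ℝ≥0∞ := 4 * A * (2 ^ (n + 2)) ^ 2 + W * (n + 1) ^ (n + 2) + 4 * H * 2 ^ (n + 2) with hD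
  have hDt : D ≠ ∞ := by
    have : ((n : ℝ≥0∞) + 1) ^ (n + 2) ≠ ∞ := by
      refine ENNReal.pow_ne_top ?_
      simp
    have h2 : (2 : ℝ≥0∞) ^ (n + 2) ≠ ∞ := by simp
    have h4 : (4 : ℝ≥0∞) ≠ ∞ := by simp
    simp only [hD, ne_eq, ENNReal.add_eq_top, not_or]
    refine ⟨⟨?_, ?_⟩, ?_⟩ <;>
      first
        | exact ENNReal.mul_ne_top hWt this
        | exact ENNReal.mul_ne_top (ENNReal.mul_ne_top h4 ENNReal.coe_ne_top) h2
        | exact ENNReal.mul_ne_top (ENNReal.mul_ne_top h4 ENNReal.coe_ne_top)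
            (ENNReal.pow_ne_top h2)
  refine ⟨4 * A + 2 * D, by
    simp only [ne_eq, ENNReal.add_eq_top, not_or]
    exact ⟨ENNReal.mul_ne_top (by simp) ENNReal.coe_ne_top, ENNReal.mul_ne_top (by simp) hDt⟩, ?_⟩
  intro K hK h hc ⟨B, hB⟩ p hp hN α hα
  obtain ⟨ι, _, P, c, ρ, hPm, hPd, hρ, hPc, hPv, hPα, hPα', hoff⟩ := exists_cz_cover hc hp hN hα
  have hα0 : (α : ℝ≥0∞) ≠ 0 := by simpa using hα.ne'
  have hαt : (α : ℝ≥0∞) ≠ ∞ := ENNReal.coe_ne_top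
  have hn1 : ((n : ℝ≥0∞) + 1) ^ (n + 2) ≠ 0 := by simp
  have hV0 : ∀ i, volume (P i) ≠ 0 := fun i h0 => by
    have := hPv i
    rw [h0, mul_zero, ENNReal.ofReal_eq_zero] at this
    exact absurd (pow_pos (hρ i) (n + 2)) (not_lt.2 this)
  have hVt : ∀ i, volume (P i) ≠ ∞ := fun i h0 => by
    have := hPv i
    rw [h0, ENNReal.mul_top hn1] at this
    exact ENNReal.ofReal_ne_top this
  have hint : ∀ i, IntegrableOn h (P i) := fun i =>
    Measure.integrableOn_of_bounded (hVt i) hc.aestronglyMeasurable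
      (Filter.Eventually.of_forall hB)
  set avg : ι → ℂ := fun i => ⨍ z in P i, h z with havg
  have havgV : ∀ i, ‖avg i‖ₑ * volume (P i) ≤ ∫⁻ z in P i, ‖h z‖ₑ := fun i => by
    refine le_trans (le_of_eq ?_) (enorm_integral_le_lintegral_enorm _)
    rw [← measure_smul_setAverage _ (hVt i), enorm_smul, mul_comm]
    congr 1
    rw [Real.enorm_eq_ofReal measureReal_nonneg, ofReal_measureReal (hVt i)]
  have havgα : ∀ i, ‖avg i‖ₑ ≤ 2 ^ (n + 2) * α := fun i => by
    have := (havgV i).trans (hPα' i)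
    rwa [← mul_assoc, ENNReal.mul_le_mul_iff_left (hV0 i) (hVt i)] at this
  set Ω := ⋃ i, P i with hΩ
  have hΩm : MeasurableSet Ω := MeasurableSet.iUnion hPm
  obtain ⟨g, hgm, hg⟩ := exists_measurable_piecewise
    (fun o : Option ι => o.elim Ωᶜ P) (fun o => by cases o; exacts [hΩm.compl, hPm _])
    (fun o => o.elim h fun i _ => avg i)
    (fun o => by cases o; exacts [hc.measurable, measurable_const]) (by
      intro o o' hoo z hz
      rcases o with - | i <;> rcases o' with - | j
      · rfl
      · exact absurd (Set.mem_iUnion.2 ⟨j, hz.2⟩) hz.1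
      · exact absurd (Set.mem_iUnion.2 ⟨i, hz.1⟩) hz.2
      · exact absurd hz.2 (Set.disjoint_left.1 (hPd fun hij => hoo (congrArg some hij)) hz.1))
  have hgP : ∀ i, ∀ z ∈ P i, g z = avg i := fun i z hz => hg (some i) hz
  have hgΩ : ∀ z ∉ Ω, g z = h z := fun z hz => hg none hz
  have hgB : ∀ z, ‖g z‖ ≤ max B (2 ^ (n + 2) * α) := by
    intro z
    by_cases hz : z ∈ Ω
    · obtain ⟨i, hi⟩ := Set.mem_iUnion.1 hz
      rw [hgP i z hi]
      refine le_max_of_le_right ?_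
      have := havgα i
      rw [← ofReal_norm, ← ENNReal.ofReal_coe_nnreal, ← ENNReal.ofReal_ofNat,
        ← ENNReal.ofReal_pow (by positivity), ← ENNReal.ofReal_mul (by positivity),
        ENNReal.ofReal_le_ofReal_iff (by positivity)] at this
      exact this
    · rw [hgΩ z hz]; exact le_max_of_le_left (hB z)
  set b : Rn1 n → ℂ := fun z => h z - g z with hb
  have hbm : Measurable b := hc.measurable.sub hgm
  have hbB : ∀ z, ‖b z‖ ≤ B + max B (2 ^ (n + 2) * α) := fun z =>
    (norm_sub_le _ _).trans (add_le_add (hB z) (hgB z))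
  have hbΩ : ∀ z ∉ Ω, b z = 0 := fun z hz => by simp [hb, hgΩ z hz]
  have hbint : ∀ i, ∫ z in P i, b z = 0 := fun i => by
    have : ∫ z in P i, b z = ∫ z in P i, (h z - avg i) :=
      setIntegral_congr_fun (hPm i) fun z hz => by simp only [hb, hgP i z hz]
    rw [this]
    exact setAverage_sub_setAverage (hVt i) h ▸ rfl
  have hbL : ∀ i, ∫⁻ z in P i, ‖b z‖ₑ ≤ 2 * (2 ^ (n + 2) * (α * volume (P i))) := fun i => by
    calc ∫⁻ z in P i, ‖b z‖ₑ ≤ ∫⁻ z in P i, (‖h z‖ₑ + ‖avg i‖ₑ) :=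
          setLIntegral_mono' (hPm i) fun z hz => by
            simp only [hb, hgP i z hz]; exact enorm_sub_le
      _ = (∫⁻ z in P i, ‖h z‖ₑ) + ‖avg i‖ₑ * volume (P i) := by
          rw [lintegral_add_left hc.enorm.measurable, setLIntegral_const]
      _ ≤ _ := by
          rw [two_mul]
          exact add_le_add (hPα' i) ((havgV i).trans (hPα' i))
  -- the measure of `Ω`
  set J := ∫⁻ x in {x | (α / 2 : ℝ≥0∞) < ‖h x‖ₑ}, ‖h x‖ₑ with hJ
  have hΩsum : volume Ω = ∑' i, volume (P i) := measure_iUnion hPd hPm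
  have hLm : MeasurableSet {x | (α / 2 : ℝ≥0∞) < ‖h x‖ₑ} :=
    measurableSet_lt measurable_const hc.enorm.measurable
  have hΩJ : volume Ω ≤ 2 * ((α : ℝ≥0∞)⁻¹ * J) := by
    have h1 : ∀ i, (α / 2 : ℝ≥0∞) * volume (P i) ≤
        ∫⁻ x in P i, {x | (α / 2 : ℝ≥0∞) < ‖h x‖ₑ}.indicator (fun x => ‖h x‖ₑ) x := fun i => by
      have h2 : ∫⁻ z in P i, ‖h z‖ₑ ≤
          ∫⁻ x in P i, ({x | (α / 2 : ℝ≥0∞) < ‖h x‖ₑ}.indicator (fun x => ‖h x‖ₑ) x + α / 2) := by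
        refine lintegral_mono fun x => ?_
        by_cases hx : (α / 2 : ℝ≥0∞) < ‖h x‖ₑ
        · rw [Set.indicator_of_mem (s := {x | (α / 2 : ℝ≥0∞) < ‖h x‖ₑ}) hx]; exact le_self_add
        · rw [Set.indicator_of_notMem (s := {x | (α / 2 : ℝ≥0∞) < ‖h x‖ₑ}) hx, zero_add]; exact not_lt.1 hx
      rw [lintegral_add_right _ measurable_const, setLIntegral_const] at h2
      have h3 := (hPα i).trans h2
      have h4 : (α : ℝ≥0∞) * volume (P i)
          = (α / 2 : ℝ≥0∞) * volume (P i) + (α / 2 : ℝ≥0∞) * volume (P i) := by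
        rw [← add_mul, ENNReal.add_halves]
      rw [h4] at h3
      exact (ENNReal.add_le_add_iff_right
        (ENNReal.mul_ne_top (ENNReal.div_ne_top hαt (by simp)) (hVt i))).1 h3
    have h2 : (α / 2 : ℝ≥0∞) * volume Ω ≤ J := by
      rw [hΩsum, ← ENNReal.tsum_mul_left]
      refine (ENNReal.tsum_le_tsum h1).trans ?_
      rw [← lintegral_iUnion hPm hPd, hJ, ← lintegral_indicator hLm]
      exact setLIntegral_le_lintegral _ _
    calc volume Ω = 2 * ((α : ℝ≥0∞)⁻¹ * ((α / 2 : ℝ≥0∞) * volume Ω)) := by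
          rw [← mul_assoc, ← mul_assoc, mul_comm 2, mul_assoc (α : ℝ≥0∞)⁻¹,
            ENNReal.mul_div_cancel (by simp) (by simp), ENNReal.inv_mul_cancel hα0 hαt, one_mul]
      _ ≤ _ := by gcongr
  -- the good part
  have hconv : ∀ x, conv1 K h x = conv1 K g x + conv1 K b x := fun x => by
    rw [conv1, conv1, conv1, ← integral_add (integrable_conv_aux hK.integrable hgm hgB x)
      (integrable_conv_aux hK.integrable hbm hbB x)]
    congr 1; ext y; simp only [hb]; ring
  set I := ∫⁻ x in {x | ‖h x‖ₑ ≤ α}, ‖h x‖ₑ ^ 2 with hI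
  have hg2 : ∫⁻ x, ‖g x‖ₑ ^ 2 ≤ I + (2 ^ (n + 2) * α) ^ 2 * volume Ω := by
    rw [← lintegral_add_compl _ hΩm, add_comm]
    refine add_le_add ?_ ?_
    · rw [setLIntegral_congr_fun hΩm.compl (g := fun x => ‖h x‖ₑ ^ 2)
        fun x hx => by simp only [hgΩ x hx]]
      exact lintegral_mono_set fun x hx => hoff x hx
    · rw [← setLIntegral_const]
      refine setLIntegral_mono' hΩm fun x hx => ?_
      obtain ⟨i, hi⟩ := Set.mem_iUnion.1 hx
      rw [hgP i x hi]
      exact pow_le_pow_left' (havgα i) 2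
  have hTg : volume {x | (α / 2 : ℝ≥0∞) ≤ ‖conv1 K g x‖ₑ} ≤
      4 * A * ((α : ℝ≥0∞)⁻¹ ^ 2 * I) + 4 * A * (2 ^ (n + 2)) ^ 2 * volume Ω := by
    have h1 := mul_meas_ge_le_lintegral₀ (μ := volume) (f := fun x => ‖conv1 K g x‖ₑ ^ 2)
      ((measurable_conv1 hK.measurable hgm).enorm.pow_const 2).aemeasurable ((α / 2 : ℝ≥0∞) ^ 2)
    have h2 : {x | (α / 2 : ℝ≥0∞) ≤ ‖conv1 K g x‖ₑ} =
        {x | (α / 2 : ℝ≥0∞) ^ 2 ≤ ‖conv1 K g x‖ₑ ^ 2} := by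
      ext x; exact (ENNReal.pow_le_pow_left_iff two_ne_zero).symm
    rw [← h2] at h1
    have h3 := h1.trans ((hK.l2 g hgm ⟨_, hgB⟩).trans (mul_le_mul_right hg2 _))
    have h4 : (4 : ℝ≥0∞) * (α : ℝ≥0∞)⁻¹ ^ 2 * (α / 2 : ℝ≥0∞) ^ 2 = 1 := by
      rw [div_eq_mul_inv, mul_pow, mul_mul_mul_comm, mul_comm 4, mul_mul_mul_comm, ← mul_pow,
        ENNReal.mul_inv_cancel hα0 hαt, one_pow, one_mul, ← ENNReal.inv_pow]
      norm_num
      exact ENNReal.mul_inv_cancel (by simp) (by simp)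
    have h5 : (α : ℝ≥0∞)⁻¹ ^ 2 * α ^ 2 = 1 := by
      rw [← mul_pow, ENNReal.inv_mul_cancel hα0 hαt, one_pow]
    calc _ = 4 * (α : ℝ≥0∞)⁻¹ ^ 2 * ((α / 2 : ℝ≥0∞) ^ 2 *
            volume {x | (α / 2 : ℝ≥0∞) ≤ ‖conv1 K g x‖ₑ}) := by rw [← mul_assoc, h4, one_mul]
      _ ≤ 4 * (α : ℝ≥0∞)⁻¹ ^ 2 * (A * (I + (2 ^ (n + 2) * α) ^ 2 * volume Ω)) := by gcongr
      _ = 4 * A * ((α : ℝ≥0∞)⁻¹ ^ 2 * I) +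
            4 * A * (2 ^ (n + 2)) ^ 2 * volume Ω * ((α : ℝ≥0∞)⁻¹ ^ 2 * α ^ 2) := by ring
      _ = _ := by rw [h5, mul_one]
  -- the bad part
  set S : ι → Set (Rn1 n) := fun i =>
    {x | 2 * ρ i < ‖(x - c i).1‖ ∨ 4 * ρ i ^ 2 < |(x - c i).2|} with hS
  have hSm : ∀ i, MeasurableSet (S i) := fun i =>
    (measurableSet_lt measurable_const (measurable_id.sub_const (c i)).fst.norm).union
      (measurableSet_lt measurable_const (measurable_id.sub_const (c i)).snd.norm)
  set E := ⋃ i, (S i)ᶜ with hE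
  have hEm : MeasurableSet E := MeasurableSet.iUnion fun i => (hSm i).compl
  have hEv : volume E ≤ W * (n + 1) ^ (n + 2) * volume Ω := by
    refine (measure_iUnion_le _).trans ?_
    rw [hΩsum, ← ENNReal.tsum_mul_left]
    refine ENNReal.tsum_le_tsum fun i => ?_
    refine (volume_parabolic_box_le (c i) (hρ i)).trans_eq ?_
    rw [hPv, ← mul_assoc]
  have hTb : ∀ x, ‖conv1 K b x‖ₑ ≤
      ∑' i, ∫⁻ y in P i, ‖K (x - y) - K (x - c i)‖ₑ * ‖b y‖ₑ := fun x => by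
    have hi := integrable_conv_aux hK.integrable hbm hbB x
    rw [conv1, ← setIntegral_eq_integral_of_forall_compl_eq_zero (s := Ω)
      (fun y hy => by rw [hbΩ y hy, mul_zero]), hΩ, integral_iUnion hPm hPd hi.integrableOn]
    have hsum := hasSum_integral_iUnion hPm hPd hi.integrableOn
    refine (enorm_tsum_le_tsum_enorm).trans (ENNReal.tsum_le_tsum fun i => ?_)
    have h1 : ∫ y in P i, K (x - y) * b y = ∫ y in P i, (K (x - y) - K (x - c i)) * b y := by
      simp only [sub_mul]
      rw [integral_sub hi.integrableOn, integral_const_mul, hbint, mul_zero, sub_zero]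
      exact (((hint i).sub ((integrableOn_const (hVt i) : IntegrableOn (fun _ => avg i) (P i))) 
        ).congr_fun (fun z hz => by simp [hb, hgP i z hz]) (hPm i)).const_mul _
    rw [h1]
    refine (enorm_integral_le_lintegral_enorm _).trans_eq ?_
    simp only [enorm_mul]
  have hKm2 : ∀ i, Measurable (Function.uncurry fun (x y : Rn1 n) =>
      ‖K (x - y) - K (x - c i)‖ₑ * ‖b y‖ₑ) := fun i =>
    (((hK.measurable.comp (measurable_fst.sub measurable_snd)).sub
      (hK.measurable.comp (measurable_fst.sub_const _))).enorm).mul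
      (hbm.comp measurable_snd).enorm
  have hTbint : ∫⁻ x in Eᶜ, ‖conv1 K b x‖ₑ ≤ 2 * H * 2 ^ (n + 2) * α * volume Ω := by
    calc ∫⁻ x in Eᶜ, ‖conv1 K b x‖ₑ
        ≤ ∫⁻ x in Eᶜ, ∑' i, ∫⁻ y in P i, ‖K (x - y) - K (x - c i)‖ₑ * ‖b y‖ₑ :=
          lintegral_mono hTb
      _ = ∑' i, ∫⁻ x in Eᶜ, ∫⁻ y in P i, ‖K (x - y) - K (x - c i)‖ₑ * ‖b y‖ₑ :=
          lintegral_tsum fun i => (hKm2 i).lintegral_prod_right.aemeasurable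
      _ ≤ ∑' i, 2 * H * 2 ^ (n + 2) * α * volume (P i) := ENNReal.tsum_le_tsum fun i => by
          have hsub : Eᶜ ⊆ S i := fun x hx => by
            by_contra hxs; exact hx (Set.mem_iUnion.2 ⟨i, hxs⟩)
          refine (lintegral_mono_set hsub).trans ?_
          rw [lintegral_lintegral_swap (hKm2 i).aemeasurable]
          calc _ ≤ ∫⁻ y in P i, H * ‖b y‖ₑ := setLIntegral_mono' (hPm i) fun y hy => by
                have hKy : Measurable fun x => ‖K (x - y) - K (x - c i)‖ₑ :=
                  ((hK.measurable.comp (measurable_id.sub_const y)).sub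
                  (hK.measurable.comp (measurable_id.sub_const (c i)))).enorm
                rw [lintegral_mul_const _ hKy]
                gcongr
                exact lintegral_compl_box_le hK (hρ i) _ _ (hPc i y hy).1 (hPc i y hy).2
            _ ≤ H * (2 * (2 ^ (n + 2) * (α * volume (P i)))) := by
                rw [lintegral_const_mul _ hbm.enorm]
                gcongr
                exact hbL i
            _ = _ := by ring
      _ = _ := by rw [ENNReal.tsum_mul_left, hΩsum]
  have hTbv : volume {x | x ∈ Eᶜ ∧ (α / 2 : ℝ≥0∞) ≤ ‖conv1 K b x‖ₑ} ≤
      4 * H * 2 ^ (n + 2) * volume Ω := by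
    have h1 := mul_meas_ge_le_lintegral₀ (μ := volume.restrict Eᶜ) (f := fun x => ‖conv1 K b x‖ₑ)
      (measurable_conv1 hK.measurable hbm).enorm.aemeasurable (α / 2 : ℝ≥0∞)
    rw [Measure.restrict_apply' hEm.compl, Set.inter_comm] at h1
    have h4 : 2 * (α : ℝ≥0∞)⁻¹ * (α / 2 : ℝ≥0∞) = 1 := by
      rw [mul_comm 2, mul_assoc, ENNReal.mul_div_cancel (by simp) (by simp),
        ENNReal.inv_mul_cancel hα0 hαt]
    calc _ = 2 * (α : ℝ≥0∞)⁻¹ * ((α / 2 : ℝ≥0∞) *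
            volume (Eᶜ ∩ {x | (α / 2 : ℝ≥0∞) ≤ ‖conv1 K b x‖ₑ})) := by
          rw [← mul_assoc, h4, one_mul]; rfl
      _ ≤ 2 * (α : ℝ≥0∞)⁻¹ * (2 * H * 2 ^ (n + 2) * α * volume Ω) := by
          exact mul_le_mul_right (h1.trans hTbint) _
      _ = 4 * H * 2 ^ (n + 2) * volume Ω * ((α : ℝ≥0∞)⁻¹ * α) := by ring
      _ = _ := by rw [ENNReal.inv_mul_cancel hα0 hαt, mul_one]
  have hsub : {x | α < ‖conv1 K h x‖ₑ} ⊆ {x | (α / 2 : ℝ≥0∞) ≤ ‖conv1 K g x‖ₑ} ∪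
      (E ∪ {x | x ∈ Eᶜ ∧ (α / 2 : ℝ≥0∞) ≤ ‖conv1 K b x‖ₑ}) := by
    intro x hx
    by_contra hcon
    simp only [Set.mem_union, Set.mem_ofPred_eq, not_or, not_and, not_le, Set.mem_compl_iff]
      at hcon
    obtain ⟨h1, h2, h3⟩ := hcon
    have h4 := ENNReal.add_lt_add h1 (h3 h2)
    rw [ENNReal.add_halves] at h4
    rw [Set.mem_ofPred_eq, hconv] at hx
    exact absurd (hx.trans_le (enorm_add_le _ _)) (not_lt.2 h4.le)
  calc volume {x | α < ‖conv1 K h x‖ₑ}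
      ≤ (4 * A * ((α : ℝ≥0∞)⁻¹ ^ 2 * I) + 4 * A * (2 ^ (n + 2)) ^ 2 * volume Ω) +
        (W * (n + 1) ^ (n + 2) * volume Ω + 4 * H * 2 ^ (n + 2) * volume Ω) :=
        (measure_mono hsub).trans ((measure_union_le _ _).trans
          (add_le_add hTg ((measure_union_le _ _).trans (add_le_add hEv hTbv))))
    _ = 4 * A * ((α : ℝ≥0∞)⁻¹ ^ 2 * I) + D * volume Ω := by rw [hD]; ring
    _ ≤ 4 * A * ((α : ℝ≥0∞)⁻¹ ^ 2 * I) + D * (2 * ((α : ℝ≥0∞)⁻¹ * J)) := by gcongr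
    _ = 4 * A * ((α : ℝ≥0∞)⁻¹ ^ 2 * I) + 2 * D * ((α : ℝ≥0∞)⁻¹ * J) := by ring
    _ ≤ _ := add_le_add (mul_le_mul_left le_self_add _) (mul_le_mul_left le_add_self _)

end CalderonZygmund

section LayerCake

lemma lintegral_rpow_tail_le {p : ℝ} (hp2 : p < 2) {s : ℝ} (hs : 0 ≤ s) :
    ENNReal.ofReal s ^ 2 * ∫⁻ t in Set.Ioi 0, (Set.Ici s).indicator
      (fun t => ENNReal.ofReal (t ^ (p - 3))) t ≤
      ENNReal.ofReal (1 / (2 - p)) * ENNReal.ofReal s ^ p := by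
  rcases hs.eq_or_lt with rfl | hs
  · simp
  have h1 : ∫⁻ t in Set.Ioi 0, (Set.Ici s).indicator
      (fun t => ENNReal.ofReal (t ^ (p - 3))) t ≤ ENNReal.ofReal (s ^ (p - 2) / (2 - p)) := by
    refine (setLIntegral_le_lintegral _ _).trans ?_
    rw [lintegral_indicator measurableSet_Ici, setLIntegral_congr Ioi_ae_eq_Ici.symm,
      ← ofReal_integral_eq_lintegral_ofReal (integrableOn_Ioi_rpow_of_lt (by linarith) hs),
      integral_Ioi_rpow_of_lt (by linarith) hs]
    · refine ENNReal.ofReal_le_ofReal (le_of_eq ?_)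
      rw [show p - 3 + 1 = p - 2 by ring, neg_div, ← div_neg, neg_sub]
    · exact (ae_restrict_iff' measurableSet_Ioi).2 (Filter.Eventually.of_forall fun t ht =>
        Real.rpow_nonneg (hs.trans ht).le _)
  refine (mul_le_mul_right h1 _).trans_eq ?_
  have h2p : 0 < 2 - p := by linarith
  rw [← ENNReal.ofReal_pow hs.le, ENNReal.ofReal_rpow_of_pos hs, ← ENNReal.ofReal_mul (by positivity),
    ← ENNReal.ofReal_mul (by positivity), Real.rpow_sub hs]
  congr 1
  norm_num
  field_simp

lemma lintegral_rpow_head_le {p : ℝ} (hp : 1 < p) {s : ℝ} (hs : 0 ≤ s) :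
    ENNReal.ofReal s * ∫⁻ t in Set.Ioi 0, {t | t / 2 < s}.indicator
      (fun t => ENNReal.ofReal (t ^ (p - 2))) t ≤
      ENNReal.ofReal (2 ^ (p - 1) / (p - 1)) * ENNReal.ofReal s ^ p := by
  rcases hs.eq_or_lt with rfl | hs
  · simp
  have hp1 : 0 < p - 1 := by linarith
  have h1 : ∫⁻ t in Set.Ioi 0, {t | t / 2 < s}.indicator
      (fun t => ENNReal.ofReal (t ^ (p - 2))) t ≤ ENNReal.ofReal ((2 * s) ^ (p - 1) / (p - 1)) := by
    have hm : MeasurableSet {t : ℝ | t / 2 < s} :=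
      measurableSet_lt (by fun_prop) measurable_const
    rw [lintegral_indicator hm, Measure.restrict_restrict hm]
    have hsub : {t : ℝ | t / 2 < s} ∩ Set.Ioi 0 ⊆ Set.Ioc 0 (2 * s) := by
      rintro t ⟨h1, h2⟩
      simp only [Set.mem_ofPred_eq] at h1
      exact ⟨h2, by linarith⟩
    refine (lintegral_mono_set hsub).trans ?_
    have hi : IntervalIntegrable (fun t : ℝ => t ^ (p - 2)) volume 0 (2 * s) :=
      intervalIntegral.intervalIntegrable_rpow' (by linarith)
    rw [intervalIntegrable_iff_integrableOn_Ioc_of_le (by linarith)] at hi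
    rw [← ofReal_integral_eq_lintegral_ofReal hi,
      ← intervalIntegral.integral_of_le (by linarith), integral_rpow (Or.inl (by linarith))]
    · refine ENNReal.ofReal_le_ofReal (le_of_eq ?_)
      rw [show p - 2 + 1 = p - 1 by ring, Real.zero_rpow hp1.ne', sub_zero]
    · exact (ae_restrict_iff' measurableSet_Ioc).2 (Filter.Eventually.of_forall fun t ht =>
        Real.rpow_nonneg ht.1.le _)
  refine (mul_le_mul_right h1 _).trans_eq ?_
  rw [ENNReal.ofReal_rpow_of_pos hs, ← ENNReal.ofReal_mul (by positivity),
    ← ENNReal.ofReal_mul (by positivity), Real.mul_rpow (by norm_num) hs.le]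
  congr 1
  rw [Real.rpow_sub hs, Real.rpow_one]
  field_simp

end LayerCake

section CalderonZygmund
variable {n : ℕ}

theorem exists_cz_lp_lt_two (n : ℕ) (A H : ℝ≥0) {p : ℝ} (hp : 1 < p) (hp2 : p < 2) :
    ∃ C : ℝ≥0∞, C ≠ ∞ ∧ ∀ K : Rn1 n → ℂ, IsCZKernel K A H → ∀ h : Rn1 n → ℂ, Continuous h →
    (∃ B, ∀ z, ‖h z‖ ≤ B) → ∫⁻ x, ‖h x‖ₑ ^ p ≠ ∞ →
    ∫⁻ x, ‖conv1 K h x‖ₑ ^ p ≤ C * ∫⁻ x, ‖h x‖ₑ ^ p := by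
  obtain ⟨C, hC, hdist⟩ := exists_cz_distribution n A H
  have hp0 : 0 < p := by linarith
  refine ⟨ENNReal.ofReal p * (C * (ENNReal.ofReal (1 / (2 - p)) +
    ENNReal.ofReal (2 ^ (p - 1) / (p - 1)))), ENNReal.mul_ne_top ENNReal.ofReal_ne_top
    (ENNReal.mul_ne_top hC (by simp)), fun K hK h hc hB hN => ?_⟩
  have hm := measurable_conv1 hK.measurable hc.measurable
  have h1 : ∫⁻ x, ‖conv1 K h x‖ₑ ^ p = ∫⁻ x, ENNReal.ofReal (‖conv1 K h x‖ ^ p) := by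
    congr 1; ext x
    rw [← ofReal_norm, ENNReal.ofReal_rpow_of_nonneg (norm_nonneg _) hp0.le]
  rw [h1, lintegral_rpow_eq_lintegral_meas_lt_mul volume
    (Filter.Eventually.of_forall fun x => norm_nonneg _) hm.norm.aemeasurable hp0]
  rw [mul_assoc]
  gcongr
  set I : Rn1 n → ℝ → ℝ≥0∞ := fun x t => ENNReal.ofReal ‖h x‖ ^ 2 *
    (Set.Ici ‖h x‖).indicator (fun t => ENNReal.ofReal (t ^ (p - 3))) t with hI
  set J : Rn1 n → ℝ → ℝ≥0∞ := fun x t => ENNReal.ofReal ‖h x‖ *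
    {t | t / 2 < ‖h x‖}.indicator (fun t => ENNReal.ofReal (t ^ (p - 2))) t with hJ
  have hIm : Measurable (Function.uncurry I) := by
    refine Measurable.mul ((hc.measurable.comp measurable_fst).norm.ennreal_ofReal.pow_const 2) ?_
    have hs : MeasurableSet {z : Rn1 n × ℝ | ‖h z.1‖ ≤ z.2} :=
      measurableSet_le (hc.measurable.comp measurable_fst).norm measurable_snd
    have : Measurable fun z : Rn1 n × ℝ => ENNReal.ofReal (z.2 ^ (p - 3)) := by fun_prop
    exact this.indicator hs
  have hJm : Measurable (Function.uncurry J) := by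
    refine Measurable.mul (hc.measurable.comp measurable_fst).norm.ennreal_ofReal ?_
    have hs : MeasurableSet {z : Rn1 n × ℝ | z.2 / 2 < ‖h z.1‖} :=
      measurableSet_lt (by fun_prop) (hc.measurable.comp measurable_fst).norm
    have : Measurable fun z : Rn1 n × ℝ => ENNReal.ofReal (z.2 ^ (p - 2)) := by fun_prop
    exact this.indicator hs
  have key : ∀ t ∈ Set.Ioi (0:ℝ), volume {x | t < ‖conv1 K h x‖} * ENNReal.ofReal (t ^ (p - 1)) ≤
      C * (∫⁻ x, I x t) + C * (∫⁻ x, J x t) := by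
    intro t ht
    have ht0 : (0:ℝ) < t := ht
    have h2 := hdist K hK h hc hB p hp.le hN t.toNNReal (by simpa using ht0)
    have h3 : {x | t < ‖conv1 K h x‖} = {x | (t.toNNReal : ℝ≥0∞) < ‖conv1 K h x‖ₑ} := by
      ext x
      simp only [Set.mem_ofPred_eq]
      change _ ↔ ENNReal.ofReal t < _
      rw [← ofReal_norm, ENNReal.ofReal_lt_ofReal_iff_of_nonneg ht0.le]
    change _ ≤ C * ((ENNReal.ofReal t)⁻¹ ^ 2 * ∫⁻ x in {x | ‖h x‖ₑ ≤ ENNReal.ofReal t}, ‖h x‖ₑ ^ 2) +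
      C * ((ENNReal.ofReal t)⁻¹ * ∫⁻ x in {x | ENNReal.ofReal t / 2 < ‖h x‖ₑ}, ‖h x‖ₑ) at h2
    have hIt : ∫⁻ x, I x t = ENNReal.ofReal (t ^ (p - 3)) *
        ∫⁻ x in {x | ‖h x‖ₑ ≤ ENNReal.ofReal t}, ‖h x‖ₑ ^ 2 := by
      have hs : MeasurableSet {x | ‖h x‖ₑ ≤ ENNReal.ofReal t} :=
        measurableSet_le hc.measurable.enorm measurable_const
      rw [← lintegral_indicator hs, ← lintegral_const_mul _
        (Measurable.indicator (by fun_prop) hs)]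
      refine lintegral_congr fun x => ?_
      have hiff : ‖h x‖ₑ ≤ ENNReal.ofReal t ↔ ‖h x‖ ≤ t := by
        rw [← ofReal_norm, ENNReal.ofReal_le_ofReal_iff ht0.le]
      by_cases hx : ‖h x‖ ≤ t
      · simp only [hI, Set.indicator, Set.mem_Ici, Set.mem_ofPred_eq, hiff, hx, if_true, ofReal_norm]
        ring
      · simp only [hI, Set.indicator, Set.mem_Ici, Set.mem_ofPred_eq, hiff, hx, if_false, mul_zero]
    have hJt : ∫⁻ x, J x t = ENNReal.ofReal (t ^ (p - 2)) *
        ∫⁻ x in {x | ENNReal.ofReal t / 2 < ‖h x‖ₑ}, ‖h x‖ₑ := by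
      have hs : MeasurableSet {x | ENNReal.ofReal t / 2 < ‖h x‖ₑ} :=
        measurableSet_lt measurable_const hc.measurable.enorm
      rw [← lintegral_indicator hs, ← lintegral_const_mul _
        (Measurable.indicator (by fun_prop) hs)]
      refine lintegral_congr fun x => ?_
      have hiff : ENNReal.ofReal t / 2 < ‖h x‖ₑ ↔ t / 2 < ‖h x‖ := by
        rw [← ofReal_norm, show ENNReal.ofReal t / 2 = ENNReal.ofReal (t / 2) by
          rw [ENNReal.ofReal_div_of_pos two_pos, ENNReal.ofReal_ofNat],
          ENNReal.ofReal_lt_ofReal_iff_of_nonneg (by positivity)]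
      by_cases hx : t / 2 < ‖h x‖
      · simp only [hJ, Set.indicator, Set.mem_ofPred_eq, hiff, hx, if_true, ofReal_norm]
        ring
      · simp only [hJ, Set.indicator, Set.mem_ofPred_eq, hiff, hx, if_false, mul_zero]
    have e1 : (ENNReal.ofReal t)⁻¹ ^ 2 * ENNReal.ofReal (t ^ (p - 1)) =
        ENNReal.ofReal (t ^ (p - 3)) := by
      rw [← ENNReal.ofReal_inv_of_pos ht0, ← ENNReal.ofReal_pow (by positivity),
        ← ENNReal.ofReal_mul (by positivity), show p - 1 = p - 3 + 2 by ring,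
        Real.rpow_add ht0, Real.rpow_two]
      congr 1
      field_simp
    have e2 : (ENNReal.ofReal t)⁻¹ * ENNReal.ofReal (t ^ (p - 1)) =
        ENNReal.ofReal (t ^ (p - 2)) := by
      rw [← ENNReal.ofReal_inv_of_pos ht0,
        ← ENNReal.ofReal_mul (by positivity), show p - 1 = p - 2 + 1 by ring,
        Real.rpow_add ht0, Real.rpow_one]
      congr 1
      field_simp
    rw [h3, hIt, hJt, ← e1, ← e2]
    refine (mul_le_mul_left h2 _).trans_eq ?_
    ring
  calc _ ≤ ∫⁻ t in Set.Ioi (0:ℝ), (C * (∫⁻ x, I x t) + C * (∫⁻ x, J x t)) :=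
        setLIntegral_mono' measurableSet_Ioi key
    _ = C * (∫⁻ x, ∫⁻ t in Set.Ioi (0:ℝ), I x t) + C * (∫⁻ x, ∫⁻ t in Set.Ioi (0:ℝ), J x t) := by
        rw [lintegral_add_left (hIm.lintegral_prod_left.const_mul C), lintegral_const_mul _
          hIm.lintegral_prod_left, lintegral_const_mul _ hJm.lintegral_prod_left,
          lintegral_lintegral_swap hIm.aemeasurable, lintegral_lintegral_swap hJm.aemeasurable]
    _ ≤ C * (∫⁻ x, ENNReal.ofReal (1 / (2 - p)) * ‖h x‖ₑ ^ p) +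
          C * (∫⁻ x, ENNReal.ofReal (2 ^ (p - 1) / (p - 1)) * ‖h x‖ₑ ^ p) := by
        gcongr with x x
        · have hx : Measurable ((Set.Ici ‖h x‖).indicator fun t => ENNReal.ofReal (t ^ (p - 3))) :=
            Measurable.indicator (by fun_prop) measurableSet_Ici
          simp only [hI]
          rw [lintegral_const_mul _ hx, ← ofReal_norm]
          exact lintegral_rpow_tail_le hp2 (norm_nonneg _)
        · have hx : Measurable ({t | t / 2 < ‖h x‖}.indicator
              fun t => ENNReal.ofReal (t ^ (p - 2))) :=
            Measurable.indicator (by fun_prop) (measurableSet_lt (by fun_prop) measurable_const)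
          simp only [hJ]
          rw [lintegral_const_mul _ hx, ← ofReal_norm]
          exact lintegral_rpow_head_le hp (norm_nonneg _)
    _ = _ := by
        rw [lintegral_const_mul _ (by fun_prop), lintegral_const_mul _ (by fun_prop)]
        ring

/-- Young's inequality for an integrable kernel. -/
lemma lintegral_conv_rpow_le {K g : Rn1 n → ℂ} (hK : Measurable K) (hg : Measurable g) {p : ℝ}
    (hp : 1 ≤ p) : ∫⁻ x, (∫⁻ y, ‖K (x - y)‖ₑ * ‖g y‖ₑ) ^ p ≤
      (∫⁻ y, ‖K y‖ₑ) ^ p * ∫⁻ x, ‖g x‖ₑ ^ p := by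
  have h1 : ∀ x, ∫⁻ y, ‖K (x - y)‖ₑ * ‖g y‖ₑ =
      ∫⁻ y, ‖g (x - y)‖ₑ ∂(volume.withDensity fun y => ‖K y‖ₑ) := fun x => by
    have hx : Measurable fun y => ‖g (x - y)‖ₑ := (hg.comp (measurable_const.sub measurable_id)).enorm
    rw [lintegral_withDensity_eq_lintegral_mul _ hK.enorm hx,
      ← lintegral_sub_left_eq_self _ x]
    simp
  simp only [h1]
  refine (lintegral_lintegral_rpow_le volume _ hp (a := fun x y => ‖g (x - y)‖ₑ)
    (M := ∫⁻ x, ‖g x‖ₑ ^ p) ?_ fun y => ?_).trans_eq ?_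
  · exact (hg.comp (measurable_fst.sub measurable_snd)).enorm
  · exact (lintegral_sub_right_eq_self (fun x => ‖g x‖ₑ ^ p) y).le
  · rw [withDensity_apply _ MeasurableSet.univ, Measure.restrict_univ]

lemma continuous_conv1 {K h : Rn1 n → ℂ} (hK : Integrable K) (hc : Continuous h) {B : ℝ}
    (hB : ∀ z, ‖h z‖ ≤ B) : Continuous (conv1 K h) := by
  have h1 : conv1 K h = fun x => ∫ y, K y * h (x - y) := by
    ext x
    rw [conv1, ← integral_sub_left_eq_self _ volume x]
    simp
  rw [h1]
  refine continuous_of_dominated (bound := fun y => ‖K y‖ * B) (fun x => ?_)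
    (fun x => Filter.Eventually.of_forall fun y => ?_) (hK.norm.mul_const B)
    (Filter.Eventually.of_forall fun y => by fun_prop)
  · exact hK.aestronglyMeasurable.mul (by fun_prop : Continuous fun y => h (x - y)).aestronglyMeasurable
  · rw [norm_mul]
    exact mul_le_mul_of_nonneg_left (hB _) (norm_nonneg _)

lemma norm_conv1_le {K h : Rn1 n → ℂ} (hK : Integrable K) {B : ℝ}
    (hB : ∀ z, ‖h z‖ ≤ B) (x : Rn1 n) : ‖conv1 K h x‖ ≤ (∫ y, ‖K y‖) * B := by
  rw [← integral_sub_left_eq_self (fun y => ‖K y‖) volume x, ← integral_mul_const]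
  refine norm_integral_le_of_norm_le ((hK.norm.comp_sub_left x).mul_const B)
    (Filter.Eventually.of_forall fun y => ?_)
  rw [norm_mul]
  exact mul_le_mul_of_nonneg_left (hB _) (norm_nonneg _)

end CalderonZygmund

section Duality
variable {n : ℕ}

lemma conv1_reflect (K g : Rn1 n → ℂ) (y : Rn1 n) :
    conv1 K (fun z => g (-z)) (-y) = ∫ x, K (x - y) * g x := by
  rw [conv1, ← integral_neg_eq_self]
  refine integral_congr_ae (Filter.Eventually.of_forall fun x => ?_)
  simp only [neg_neg]
  congr 2
  abel

lemma enorm_conv1_le (K h : Rn1 n → ℂ) (x : Rn1 n) :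
    ‖conv1 K h x‖ₑ ≤ ∫⁻ y, ‖K (x - y)‖ₑ * ‖h y‖ₑ := by
  refine (enorm_integral_le_lintegral_enorm _).trans_eq ?_
  simp only [enorm_mul]

set_option maxHeartbeats 800000 in
theorem exists_cz_lp_two_lt (n : ℕ) (A H : ℝ≥0) {p : ℝ} (hp2 : 2 < p) :
    ∃ C : ℝ≥0∞, C ≠ ∞ ∧ ∀ K : Rn1 n → ℂ, IsCZKernel K A H → ∀ h : Rn1 n → ℂ, Continuous h →
    (∃ B, ∀ z, ‖h z‖ ≤ B) → ∫⁻ x, ‖h x‖ₑ ^ p ≠ ∞ →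
    ∫⁻ x, ‖conv1 K h x‖ₑ ^ p ≤ C * ∫⁻ x, ‖h x‖ₑ ^ p := by
  have hp0 : 0 < p := by linarith
  have hp1 : 0 < p - 1 := by linarith
  set q : ℝ := p / (p - 1) with hq
  have hpq : p.HolderConjugate q := Real.HolderConjugate.conjExponent (by linarith)
  have hq1 : 1 < q := hpq.symm.lt
  have hq0 : 0 < q := by linarith
  have hq2 : q < 2 := by rw [hq, div_lt_iff₀ hp1]; linarith
  obtain ⟨C, hC, hCq⟩ := exists_cz_lp_lt_two n A H hq1 hq2
  refine ⟨C ^ (p / q), ENNReal.rpow_ne_top_of_nonneg (by positivity) hC,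
    fun K hK h hc ⟨B, hB⟩ hN => ?_⟩
  have hK1 : (∫⁻ y, ‖K y‖ₑ) ≠ ∞ := hK.integrable.2.ne
  set u := conv1 K h with hu
  have huc : Continuous u := continuous_conv1 hK.integrable hc hB
  have hYoung : ∫⁻ x, (∫⁻ y, ‖K (x - y)‖ₑ * ‖h y‖ₑ) ^ p ≠ ∞ :=
    ne_top_of_le_ne_top (ENNReal.mul_ne_top (ENNReal.rpow_ne_top_of_nonneg hp0.le hK1) hN)
      (lintegral_conv_rpow_le hK.measurable hc.measurable (by linarith))
  set N := ∫⁻ x, ‖u x‖ₑ ^ p with hNdef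
  have hNt : N ≠ ∞ := ne_top_of_le_ne_top hYoung
    (lintegral_mono fun x => ENNReal.rpow_le_rpow (enorm_conv1_le K h x) hp0.le)
  set g : Rn1 n → ℂ := fun x => ((‖u x‖ ^ (p - 2) : ℝ) : ℂ) * (starRingEnd ℂ) (u x) with hg
  have hgc : Continuous g := by
    refine (Complex.continuous_ofReal.comp (huc.norm.rpow_const fun x => Or.inr (by linarith))).mul
      (Complex.continuous_conj.comp huc)
  have hgn : ∀ x, ‖g x‖ = ‖u x‖ ^ (p - 1) := fun x => by
    simp only [hg, norm_mul, Complex.norm_real, RCLike.norm_conj]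
    rw [Real.norm_of_nonneg (by positivity)]
    rcases (norm_nonneg (u x)).eq_or_lt with h0 | h0
    · rw [← h0, mul_zero, Real.zero_rpow hp1.ne']
    · rw [← Real.rpow_add_one h0.ne']; congr 1; ring
  have hge : ∀ x, ‖g x‖ₑ ^ q = ‖u x‖ₑ ^ p := fun x => by
    rw [← ofReal_norm, hgn, ← ofReal_norm, ← ENNReal.ofReal_rpow_of_nonneg (norm_nonneg _) hp1.le,
      ← ENNReal.rpow_mul]
    congr 1
    rw [hq]; field_simp
  have hgB : ∀ x, ‖g x‖ ≤ ((∫ y, ‖K y‖) * B) ^ (p - 1) := fun x => by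
    rw [hgn]
    exact Real.rpow_le_rpow (norm_nonneg _) (norm_conv1_le hK.integrable hB x) hp1.le
  have hug : ∀ x, u x * g x = ((‖u x‖ ^ p : ℝ) : ℂ) := fun x => by
    simp only [hg]
    rw [mul_left_comm, Complex.mul_conj, Complex.normSq_eq_norm_sq, ← Complex.ofReal_mul]
    congr 1
    rcases (norm_nonneg (u x)).eq_or_lt with h0 | h0
    · rw [← h0, Real.zero_rpow hp0.ne']; simp
    · rw [← Real.rpow_two, ← Real.rpow_add h0]; congr 1; ring
  have hNg : ∫⁻ x, ‖g x‖ₑ ^ q = N := by simp only [hge, hNdef]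
  have hN1 : N = ‖∫ x, u x * g x‖ₑ := by
    simp only [hug]
    rw [integral_complex_ofReal, ← ofReal_norm, Complex.norm_real,
      Real.norm_of_nonneg (integral_nonneg fun x => by positivity),
      integral_eq_lintegral_of_nonneg_ae (Filter.Eventually.of_forall fun x => by positivity)
      (huc.norm.rpow_const fun x => Or.inr hp0.le).aestronglyMeasurable]
    have : ∀ x, ENNReal.ofReal (‖u x‖ ^ p) = ‖u x‖ₑ ^ p := fun x => by
      rw [← ofReal_norm, ENNReal.ofReal_rpow_of_nonneg (norm_nonneg _) hp0.le]
    simp only [this]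
    rw [ENNReal.ofReal_toReal hNt]
  set w : Rn1 n → ℂ := fun y => ∫ x, K (x - y) * g x with hw
  have hwN : ∫⁻ y, ‖w y‖ₑ ^ q ≤ C * N := by
    have h1 := hCq K hK (fun z => g (-z)) (hgc.comp continuous_neg) ⟨_, fun z => hgB (-z)⟩ (by
      rw [lintegral_neg_eq_self (fun z => ‖g z‖ₑ ^ q), hNg]; exact hNt)
    rw [lintegral_neg_eq_self (fun z => ‖g z‖ₑ ^ q), hNg, ← lintegral_neg_eq_self] at h1
    simpa only [conv1_reflect] using h1
  have hwm : Measurable w := by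
    have : w = fun y => conv1 K (fun z => g (-z)) (-y) := by ext y; rw [conv1_reflect]
    rw [this]
    exact ((continuous_conv1 hK.integrable (hgc.comp continuous_neg) fun z => hgB (-z)).comp
      continuous_neg).measurable
  have hint : Integrable (fun z : Rn1 n × Rn1 n => K (z.1 - z.2) * h z.2 * g z.1)
      (volume.prod volume) := by
    have hm : Measurable fun z : Rn1 n × Rn1 n => K (z.1 - z.2) * h z.2 * g z.1 :=
      ((hK.measurable.comp (measurable_fst.sub measurable_snd)).mul
        (hc.measurable.comp measurable_snd)).mul (hgc.measurable.comp measurable_fst)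
    refine ⟨hm.aestronglyMeasurable, ?_⟩
    rw [hasFiniteIntegral_iff_enorm, lintegral_prod _ hm.enorm.aemeasurable]
    simp only [enorm_mul]
    have hm2 : Measurable fun z : Rn1 n × Rn1 n => ‖K (z.1 - z.2)‖ₑ * ‖h z.2‖ₑ :=
      (hK.measurable.comp (measurable_fst.sub measurable_snd)).enorm.mul
        (hc.measurable.comp measurable_snd).enorm
    have h1 : ∀ x, ∫⁻ y, ‖K (x - y)‖ₑ * ‖h y‖ₑ * ‖g x‖ₑ =
        (∫⁻ y, ‖K (x - y)‖ₑ * ‖h y‖ₑ) * ‖g x‖ₑ := fun x =>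
      lintegral_mul_const _ ((hK.measurable.comp (measurable_const.sub measurable_id)).enorm.mul
        hc.measurable.enorm)
    simp only [h1]
    refine (ENNReal.lintegral_mul_le_Lp_mul_Lq volume hpq hm2.lintegral_prod_right'.aemeasurable
      hgc.measurable.enorm.aemeasurable).trans_lt ?_
    rw [hNg]
    exact ENNReal.mul_lt_top (ENNReal.rpow_lt_top_of_nonneg (by positivity) hYoung)
      (ENNReal.rpow_lt_top_of_nonneg (by positivity) hNt)
  have hdual : ∫ x, u x * g x = ∫ y, h y * w y := by
    have h1 : ∀ x, u x * g x = ∫ y, K (x - y) * h y * g x := fun x => by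
      rw [integral_mul_const]; rfl
    simp only [h1]
    rw [integral_integral_swap hint]
    refine integral_congr_ae (Filter.Eventually.of_forall fun y => ?_)
    simp only [hw]
    rw [← integral_const_mul]
    refine integral_congr_ae (Filter.Eventually.of_forall fun x => ?_)
    simp only
    ring
  set M := ∫⁻ x, ‖h x‖ₑ ^ p with hM
  have hmain : N ≤ M ^ (1 / p) * (C * N) ^ (1 / q) := by
    calc N = ‖∫ y, h y * w y‖ₑ := by rw [hN1, hdual]
      _ ≤ ∫⁻ y, ‖h y‖ₑ * ‖w y‖ₑ := by
        refine (enorm_integral_le_lintegral_enorm _).trans_eq ?_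
        simp only [enorm_mul]
      _ ≤ M ^ (1 / p) * (∫⁻ y, ‖w y‖ₑ ^ q) ^ (1 / q) :=
        ENNReal.lintegral_mul_le_Lp_mul_Lq volume hpq hc.measurable.enorm.aemeasurable
          hwm.enorm.aemeasurable
      _ ≤ _ := by gcongr
  rcases eq_or_ne N 0 with h0 | h0
  · rw [h0]; exact zero_le
  have hs : N ^ (1 / p) * N ^ (1 / q) = N := by
    rw [← ENNReal.rpow_add _ _ h0 hNt, one_div, one_div, hpq.inv_add_inv_eq_one, ENNReal.rpow_one]
  have h2 : N ^ (1 / p) ≤ M ^ (1 / p) * C ^ (1 / q) := by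
    rw [ENNReal.mul_rpow_of_nonneg _ _ (by positivity), ← mul_assoc] at hmain
    nth_rw 1 [← hs] at hmain
    exact (ENNReal.mul_le_mul_iff_left (by
      simp [ENNReal.rpow_eq_zero_iff, h0, hNt]) (ENNReal.rpow_ne_top_of_nonneg (by positivity) hNt)).1 hmain
  calc N = (N ^ (1 / p)) ^ p := by rw [← ENNReal.rpow_mul, one_div_mul_cancel hp0.ne', ENNReal.rpow_one]
    _ ≤ (M ^ (1 / p) * C ^ (1 / q)) ^ p := by gcongr
    _ = _ := by
      rw [ENNReal.mul_rpow_of_nonneg _ _ hp0.le, ← ENNReal.rpow_mul, one_div_mul_cancel hp0.ne',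
        ENNReal.rpow_one, ← ENNReal.rpow_mul, mul_comm]
      congr 2
      ring

theorem exists_cz_lp (n : ℕ) (A H : ℝ≥0) {p : ℝ} (hp : 1 < p) :
    ∃ C : ℝ≥0∞, C ≠ ∞ ∧ ∀ K : Rn1 n → ℂ, IsCZKernel K A H → ∀ h : Rn1 n → ℂ, Continuous h →
    (∃ B, ∀ z, ‖h z‖ ≤ B) → ∫⁻ x, ‖h x‖ₑ ^ p ≠ ∞ →
    ∫⁻ x, ‖conv1 K h x‖ₑ ^ p ≤ C * ∫⁻ x, ‖h x‖ₑ ^ p := by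
  rcases lt_trichotomy p 2 with h2 | rfl | h2
  · exact exists_cz_lp_lt_two n A H hp h2
  · refine ⟨A, ENNReal.coe_ne_top, fun K hK h hc hB _ => ?_⟩
    simpa using hK.l2 h hc.measurable hB
  · exact exists_cz_lp_two_lt n A H h2

/-- Calderón–Zygmund kernels give `Lᵖ` multipliers, uniformly. -/
theorem exists_isLpMult_of_cz (n : ℕ) (A H : ℝ≥0) {p : ℝ} (hp : 1 < p) :
    ∃ C : ℝ≥0, ∀ K : Rn1 n → ℂ, IsCZKernel K A H → IsLpMult p (FT1 K) C := by
  obtain ⟨C, hC, h⟩ := exists_cz_lp n A H hp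
  have hp0 : 0 < p := by linarith
  refine ⟨((C + 1) ^ (1 / p)).toNNReal, fun K hK => ?_⟩
  have hY := IsLpMult.FT1 hp.le hK.integrable hK.measurable
  refine ⟨hY.measurable, hY.bounded, fun F hFm hF => ?_⟩
  have hct : (C + 1) ^ (1 / p) ≠ ∞ := ENNReal.rpow_ne_top_of_nonneg (by positivity) (by simp [hC])
  rw [ENNReal.coe_toNNReal hct]
  have e1 : IFT1 (fun q => FT1 K q * F q) = conv1 K (IFT1 F) := by
    ext x
    rw [IFT1_FT1_mul hK.integrable hF, conv1, ← integral_sub_left_eq_self _ volume x]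
    simp
  rw [e1]
  refine (ENNReal.rpow_le_rpow_iff hp0).1 ?_
  rw [ENNReal.mul_rpow_of_nonneg _ _ hp0.le, ← ENNReal.rpow_mul, one_div_mul_cancel hp0.ne',
    ENNReal.rpow_one, pNorm_rpow hp0, pNorm_rpow hp0]
  by_cases hfin : ∫⁻ x, ‖IFT1 F x‖ₑ ^ p = ∞
  · rw [hfin, ENNReal.mul_top (by simp)]; exact le_top
  · refine (h K hK _ (continuous_IFT1 hF) ⟨_, norm_IFT1_le F⟩ hfin).trans ?_
    gcongr
    exact le_self_add

end Duality

section Schwartz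
variable {n : ℕ}
open FourierTransform

/-- The Hilbert space structure on `ℝⁿ × ℝ`. -/
abbrev HilbertRn1 (n : ℕ) : Type := WithLp 2 (Rn n × ℝ)

lemma inner_toLp_eq_pairing (q x : Rn1 n) :
    inner ℝ (WithLp.toLp 2 q : HilbertRn1 n) (WithLp.toLp 2 x) = pairing q x := by
  rw [WithLp.prod_inner_apply]
  simp [pairing, PiLp.inner_apply, mul_comm]

lemma FT1_eq_fourier (f : Rn1 n → ℂ) (q : Rn1 n) :
    FT1 f q = 𝓕 (fun v : HilbertRn1 n => f (WithLp.ofLp v)) (WithLp.toLp 2 q) := by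
  rw [Real.fourier_eq', ← (WithLp.volume_preserving_toLp (Rn n) ℝ).integral_comp
    (MeasurableEquiv.toLp 2 (Rn n × ℝ)).measurableEmbedding, FT1]
  refine integral_congr_ae (Filter.Eventually.of_forall fun x => ?_)
  simp only [inner_toLp_eq_pairing, smul_eq_mul, pairing]
  congr 2
  push_cast
  ring

lemma IFT1_eq_fourierInv (f : Rn1 n → ℂ) (x : Rn1 n) :
    IFT1 f x = 𝓕⁻ (fun v : HilbertRn1 n => f (WithLp.ofLp v)) (WithLp.toLp 2 x) := by
  rw [Real.fourierInv_eq', ← (WithLp.volume_preserving_toLp (Rn n) ℝ).integral_comp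
    (MeasurableEquiv.toLp 2 (Rn n × ℝ)).measurableEmbedding, IFT1]
  refine integral_congr_ae (Filter.Eventually.of_forall fun x => ?_)
  simp only [inner_toLp_eq_pairing, smul_eq_mul, pairing]
  congr 2
  push_cast
  ring

/-- A Schwartz function on `ℝⁿ × ℝ`, seen on the Hilbert space. -/
def toHilbert (φ : SchwartzMap (Rn1 n) ℂ) : SchwartzMap (HilbertRn1 n) ℂ :=
  SchwartzMap.compCLMOfContinuousLinearEquiv ℂ (WithLp.prodContinuousLinearEquiv 2 ℝ (Rn n) ℝ) φ

/-- The Fourier transform of a Schwartz function on `ℝⁿ × ℝ`. -/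
def schwartzFT (φ : SchwartzMap (Rn1 n) ℂ) : SchwartzMap (Rn1 n) ℂ :=
  SchwartzMap.compCLMOfContinuousLinearEquiv ℂ
    (WithLp.prodContinuousLinearEquiv 2 ℝ (Rn n) ℝ).symm (𝓕 (toHilbert φ))

lemma coe_schwartzFT (φ : SchwartzMap (Rn1 n) ℂ) : ⇑(schwartzFT φ) = FT1 φ := by
  ext q
  rw [FT1_eq_fourier]
  rfl

lemma IFT1_FT1 (φ : SchwartzMap (Rn1 n) ℂ) : IFT1 (FT1 φ) = φ := by
  ext x
  rw [IFT1_eq_fourierInv]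
  have h1 : (fun v : HilbertRn1 n => FT1 φ (WithLp.ofLp v)) =
      ((𝓕 (toHilbert φ) : SchwartzMap (HilbertRn1 n) ℂ) : HilbertRn1 n → ℂ) := by
    ext v
    rw [FT1_eq_fourier]
    rfl
  rw [h1, ← SchwartzMap.fourierInv_coe, FourierTransform.fourierInv_fourier_eq]
  rfl

lemma lintegral_enorm_sq_FT1 (φ : SchwartzMap (Rn1 n) ℂ) :
    ∫⁻ q, ‖FT1 φ q‖ₑ ^ 2 = ∫⁻ x, ‖φ x‖ₑ ^ 2 := by
  have h := SchwartzMap.integral_norm_sq_fourier (toHilbert φ)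
  rw [← (WithLp.volume_preserving_toLp (Rn n) ℝ).integral_comp
    (MeasurableEquiv.toLp 2 (Rn n × ℝ)).measurableEmbedding,
    ← (WithLp.volume_preserving_toLp (Rn n) ℝ).integral_comp
    (MeasurableEquiv.toLp 2 (Rn n × ℝ)).measurableEmbedding] at h
  have h2 : ∫ q, ‖schwartzFT φ q‖ ^ 2 = ∫ x, ‖φ x‖ ^ 2 := h
  have h3 : ∀ ψ : SchwartzMap (Rn1 n) ℂ, ∫⁻ x, ‖ψ x‖ₑ ^ 2 = ENNReal.ofReal (∫ x, ‖ψ x‖ ^ 2) := by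
    intro ψ
    rw [ofReal_integral_eq_lintegral_ofReal]
    · refine lintegral_congr fun x => ?_
      rw [ENNReal.ofReal_pow (norm_nonneg _), ofReal_norm]
    · exact (ψ.memLp 2 volume).integrable_norm_pow two_ne_zero
    · exact Filter.Eventually.of_forall fun x => by positivity
  rw [← coe_schwartzFT, h3, h3, h2]

end Schwartz

section LTwo
variable {n : ℕ}

lemma eLpNorm_two_sq (f : Rn1 n → ℂ) : eLpNorm f 2 volume ^ 2 = ∫⁻ x, ‖f x‖ₑ ^ 2 := by
  have := pNorm_rpow (p := 2) two_pos f
  rw [pNorm, ENNReal.ofReal_ofNat] at this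
  simpa using this

lemma lintegral_enorm_mul_le_eLpNorm_two {f g : Rn1 n → ℂ} (hf : Measurable f) (hg : Measurable g) :
    ∫⁻ x, ‖f x‖ₑ * ‖g x‖ₑ ≤ eLpNorm f 2 volume * eLpNorm g 2 volume := by
  have h := ENNReal.lintegral_mul_le_Lp_mul_Lq volume Real.HolderConjugate.two_two
    hf.enorm.aemeasurable hg.enorm.aemeasurable
  have e : ∀ u : Rn1 n → ℂ, eLpNorm u 2 volume = (∫⁻ x, ‖u x‖ₑ ^ (2:ℝ)) ^ (1 / (2:ℝ)) := fun u => by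
    have := pNorm_eq_lintegral (p := 2) two_pos u
    rwa [pNorm, ENNReal.ofReal_ofNat] at this
  rw [e, e]
  exact h

lemma eLpNorm_two_FT1 (φ : SchwartzMap (Rn1 n) ℂ) :
    eLpNorm (FT1 φ) 2 volume = eLpNorm φ 2 volume := by
  refine (ENNReal.pow_right_strictMono two_ne_zero).injective ?_
  simp only [eLpNorm_two_sq, lintegral_enorm_sq_FT1]

lemma IFT1_eq_FT1_neg (f : Rn1 n → ℂ) (x : Rn1 n) : IFT1 f x = FT1 f (-x) := by
  rw [FT1_eq, IFT1_eq]
  refine integral_congr_ae (Filter.Eventually.of_forall fun y => ?_)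
  simp only [character]
  rw [pairing_comm (-x), pairing_neg, pairing_comm (-y), pairing_neg, neg_neg, pairing_comm y x]

lemma eLpNorm_two_IFT1 (φ : SchwartzMap (Rn1 n) ℂ) :
    eLpNorm (IFT1 φ) 2 volume = eLpNorm φ 2 volume := by
  rw [← eLpNorm_two_FT1]
  refine (ENNReal.pow_right_strictMono two_ne_zero).injective ?_
  simp only [eLpNorm_two_sq, IFT1_eq_FT1_neg]
  exact lintegral_neg_eq_self (fun x => ‖FT1 φ x‖ₑ ^ 2)

lemma integral_IFT1_mul {G ψ : Rn1 n → ℂ} (hG : Integrable G) (hψ : Integrable ψ) :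
    ∫ x, IFT1 G x * ψ x = ∫ q, G q * IFT1 ψ q := by
  have hint : Integrable (fun z : Rn1 n × Rn1 n => character z.2 z.1 * (ψ z.1 * G z.2))
      (volume.prod volume) :=
    (hψ.mul_prod hG).bdd_mul (c := 1)
      (continuous_character.comp continuous_swap).aestronglyMeasurable
      (Filter.Eventually.of_forall fun z => (norm_character z.2 z.1).le)
  have h1 : ∀ x, IFT1 G x * ψ x = ∫ q, character q x * (ψ x * G q) := fun x => by
    rw [IFT1_eq, ← integral_mul_const]
    congr 1; ext q; ring
  simp only [h1]
  rw [integral_integral_swap hint]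
  congr 1; ext q
  rw [IFT1_eq, ← integral_const_mul]
  congr 1; ext x
  rw [character_comm]; ring

lemma integrable_FT1 (φ : SchwartzMap (Rn1 n) ℂ) : Integrable (FT1 φ) := by
  rw [← coe_schwartzFT]; exact (schwartzFT φ).integrable

lemma conv1_eq_IFT1 {K : Rn1 n → ℂ} (hK : Integrable K) (φ : SchwartzMap (Rn1 n) ℂ) :
    conv1 K φ = IFT1 (fun q => FT1 K q * FT1 φ q) := by
  ext x
  rw [IFT1_FT1_mul hK (integrable_FT1 φ), conv1, ← integral_sub_left_eq_self _ volume x, IFT1_FT1]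
  simp

lemma measurable_FT1 {K : Rn1 n → ℂ} (hK : Integrable K) : Measurable (FT1 K) := by
  have : FT1 K = fun q => IFT1 K (-q) := by ext q; rw [IFT1_eq_FT1_neg, neg_neg]
  rw [this]
  exact ((continuous_IFT1 hK).comp continuous_neg).measurable

lemma enorm_integral_conv1_mul_le {K : Rn1 n → ℂ} (hK : Integrable K) {A : ℝ≥0}
    (hA : ∀ q, ‖FT1 K q‖ ≤ A) (φ ψ : SchwartzMap (Rn1 n) ℂ) :
    ‖∫ x, conv1 K φ x * ψ x‖ₑ ≤ A * eLpNorm φ 2 volume * eLpNorm ψ 2 volume := by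
  have hA' : ∀ q, ‖FT1 K q‖ₑ ≤ A := fun q => by
    rw [← ofReal_norm]; exact (ENNReal.ofReal_le_ofReal (hA q)).trans_eq (by simp)
  have hKm := measurable_FT1 hK
  have hG : Integrable fun q => FT1 K q * FT1 φ q :=
    (integrable_FT1 φ).bdd_mul (c := A) hKm.aestronglyMeasurable (Filter.Eventually.of_forall hA)
  rw [conv1_eq_IFT1 hK, integral_IFT1_mul hG ψ.integrable]
  calc _ ≤ ∫⁻ q, A * (‖FT1 φ q‖ₑ * ‖IFT1 ψ q‖ₑ) := by
        refine (enorm_integral_le_lintegral_enorm _).trans (lintegral_mono fun q => ?_)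
        simp only [enorm_mul, mul_assoc]
        gcongr
        exact hA' q
    _ = A * ∫⁻ q, ‖FT1 φ q‖ₑ * ‖IFT1 ψ q‖ₑ := lintegral_const_mul' _ _ ENNReal.coe_ne_top
    _ ≤ A * (eLpNorm (FT1 φ) 2 volume * eLpNorm (IFT1 ψ) 2 volume) := by
        gcongr
        exact lintegral_enorm_mul_le_eLpNorm_two (measurable_FT1 φ.integrable)
          (continuous_IFT1 ψ.integrable).measurable
    _ = _ := by rw [eLpNorm_two_FT1, eLpNorm_two_IFT1, mul_assoc]

lemma exists_schwartz_eLpNorm_sub_le {f : Rn1 n → ℂ} (hf : MemLp f 2 volume) {ε : ℝ} (hε : 0 < ε) :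
    ∃ ψ : SchwartzMap (Rn1 n) ℂ, eLpNorm (f - ⇑ψ) 2 volume ≤ ENNReal.ofReal ε := by
  obtain ⟨g, hg1, hg2, hg3⟩ := hf.exist_eLpNorm_sub_le (by simp) (by norm_num) hε
  exact ⟨hg1.toSchwartzMap hg2, hg3⟩

lemma eLpNorm_two_conv1_le {K g : Rn1 n → ℂ} (hK : Measurable K) (hg : Measurable g) :
    eLpNorm (conv1 K g) 2 volume ≤ (∫⁻ y, ‖K y‖ₑ) * eLpNorm g 2 volume := by
  rw [← ENNReal.pow_le_pow_left_iff two_ne_zero, mul_pow, eLpNorm_two_sq, eLpNorm_two_sq]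
  have := lintegral_conv_rpow_le hK hg (p := 2) (by norm_num)
  simp only [ENNReal.rpow_ofNat] at this
  refine le_trans (lintegral_mono fun x => ?_) this
  gcongr
  exact enorm_conv1_le K g x

lemma eLpNorm_two_conv1_schwartz_le {K : Rn1 n → ℂ} (hK : Integrable K) (hKm : Measurable K)
    {A : ℝ≥0} (hA : ∀ q, ‖FT1 K q‖ ≤ A) (φ : SchwartzMap (Rn1 n) ℂ) :
    eLpNorm (conv1 K φ) 2 volume ≤ A * eLpNorm φ 2 volume := by
  set u := conv1 K φ with hu
  set U := eLpNorm u 2 volume with hU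
  set Φ := eLpNorm φ 2 volume with hΦ
  have hum : Measurable u := measurable_conv1 hKm φ.continuous.measurable
  have hΦt : Φ ≠ ∞ := (φ.memLp 2 volume).2.ne
  have hUt : U ≠ ∞ := ne_top_of_le_ne_top (ENNReal.mul_ne_top hK.2.ne hΦt)
    (eLpNorm_two_conv1_le hKm φ.continuous.measurable)
  have hcm : Measurable fun x => (starRingEnd ℂ) (u x) := Complex.continuous_conj.measurable.comp hum
  have hconj : eLpNorm (fun x => (starRingEnd ℂ) (u x)) 2 volume = U :=
    eLpNorm_congr_norm_ae (Filter.Eventually.of_forall fun x => RCLike.norm_conj _)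
  have hcL : MemLp (fun x => (starRingEnd ℂ) (u x)) 2 volume :=
    ⟨hcm.aestronglyMeasurable, by rw [hconj]; exact hUt.lt_top⟩
  have huL : MemLp u 2 volume := ⟨hum.aestronglyMeasurable, hUt.lt_top⟩
  have hstep : ∀ ε : ℝ, 0 < ε →
      U ^ 2 ≤ A * Φ * (U + ENNReal.ofReal ε) + U * ENNReal.ofReal ε := by
    intro ε hε
    obtain ⟨ψ, hψ⟩ := exists_schwartz_eLpNorm_sub_le hcL hε
    have hψn : eLpNorm ψ 2 volume ≤ U + ENNReal.ofReal ε := by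
      have : (ψ : Rn1 n → ℂ) = (fun x => (starRingEnd ℂ) (u x)) -
        ((fun x => (starRingEnd ℂ) (u x)) - ⇑ψ) := by ext x; simp
      rw [this]
      refine (eLpNorm_sub_le hcL.1 (hcL.1.sub ψ.continuous.aestronglyMeasurable)
        (by norm_num)).trans ?_
      rw [hconj]
      gcongr
    have hUsq : U ^ 2 = ‖∫ x, u x * (starRingEnd ℂ) (u x)‖ₑ := by
      rw [hU, eLpNorm_two_sq]
      have h1 : ∀ x, u x * (starRingEnd ℂ) (u x) = ((‖u x‖ ^ 2 : ℝ) : ℂ) := fun x => by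
        rw [Complex.mul_conj, Complex.normSq_eq_norm_sq]
      simp only [h1]
      have h0 : 0 ≤ ∫ x, ‖u x‖ ^ 2 := integral_nonneg fun x => by positivity
      rw [integral_complex_ofReal, ← ofReal_norm, Complex.norm_real, Real.norm_of_nonneg h0,
        ofReal_integral_eq_lintegral_ofReal (huL.integrable_norm_pow two_ne_zero)
          (Filter.Eventually.of_forall fun x => by positivity)]
      refine lintegral_congr fun x => ?_
      rw [ENNReal.ofReal_pow (norm_nonneg _), ofReal_norm]
    have hsplit : ∫ x, u x * (starRingEnd ℂ) (u x) =
        (∫ x, u x * ψ x) + ∫ x, u x * ((starRingEnd ℂ) (u x) - ψ x) := by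
      rw [← integral_add]
      · congr 1; ext x; ring
      · exact huL.integrable_mul (ψ.memLp 2 volume)
      · exact huL.integrable_mul (hcL.sub (ψ.memLp 2 volume))
    rw [hUsq, hsplit]
    refine (enorm_add_le _ _).trans (add_le_add ?_ ?_)
    · exact (enorm_integral_conv1_mul_le hK hA φ ψ).trans (by gcongr)
    · refine (enorm_integral_le_lintegral_enorm _).trans ?_
      simp only [enorm_mul]
      refine (lintegral_enorm_mul_le_eLpNorm_two hum
        (hcm.sub ψ.continuous.measurable)).trans (by gcongr)
  have hlim : U ^ 2 ≤ A * Φ * U := by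
    have ht : Filter.Tendsto (fun ε : ℝ => A * Φ * (U + ENNReal.ofReal ε) + U * ENNReal.ofReal ε)
        (nhdsWithin 0 (Set.Ioi 0)) (nhds (A * Φ * (U + ENNReal.ofReal 0) + U * ENNReal.ofReal 0)) := by
      have h0 : Filter.Tendsto (fun ε : ℝ => ENNReal.ofReal ε) (nhdsWithin 0 (Set.Ioi 0))
        (nhds (ENNReal.ofReal 0)) := (ENNReal.continuous_ofReal.tendsto 0).mono_left nhdsWithin_le_nhds
      exact (ENNReal.Tendsto.const_mul (tendsto_const_nhds.add h0)
        (Or.inr (ENNReal.mul_ne_top ENNReal.coe_ne_top hΦt))).add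
        (ENNReal.Tendsto.const_mul h0 (Or.inr hUt))
    have := ge_of_tendsto ht (b := U ^ 2) (by
      filter_upwards [self_mem_nhdsWithin] with ε hε using hstep ε hε)
    simpa using this
  rcases eq_or_ne U 0 with h0 | h0
  · rw [h0]; exact zero_le
  · rw [pow_two] at hlim
    exact (ENNReal.mul_le_mul_iff_left h0 hUt).1 hlim

/-- An integrable kernel with bounded Fourier transform gives a bounded convolution on `L²`. -/
theorem lintegral_conv1_sq_le {K : Rn1 n → ℂ} (hK : Integrable K) (hKm : Measurable K)
    {A : ℝ≥0} (hA0 : 0 < A) (hA : ∀ q, ‖FT1 K q‖ ≤ A) {g : Rn1 n → ℂ} (hg : Measurable g)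
    {B : ℝ} (hB : ∀ z, ‖g z‖ ≤ B) :
    ∫⁻ x, ‖conv1 K g x‖ₑ ^ 2 ≤ (A ^ 2 : ℝ≥0) * ∫⁻ x, ‖g x‖ₑ ^ 2 := by
  rw [← eLpNorm_two_sq, ← eLpNorm_two_sq, ENNReal.coe_pow, ← mul_pow]
  refine pow_le_pow_left' ?_ 2
  set G := eLpNorm g 2 volume with hG
  by_cases hGt : G = ∞
  · rw [hGt, ENNReal.mul_top (by simpa using hA0.ne')]; exact le_top
  have hgL : MemLp g 2 volume := ⟨hg.aestronglyMeasurable, lt_top_iff_ne_top.2 hGt⟩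
  set κ := ∫⁻ y, ‖K y‖ₑ with hκ
  have hκt : κ ≠ ∞ := hK.2.ne
  have hstep : ∀ ε : ℝ, 0 < ε → eLpNorm (conv1 K g) 2 volume ≤
      A * (G + ENNReal.ofReal ε) + κ * ENNReal.ofReal ε := by
    intro ε hε
    obtain ⟨φ, hφ⟩ := exists_schwartz_eLpNorm_sub_le hgL hε
    have hφm : Measurable φ := φ.continuous.measurable
    have hφn : eLpNorm φ 2 volume ≤ G + ENNReal.ofReal ε := by
      have : (φ : Rn1 n → ℂ) = g - (g - ⇑φ) := by ext x; simp
      rw [this]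
      refine (eLpNorm_sub_le hgL.1 (hgL.1.sub φ.continuous.aestronglyMeasurable)
        (by norm_num)).trans ?_
      gcongr
    have hφB : ∀ z, ‖φ z‖ ≤ SchwartzMap.seminorm ℝ 0 0 φ := φ.norm_le_seminorm ℝ
    have hsplit : conv1 K g = conv1 K φ + conv1 K (g - ⇑φ) := by
      ext x
      simp only [conv1, Pi.add_apply, Pi.sub_apply, mul_sub]
      rw [integral_sub (integrable_conv_aux hK hg hB x) (integrable_conv_aux hK hφm hφB x)]
      ring
    rw [hsplit]
    refine (eLpNorm_add_le (measurable_conv1 hKm hφm).aestronglyMeasurable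
      (measurable_conv1 hKm (hg.sub hφm)).aestronglyMeasurable (by norm_num)).trans (add_le_add ?_ ?_)
    · exact (eLpNorm_two_conv1_schwartz_le hK hKm hA φ).trans (by gcongr)
    · exact (eLpNorm_two_conv1_le hKm (hg.sub hφm)).trans (by gcongr)
  have ht : Filter.Tendsto (fun ε : ℝ => A * (G + ENNReal.ofReal ε) + κ * ENNReal.ofReal ε)
      (nhdsWithin 0 (Set.Ioi 0)) (nhds (A * (G + ENNReal.ofReal 0) + κ * ENNReal.ofReal 0)) := by
    have h0 : Filter.Tendsto (fun ε : ℝ => ENNReal.ofReal ε) (nhdsWithin 0 (Set.Ioi 0))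
      (nhds (ENNReal.ofReal 0)) := (ENNReal.continuous_ofReal.tendsto 0).mono_left nhdsWithin_le_nhds
    exact (ENNReal.Tendsto.const_mul (tendsto_const_nhds.add h0)
      (Or.inr ENNReal.coe_ne_top)).add (ENNReal.Tendsto.const_mul h0 (Or.inr hκt))
  have := ge_of_tendsto ht (b := eLpNorm (conv1 K g) 2 volume) (by
    filter_upwards [self_mem_nhdsWithin] with ε hε using hstep ε hε)
  simpa using this

end LTwo

section HeatType
variable {n : ℕ}

lemma lintegral_slab {F : Rn1 n → ℝ≥0∞} (hF : Measurable F) {T : Set ℝ} :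
    ∫⁻ z in {z : Rn1 n | z.2 ∈ T}, F z = ∫⁻ t in T, ∫⁻ x, F (x, t) := by
  have h1 : {z : Rn1 n | z.2 ∈ T} = Set.univ ×ˢ T := by ext z; simp
  rw [h1, Measure.volume_eq_prod, ← Measure.prod_restrict, Measure.restrict_univ,
    lintegral_prod_symm _ hF.aemeasurable]

/-- The size of a parabolic singular kernel. -/
def parGauss (z : Rn1 n) : ℝ := z.2 ^ (-1 - (n:ℝ) / 2) * Real.exp (-(‖z.1‖ ^ 2 / z.2))

lemma parGauss_nonneg {z : Rn1 n} (hz : 0 < z.2) : 0 ≤ parGauss z := by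
  unfold parGauss; positivity

lemma measurable_parGauss : Measurable (parGauss (n := n)) := by
  unfold parGauss; fun_prop

lemma lintegral_exp_neg_sq {b : ℝ} (hb : 0 < b) :
    ∫⁻ x : Rn n, ENNReal.ofReal (Real.exp (-(‖x‖ ^ 2 / b))) = ENNReal.ofReal ((π * b) ^ ((n:ℝ) / 2)) := by
  have h := GaussianFourier.integral_rexp_neg_mul_sq_norm (V := Rn n) (inv_pos.2 hb)
  have hi : Integrable fun x : Rn n => Real.exp (-(‖x‖ ^ 2 / b)) := by
    have := GaussianFourier.integrable_cexp_neg_mul_sq_norm_add (V := Rn n) (b := (b⁻¹ : ℝ))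
      (by simpa using hb) 0 0
    have h2 := this.norm
    refine h2.congr (Filter.Eventually.of_forall fun x => ?_)
    simp only [Complex.norm_exp]
    congr 1
    simp only [inner_zero_left, ofReal_zero, mul_zero, add_zero]
    rw [show (-((b⁻¹:ℝ):ℂ) * (‖x‖:ℂ) ^ 2) = ((-b⁻¹ * ‖x‖ ^ 2 : ℝ) : ℂ) by push_cast; ring,
      Complex.ofReal_re]
    field_simp
  rw [← ofReal_integral_eq_lintegral_ofReal hi
    (Filter.Eventually.of_forall fun x => (Real.exp_pos _).le)]
  have e1 : (fun x : Rn n => Real.exp (-(‖x‖ ^ 2 / b))) = fun x => Real.exp (-b⁻¹ * ‖x‖ ^ 2) := by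
    ext x; congr 1; field_simp
  rw [e1, h, finrank_euclideanSpace_fin, div_inv_eq_mul]

lemma lintegral_parGauss {t : ℝ} (ht : 0 < t) :
    ∫⁻ x : Rn n, ENNReal.ofReal (parGauss (x, t)) = ENNReal.ofReal (π ^ ((n:ℝ) / 2) * t⁻¹) := by
  have h1 : ∀ x : Rn n, ENNReal.ofReal (parGauss (x, t)) =
      ENNReal.ofReal (t ^ (-1 - (n:ℝ) / 2)) * ENNReal.ofReal (Real.exp (-(‖x‖ ^ 2 / t))) := fun x =>
    ENNReal.ofReal_mul (by positivity)
  simp only [h1]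
  rw [lintegral_const_mul _ (by fun_prop), lintegral_exp_neg_sq ht, ← ENNReal.ofReal_mul (by positivity),
    Real.mul_rpow Real.pi_pos.le ht.le, mul_left_comm, ← Real.rpow_add ht]
  congr 2
  rw [show -1 - (n:ℝ) / 2 + n / 2 = -1 by ring, Real.rpow_neg_one]

lemma parGauss_le_of_lt {z : Rn1 n} {ρ : ℝ} (hρ : 0 < ρ) (hz : 0 < z.2) (h : ρ < ‖z.1‖) :
    parGauss z ≤ 2 / ρ ^ 2 * (z.2 ^ (-((n:ℝ) / 2)) * Real.exp (-(‖z.1‖ ^ 2 / (2 * z.2)))) := by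
  set r := ‖z.1‖ ^ 2 / (2 * z.2) with hr
  have h1 : ‖z.1‖ ^ 2 / z.2 = r + r := by rw [hr]; field_simp; ring
  have h2 : r * Real.exp (-r) ≤ 1 := by
    have := Real.add_one_le_exp r
    rw [Real.exp_neg, ← div_eq_mul_inv, div_le_one (Real.exp_pos _)]
    linarith
  have h3 : z.2⁻¹ ≤ 2 / ρ ^ 2 * r := by
    rw [hr]
    have : ρ ^ 2 ≤ ‖z.1‖ ^ 2 := by gcongr
    rw [inv_eq_one_div, div_mul_div_comm, div_le_div_iff₀ hz (by positivity)]
    nlinarith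
  unfold parGauss
  rw [h1, neg_add, Real.exp_add, sub_eq_add_neg, Real.rpow_add hz, Real.rpow_neg_one]
  calc _ ≤ (2 / ρ ^ 2 * r) * z.2 ^ (-((n:ℝ) / 2)) * (Real.exp (-r) * Real.exp (-r)) := by gcongr
    _ = 2 / ρ ^ 2 * (z.2 ^ (-((n:ℝ) / 2)) * Real.exp (-r)) * (r * Real.exp (-r)) := by ring
    _ ≤ 2 / ρ ^ 2 * (z.2 ^ (-((n:ℝ) / 2)) * Real.exp (-r)) * 1 := by gcongr
    _ = _ := mul_one _

lemma lintegral_parGauss_far {ρ : ℝ} (hρ : 0 < ρ) :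
    ∫⁻ z in {z : Rn1 n | z.2 ∈ Set.Ioc 0 (5 * ρ ^ 2)},
      {z : Rn1 n | ρ < ‖z.1‖}.indicator (fun z => ENNReal.ofReal (parGauss z)) z ≤
      ENNReal.ofReal (10 * (π * 2) ^ ((n:ℝ) / 2)) := by
  have hs : MeasurableSet {z : Rn1 n | ρ < ‖z.1‖} :=
    measurableSet_lt measurable_const measurable_fst.norm
  rw [lintegral_slab (Measurable.indicator measurable_parGauss.ennreal_ofReal hs)]
  have h1 : ∀ t ∈ Set.Ioc 0 (5 * ρ ^ 2), ∫⁻ x : Rn n, {z : Rn1 n | ρ < ‖z.1‖}.indicator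
      (fun z => ENNReal.ofReal (parGauss z)) (x, t) ≤
      ENNReal.ofReal (2 / ρ ^ 2 * (π * 2) ^ ((n:ℝ) / 2)) := by
    intro t ht
    have ht0 : 0 < t := ht.1
    calc _ ≤ ∫⁻ x : Rn n, ENNReal.ofReal (2 / ρ ^ 2 * t ^ (-((n:ℝ) / 2))) *
          ENNReal.ofReal (Real.exp (-(‖x‖ ^ 2 / (2 * t)))) := by
          refine lintegral_mono fun x => Set.indicator_apply_le' (fun hx => ?_) fun _ => zero_le
          rw [← ENNReal.ofReal_mul (by positivity)]
          refine ENNReal.ofReal_le_ofReal ((parGauss_le_of_lt hρ ht0 hx).trans_eq ?_)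
          ring
      _ = _ := by
          rw [lintegral_const_mul _ (by fun_prop), lintegral_exp_neg_sq (by positivity),
            ← ENNReal.ofReal_mul (by positivity), ← mul_assoc π, Real.mul_rpow (by positivity) ht0.le,
            Real.rpow_neg ht0.le]
          congr 1
          have : t ^ ((n:ℝ) / 2) ≠ 0 := (Real.rpow_pos_of_pos ht0 _).ne'
          field_simp
  refine (setLIntegral_mono' measurableSet_Ioc h1).trans ?_
  rw [setLIntegral_const, Real.volume_Ioc, ← ENNReal.ofReal_mul (by positivity)]
  refine ENNReal.ofReal_le_ofReal (le_of_eq ?_)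
  field_simp
  ring

lemma lintegral_parGauss_tail {C : ℝ} (hC : 0 ≤ C) {ρ : ℝ} (hρ : 0 < ρ) :
    ∫⁻ z in {z : Rn1 n | z.2 ∈ Set.Ioi (3 * ρ ^ 2)},
      ENNReal.ofReal (C * (ρ / √z.2 + ρ ^ 2 / z.2) * parGauss z) ≤
      ENNReal.ofReal (3 * C * π ^ ((n:ℝ) / 2)) := by
  have hρ2 : 0 < 3 * ρ ^ 2 := by positivity
  have hm : Measurable fun z : Rn1 n => C * (ρ / √z.2 + ρ ^ 2 / z.2) * parGauss z := by
    have := measurable_parGauss (n := n)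
    fun_prop
  rw [lintegral_slab hm.ennreal_ofReal]
  have h1 : ∀ t ∈ Set.Ioi (3 * ρ ^ 2),
      ∫⁻ x : Rn n, ENNReal.ofReal (C * (ρ / √t + ρ ^ 2 / t) * parGauss (x, t)) =
      ENNReal.ofReal (C * π ^ ((n:ℝ) / 2) * (ρ * t ^ (-(3/2) : ℝ) + ρ ^ 2 * t ^ (-2 : ℝ))) := by
    intro t ht
    have ht0 : 0 < t := hρ2.trans ht
    have h2 : 0 ≤ C * (ρ / √t + ρ ^ 2 / t) := by positivity
    simp only [ENNReal.ofReal_mul h2]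
    have hmx : Measurable fun x : Rn n => ENNReal.ofReal (parGauss (x, t)) :=
      (measurable_parGauss.comp (by fun_prop : Measurable fun x : Rn n => (x, t))).ennreal_ofReal
    rw [lintegral_const_mul _ hmx, lintegral_parGauss ht0,
      ← ENNReal.ofReal_mul h2]
    congr 1
    have e1 : t ^ (-(3/2) : ℝ) = (√t)⁻¹ * t⁻¹ := by
      rw [Real.sqrt_eq_rpow, ← Real.rpow_neg ht0.le, ← Real.rpow_neg_one t, ← Real.rpow_add ht0]
      norm_num
    have e2 : t ^ (-2 : ℝ) = t⁻¹ * t⁻¹ := by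
      rw [← Real.rpow_neg_one t, ← Real.rpow_add ht0]; norm_num
    rw [e1, e2]
    ring
  rw [setLIntegral_congr_fun measurableSet_Ioi h1]
  have i1 := integrableOn_Ioi_rpow_of_lt (a := -(3/2)) (by norm_num) hρ2
  have i2 := integrableOn_Ioi_rpow_of_lt (a := -2) (by norm_num) hρ2
  have i3 : IntegrableOn (fun t : ℝ => C * π ^ ((n:ℝ) / 2) *
      (ρ * t ^ (-(3/2) : ℝ) + ρ ^ 2 * t ^ (-2 : ℝ))) (Set.Ioi (3 * ρ ^ 2)) :=
    ((i1.const_mul ρ).add (i2.const_mul (ρ ^ 2))).const_mul _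
  rw [← ofReal_integral_eq_lintegral_ofReal i3
    ((ae_restrict_iff' measurableSet_Ioi).2 (Filter.Eventually.of_forall fun t ht => by
      have ht0 : 0 < t := hρ2.trans ht
      simp only [Pi.zero_apply]
      positivity))]
  refine ENNReal.ofReal_le_ofReal ?_
  rw [integral_const_mul]
  have e3 : ∫ t in Set.Ioi (3 * ρ ^ 2), (ρ * t ^ (-(3/2) : ℝ) + ρ ^ 2 * t ^ (-2 : ℝ)) =
      ρ * (2 / √(3 * ρ ^ 2)) + ρ ^ 2 * (1 / (3 * ρ ^ 2)) := by
    rw [integral_add (i1.const_mul _) (i2.const_mul _), integral_const_mul, integral_const_mul,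
      integral_Ioi_rpow_of_lt (by norm_num) hρ2, integral_Ioi_rpow_of_lt (by norm_num) hρ2]
    congr 2
    · rw [Real.sqrt_eq_rpow, show (-(3/2) + 1 : ℝ) = -(1/2) by norm_num, Real.rpow_neg hρ2.le]
      ring
    · rw [show (-2 + 1 : ℝ) = -1 by norm_num, Real.rpow_neg_one]
      ring
  have e4 : ρ * (2 / √(3 * ρ ^ 2)) ≤ 2 := by
    rw [← mul_div_assoc, div_le_iff₀ (Real.sqrt_pos.2 hρ2)]
    have : ρ ≤ √(3 * ρ ^ 2) := Real.le_sqrt_of_sq_le (by nlinarith)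
    linarith
  have e5 : ρ ^ 2 * (1 / (3 * ρ ^ 2)) = 1 / 3 := by field_simp
  have e6 : 0 ≤ C * π ^ ((n:ℝ) / 2) := by positivity
  have : ∫ t in Set.Ioi (3 * ρ ^ 2), (ρ * t ^ (-(3/2) : ℝ) + ρ ^ 2 * t ^ (-2 : ℝ)) ≤ 3 := by
    rw [e3, e5]; linarith
  calc _ ≤ C * π ^ ((n:ℝ) / 2) * 3 := by
        refine mul_le_mul_of_nonneg_left ?_ e6
        simpa only [Pi.add_apply] using this
    _ = _ := by ring

end HeatType

section Hormander
variable {n : ℕ}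

lemma enorm_sub_le_lintegral_bound {f g : ℝ → ℝ} {B : ℝ}
    (h : ∀ s ∈ Set.Icc (0:ℝ) 1, ∃ d, HasDerivAt f d s ∧ |d| ≤ g s)
    (hB : ∀ s ∈ Set.Icc (0:ℝ) 1, g s ≤ B) :
    ‖f 1 - f 0‖ₑ ≤ ∫⁻ s in Set.Ioc (0:ℝ) 1, ENNReal.ofReal (g s) := by
  have hd : ∀ s ∈ Set.Icc (0:ℝ) 1, HasDerivAt f (deriv f s) s ∧ |deriv f s| ≤ g s := by
    intro s hs
    obtain ⟨d, h1, h2⟩ := h s hs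
    rw [h1.deriv]
    exact ⟨h1, h2⟩
  have hint : IntervalIntegrable (deriv f) volume 0 1 := by
    rw [intervalIntegrable_iff_integrableOn_Ioc_of_le zero_le_one]
    refine Integrable.of_bound (C := B) (measurable_deriv f).aestronglyMeasurable ?_
    refine (ae_restrict_iff' measurableSet_Ioc).2 (Filter.Eventually.of_forall fun s hs => ?_)
    have hs' := Set.Ioc_subset_Icc_self hs
    exact (hd s hs').2.trans (hB s hs')
  have h2 := intervalIntegral.integral_eq_sub_of_hasDerivAt (f := f) (f' := deriv f) (a := 0) (b := 1)
    (fun s hs => (hd s (by rwa [Set.uIcc_of_le zero_le_one] at hs)).1) hint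
  rw [← h2, intervalIntegral.integral_of_le zero_le_one]
  refine (enorm_integral_le_lintegral_enorm _).trans ?_
  refine setLIntegral_mono' measurableSet_Ioc fun s hs => ?_
  rw [Real.enorm_eq_ofReal_abs]
  exact ENNReal.ofReal_le_ofReal (hd s (Set.Ioc_subset_Icc_self hs)).2

/-- Real kernels supported in positive time with parabolic singular integral bounds. -/
structure IsHeatType (k : Rn1 n → ℝ) (C : ℝ) : Prop where
  nonneg : 0 ≤ C
  measurable : Measurable k
  zero : ∀ z : Rn1 n, z.2 ≤ 0 → k z = 0
  bound : ∀ z : Rn1 n, 0 < z.2 → |k z| ≤ parGauss z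
  deriv : ∀ z y : Rn1 n, 0 < z.2 → ∃ d, HasDerivAt (fun s : ℝ => k (z - s • y)) d 0 ∧
    |d| ≤ C * (‖y.1‖ / √z.2 + |y.2| / z.2) * parGauss z

lemma parGauss_le_rpow {z : Rn1 n} {a : ℝ} (ha : 0 < a) (hz : a ≤ z.2) :
    parGauss z ≤ a ^ (-1 - (n:ℝ) / 2) := by
  have hz0 : 0 < z.2 := ha.trans_le hz
  unfold parGauss
  calc z.2 ^ (-1 - (n:ℝ) / 2) * Real.exp (-(‖z.1‖ ^ 2 / z.2)) ≤ z.2 ^ (-1 - (n:ℝ) / 2) * 1 := by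
        gcongr
        rw [Real.exp_le_one_iff, neg_nonpos]
        positivity
    _ ≤ _ := by
        rw [mul_one]
        refine Real.rpow_le_rpow_of_nonpos ha hz ?_
        have : (0:ℝ) ≤ n := n.cast_nonneg
        linarith

/-- The majorant of increments for large times. -/
def tailMajorant (C ρ : ℝ) (z : Rn1 n) : ℝ≥0∞ :=
  {z : Rn1 n | z.2 ∈ Set.Ioi (3 * ρ ^ 2)}.indicator
    (fun z => ENNReal.ofReal (C * (ρ / √z.2 + ρ ^ 2 / z.2) * parGauss z)) z

/-- The majorant of the kernel away from the spatial origin. -/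
def farMajorant (ρ : ℝ) (z : Rn1 n) : ℝ≥0∞ :=
  {z : Rn1 n | z.2 ∈ Set.Ioc 0 (5 * ρ ^ 2)}.indicator
    ({z : Rn1 n | ρ < ‖z.1‖}.indicator (fun z => ENNReal.ofReal (parGauss z))) z

lemma measurable_tailMajorant {C ρ : ℝ} : Measurable (tailMajorant (n := n) C ρ) := by
  have := measurable_parGauss (n := n)
  unfold tailMajorant
  refine Measurable.indicator (by fun_prop) (measurable_snd measurableSet_Ioi)

lemma measurable_farMajorant {ρ : ℝ} : Measurable (farMajorant (n := n) ρ) := by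
  have := measurable_parGauss (n := n)
  unfold farMajorant
  exact Measurable.indicator (Measurable.indicator (by fun_prop)
    (measurableSet_lt measurable_const measurable_fst.norm)) (measurable_snd measurableSet_Ioc)

lemma lintegral_tailMajorant {C ρ : ℝ} (hC : 0 ≤ C) (hρ : 0 < ρ) :
    ∫⁻ z : Rn1 n, tailMajorant C ρ z ≤ ENNReal.ofReal (3 * C * π ^ ((n:ℝ) / 2)) := by
  have hm : MeasurableSet {z : Rn1 n | z.2 ∈ Set.Ioi (3 * ρ ^ 2)} := measurable_snd measurableSet_Ioi
  unfold tailMajorant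
  rw [lintegral_indicator hm]
  exact lintegral_parGauss_tail hC hρ

lemma lintegral_farMajorant {ρ : ℝ} (hρ : 0 < ρ) :
    ∫⁻ z : Rn1 n, farMajorant ρ z ≤ ENNReal.ofReal (10 * (π * 2) ^ ((n:ℝ) / 2)) := by
  have hm : MeasurableSet {z : Rn1 n | z.2 ∈ Set.Ioc 0 (5 * ρ ^ 2)} := measurable_snd measurableSet_Ioc
  unfold farMajorant
  rw [lintegral_indicator hm]
  exact lintegral_parGauss_far hρ

lemma IsHeatType.increment_tail {k : Rn1 n → ℝ} {C : ℝ} (hk : IsHeatType k C) {ρ : ℝ} (hρ : 0 < ρ)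
    {y z : Rn1 n} (hy1 : ‖y.1‖ ≤ ρ) (hy2 : |y.2| ≤ ρ ^ 2) (hz : 4 * ρ ^ 2 < z.2) :
    ‖k (z - y) - k z‖ₑ ≤ ∫⁻ s in Set.Ioc (0:ℝ) 1, tailMajorant C ρ (z - s • y) := by
  have hρ2 : 0 < ρ ^ 2 := by positivity
  have ht : ∀ s ∈ Set.Icc (0:ℝ) 1, 3 * ρ ^ 2 < (z - s • y).2 := by
    intro s hs
    have h1 : s * y.2 ≤ ρ ^ 2 := by
      calc s * y.2 ≤ |s * y.2| := le_abs_self _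
        _ = s * |y.2| := by rw [abs_mul, abs_of_nonneg hs.1]
        _ ≤ 1 * ρ ^ 2 := by
          have := hs.2
          gcongr
        _ = ρ ^ 2 := one_mul _
    simp only [Prod.snd_sub, Prod.smul_snd, smul_eq_mul]
    linarith
  have hC := hk.nonneg
  have key := enorm_sub_le_lintegral_bound (f := fun s : ℝ => k (z - s • y))
    (g := fun s => C * (ρ / √(z - s • y).2 + ρ ^ 2 / (z - s • y).2) * parGauss (z - s • y))
    (B := C * (1 + 1) * (3 * ρ ^ 2) ^ (-1 - (n:ℝ) / 2)) ?_ ?_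
  · simp only [one_smul, zero_smul, sub_zero] at key
    refine key.trans (setLIntegral_mono' measurableSet_Ioc fun s hs => ?_)
    rw [tailMajorant, Set.indicator_of_mem]
    exact ht s (Set.Ioc_subset_Icc_self hs)
  · intro s hs
    have h0 : 0 < (z - s • y).2 := lt_trans (by positivity) (ht s hs)
    obtain ⟨d, h1, h2⟩ := hk.deriv (z - s • y) y h0
    have hG := parGauss_nonneg h0
    refine ⟨d, ?_, h2.trans (by gcongr)⟩
    have h3 := HasDerivAt.comp_sub_const (f := fun u : ℝ => k (z - s • y - u • y)) (f' := d) s s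
      (by rwa [sub_self])
    refine h3.congr_of_eventuallyEq (Filter.Eventually.of_forall fun u => ?_)
    simp only [sub_smul]
    congr 1
    abel
  · intro s hs
    have h3 := ht s hs
    have h0 : 0 < (z - s • y).2 := lt_trans (by positivity) (ht s hs)
    have hG := parGauss_nonneg h0
    have hG2 := parGauss_le_rpow (n := n) (by positivity : 0 < 3 * ρ ^ 2) h3.le
    have e1 : ρ / √(z - s • y).2 ≤ 1 := by
      rw [div_le_one (Real.sqrt_pos.2 h0)]
      exact Real.le_sqrt_of_sq_le (by linarith)
    have e2 : ρ ^ 2 / (z - s • y).2 ≤ 1 := by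
      rw [div_le_one h0]
      linarith
    have e3 : 0 ≤ ρ / √(z - s • y).2 + ρ ^ 2 / (z - s • y).2 := by positivity
    gcongr

lemma IsHeatType.enorm_le_farMajorant {k : Rn1 n → ℝ} {C : ℝ} (hk : IsHeatType k C) {ρ : ℝ}
    {z : Rn1 n} (h1 : ρ < ‖z.1‖) (h2 : z.2 ≤ 5 * ρ ^ 2) : ‖k z‖ₑ ≤ farMajorant ρ z := by
  rcases le_or_gt z.2 0 with h0 | h0
  · rw [hk.zero z h0]
    simp
  · rw [farMajorant, Set.indicator_of_mem (by exact ⟨h0, h2⟩), Set.indicator_of_mem (by exact h1),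
      Real.enorm_eq_ofReal_abs]
    exact ENNReal.ofReal_le_ofReal (hk.bound z h0)

lemma IsHeatType.increment_le {k : Rn1 n → ℝ} {C : ℝ} (hk : IsHeatType k C) {ρ : ℝ} (hρ : 0 < ρ)
    {y z : Rn1 n} (hy1 : ‖y.1‖ ≤ ρ) (hy2 : |y.2| ≤ ρ ^ 2) (hz : 2 * ρ < ‖z.1‖ ∨ 4 * ρ ^ 2 < |z.2|) :
    ‖k (z - y) - k z‖ₑ ≤ (∫⁻ s in Set.Ioc (0:ℝ) 1, tailMajorant C ρ (z - s • y)) +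
      (farMajorant ρ (z - y) + farMajorant ρ z) := by
  have hρ2 : 0 < ρ ^ 2 := by positivity
  have hy2' := abs_le.1 hy2
  rcases lt_or_ge (4 * ρ ^ 2) z.2 with h | h
  · exact (hk.increment_tail hρ hy1 hy2 h).trans le_self_add
  rcases lt_or_ge z.2 (-(4 * ρ ^ 2)) with h' | h'
  · rw [hk.zero z (by linarith), hk.zero (z - y) (by simp only [Prod.snd_sub]; linarith)]
    simp
  have hz1 : 2 * ρ < ‖z.1‖ := hz.resolve_right (not_lt.2 (abs_le.2 ⟨h', h⟩))
  refine le_trans ?_ le_add_self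
  refine enorm_sub_le.trans (add_le_add ?_ ?_)
  · refine hk.enorm_le_farMajorant ?_ ?_
    · have := norm_sub_norm_le z.1 y.1
      simp only [Prod.fst_sub]
      linarith
    · simp only [Prod.snd_sub]
      linarith
  · exact hk.enorm_le_farMajorant (by linarith) (by linarith)

/-- The Hörmander constant of a heat type kernel. -/
def heatHormander (n : ℕ) (C : ℝ) : ℝ≥0 :=
  (3 * C * π ^ ((n:ℝ) / 2)).toNNReal +
    ((10 * (π * 2) ^ ((n:ℝ) / 2)).toNNReal + (10 * (π * 2) ^ ((n:ℝ) / 2)).toNNReal)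

lemma IsHeatType.hormander {k : Rn1 n → ℝ} {C : ℝ} (hk : IsHeatType k C) {ρ : ℝ} (hρ : 0 < ρ)
    {y : Rn1 n} (hy1 : ‖y.1‖ ≤ ρ) (hy2 : |y.2| ≤ ρ ^ 2) :
    ∫⁻ z in {z : Rn1 n | 2 * ρ < ‖z.1‖ ∨ 4 * ρ ^ 2 < |z.2|}, ‖k (z - y) - k z‖ₑ ≤
      heatHormander n C := by
  have hm : MeasurableSet {z : Rn1 n | 2 * ρ < ‖z.1‖ ∨ 4 * ρ ^ 2 < |z.2|} :=
    (measurableSet_lt measurable_const measurable_fst.norm).union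
      (measurableSet_lt measurable_const measurable_snd.norm)
  have hmT := measurable_tailMajorant (n := n) (C := C) (ρ := ρ)
  have hmF := measurable_farMajorant (n := n) (ρ := ρ)
  calc _ ≤ ∫⁻ z in {z : Rn1 n | 2 * ρ < ‖z.1‖ ∨ 4 * ρ ^ 2 < |z.2|},
        ((∫⁻ s in Set.Ioc (0:ℝ) 1, tailMajorant C ρ (z - s • y)) +
      (farMajorant ρ (z - y) + farMajorant ρ z)) :=
        setLIntegral_mono' hm fun z hz => hk.increment_le hρ hy1 hy2 hz
    _ ≤ ∫⁻ z : Rn1 n, ((∫⁻ s in Set.Ioc (0:ℝ) 1, tailMajorant C ρ (z - s • y)) +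
      (farMajorant ρ (z - y) + farMajorant ρ z)) := setLIntegral_le_lintegral _ _
    _ = (∫⁻ z : Rn1 n, ∫⁻ s in Set.Ioc (0:ℝ) 1, tailMajorant C ρ (z - s • y)) +
      ((∫⁻ z : Rn1 n, farMajorant ρ (z - y)) + ∫⁻ z : Rn1 n, farMajorant ρ z) := by
        rw [lintegral_add_right _ (by fun_prop), lintegral_add_right _ hmF]
    _ ≤ _ := by
        rw [lintegral_sub_right_eq_self (fun z : Rn1 n => farMajorant ρ z) y,
          lintegral_lintegral_swap (by fun_prop)]
        simp only [lintegral_sub_right_eq_self (fun z : Rn1 n => tailMajorant C ρ z)]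
        rw [setLIntegral_const, Real.volume_Ioc, sub_zero, ENNReal.ofReal_one, mul_one, heatHormander,
          ENNReal.coe_add, ENNReal.coe_add]
        exact add_le_add (lintegral_tailMajorant hk.nonneg hρ)
          (add_le_add (lintegral_farMajorant hρ) (lintegral_farMajorant hρ))

end Hormander

section HeatMult
variable {n : ℕ}

lemma enorm_ofReal_sub (a b : ℝ) : ‖(a : ℂ) - (b : ℂ)‖ₑ = ‖a - b‖ₑ := by
  rw [← Complex.ofReal_sub, enorm_eq_nnnorm, enorm_eq_nnnorm, Complex.nnnorm_real]

theorem exists_isLpMult_of_heatType (n : ℕ) {p : ℝ} (hp : 1 < p) (C : ℝ) (A : ℝ≥0) (hA : 0 < A) :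
    ∃ D : ℝ≥0, ∀ k : Rn1 n → ℝ, IsHeatType k C → Integrable k →
      (∀ q, ‖FT1 (fun z => (k z : ℂ)) q‖ ≤ A) → IsLpMult p (FT1 fun z => (k z : ℂ)) D := by
  obtain ⟨D, hD⟩ := exists_isLpMult_of_cz n (A ^ 2) (heatHormander n C) hp
  refine ⟨D, fun k hk hki hb => hD _ ?_⟩
  have hm : Measurable fun z => (k z : ℂ) := Complex.measurable_ofReal.comp hk.measurable
  refine ⟨hki.ofReal, hm, fun g hg ⟨B, hB⟩ => lintegral_conv1_sq_le hki.ofReal hm hA hb hg hB, ?_⟩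
  intro ρ hρ y hy1 hy2
  simp only [enorm_ofReal_sub]
  exact hk.hormander hρ hy1 hy2

lemma IsHeatType.hormander_neg {k : Rn1 n → ℝ} {C : ℝ} (hk : IsHeatType k C) {ρ : ℝ} (hρ : 0 < ρ)
    {y : Rn1 n} (hy1 : ‖y.1‖ ≤ ρ) (hy2 : |y.2| ≤ ρ ^ 2) :
    ∫⁻ z in {z : Rn1 n | 2 * ρ < ‖z.1‖ ∨ 4 * ρ ^ 2 < |z.2|}, ‖k (-(z - y)) - k (-z)‖ₑ ≤
      heatHormander n C := by
  have hm : MeasurableSet {z : Rn1 n | 2 * ρ < ‖z.1‖ ∨ 4 * ρ ^ 2 < |z.2|} :=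
    (measurableSet_lt measurable_const measurable_fst.norm).union
      (measurableSet_lt measurable_const measurable_snd.norm)
  refine le_trans (le_of_eq ?_) (hk.hormander hρ (y := -y) (by simpa using hy1) (by simpa using hy2))
  rw [← lintegral_indicator hm, ← lintegral_indicator hm,
    ← (Measure.measurePreserving_neg (volume : Measure (Rn1 n))).lintegral_comp_emb
      (MeasurableEquiv.neg (Rn1 n)).measurableEmbedding]
  refine lintegral_congr fun z => ?_
  simp only [Set.indicator_apply, Set.mem_ofPred_eq, Prod.fst_neg, Prod.snd_neg, norm_neg, abs_neg,
    neg_neg]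
  congr 4
  abel

theorem exists_isLpMult_of_heatType_odd (n : ℕ) {p : ℝ} (hp : 1 < p) (C : ℝ) (A : ℝ≥0) (hA : 0 < A) :
    ∃ D : ℝ≥0, ∀ k : Rn1 n → ℝ, IsHeatType k C → Integrable k →
      (∀ q, ‖FT1 (fun z => (k z : ℂ) - (k (-z) : ℂ)) q‖ ≤ A) →
        IsLpMult p (FT1 fun z => (k z : ℂ) - (k (-z) : ℂ)) D := by
  obtain ⟨D, hD⟩ := exists_isLpMult_of_cz n (A ^ 2) (heatHormander n C + heatHormander n C) hp
  refine ⟨D, fun k hk hki hb => hD _ ?_⟩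
  have hkm := hk.measurable
  have hm : Measurable fun z => (k z : ℂ) - (k (-z) : ℂ) := by fun_prop
  have hi : Integrable fun z => (k z : ℂ) - (k (-z) : ℂ) := hki.ofReal.sub hki.comp_neg.ofReal
  refine ⟨hi, hm, fun g hg ⟨B, hB⟩ => lintegral_conv1_sq_le hi hm hA hb hg hB, ?_⟩
  intro ρ hρ y hy1 hy2
  rw [ENNReal.coe_add]
  refine le_trans ?_ (add_le_add (hk.hormander hρ hy1 hy2) (hk.hormander_neg hρ hy1 hy2))
  rw [← lintegral_add_left (by fun_prop)]
  refine lintegral_mono fun z => ?_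
  simp only [← enorm_ofReal_sub]
  rw [show (k (z - y) : ℂ) - (k (-(z - y)) : ℂ) - ((k z : ℂ) - (k (-z) : ℂ)) =
    ((k (z - y) : ℂ) - (k z : ℂ)) - ((k (-(z - y)) : ℂ) - (k (-z) : ℂ)) by ring]
  exact enorm_sub_le

/-- `f` has size at most `U` and logarithmic derivative at most `c` at the origin. -/
def DerivBound (f : ℝ → ℝ) (U c : ℝ) : Prop :=
  |f 0| ≤ U ∧ ∃ d, HasDerivAt f d 0 ∧ |d| ≤ c * U

lemma DerivBound.mul {f g : ℝ → ℝ} {U V c c' : ℝ} (hf : DerivBound f U c) (hg : DerivBound g V c') :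
    DerivBound (fun s => f s * g s) (U * V) (c + c') := by
  obtain ⟨h1, d, h2, h3⟩ := hf
  obtain ⟨h1', d', h2', h3'⟩ := hg
  have hU : 0 ≤ U := (abs_nonneg _).trans h1
  have hV : 0 ≤ V := (abs_nonneg _).trans h1'
  have hcU : 0 ≤ c * U := (abs_nonneg _).trans h3
  refine ⟨by rw [abs_mul]; gcongr, _, h2.mul h2', ?_⟩
  calc _ ≤ |d * g 0| + |f 0 * d'| := abs_add_le _ _
    _ ≤ c * U * V + U * (c' * V) := by rw [abs_mul, abs_mul]; gcongr
    _ = _ := by ring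

lemma hasDerivAt_line (t τ : ℝ) : HasDerivAt (fun s : ℝ => t - s * τ) (-τ) 0 := by
  simpa using ((hasDerivAt_id (0:ℝ)).mul_const τ).const_sub t

lemma derivBound_rpow {t τ a : ℝ} (ht : 0 < t) :
    DerivBound (fun s => (t - s * τ) ^ (-a)) (t ^ (-a)) (|a| * (|τ| / t)) := by
  refine ⟨by simp [abs_of_pos (Real.rpow_pos_of_pos ht _)], _,
    (hasDerivAt_line t τ).rpow_const (p := -a) (Or.inl (by simpa using ht.ne')), ?_⟩
  simp only [zero_mul, sub_zero]
  rw [Real.rpow_sub_one ht.ne', abs_mul, abs_mul, abs_neg, abs_neg, abs_div,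
    abs_of_pos (Real.rpow_pos_of_pos ht _), abs_of_pos ht]
  apply le_of_eq
  ring

lemma self_mul_exp_neg_le (r : ℝ) : r * Real.exp (-r) ≤ 1 := by
  have := Real.add_one_le_exp r
  rw [Real.exp_neg, ← div_eq_mul_inv, div_le_one (Real.exp_pos _)]
  linarith

lemma derivBound_exp {t τ η : ℝ} (ht : 0 < t) (hη : 0 ≤ η) :
    DerivBound (fun s => Real.exp (-(η * (t - s * τ)))) 1 (|τ| / t) := by
  have h0 : 0 ≤ η * t := by positivity
  have hd : HasDerivAt (fun s => Real.exp (-(η * (t - s * τ))))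
      (Real.exp (-(η * (t - 0 * τ))) * -(η * -τ)) 0 := (((hasDerivAt_line t τ).const_mul η).neg).exp
  refine ⟨?_, _, hd, ?_⟩
  · simpa [abs_of_pos (Real.exp_pos _)] using h0
  · simp only [zero_mul, sub_zero, mul_one]
    rw [abs_mul, abs_of_pos (Real.exp_pos _), abs_neg, abs_mul, abs_neg, abs_of_nonneg hη,
      le_div_iff₀ ht]
    calc _ = |τ| * (η * t * Real.exp (-(η * t))) := by ring
      _ ≤ |τ| * 1 := by gcongr; exact self_mul_exp_neg_le _
      _ = _ := mul_one _

lemma derivBound_inv {t τ ε : ℝ} (ht : 0 < t) (hε : 0 ≤ ε) :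
    DerivBound (fun s => (t - s * τ + ε)⁻¹) t⁻¹ (|τ| / t) := by
  have h0 : 0 < t + ε := by positivity
  refine ⟨?_, _, ((hasDerivAt_line t τ).add_const ε).inv (by simpa using h0.ne'), ?_⟩
  · simp only [zero_mul, sub_zero]
    rw [abs_of_pos (inv_pos.2 h0)]
    gcongr
    linarith
  · simp only [zero_mul, sub_zero, neg_neg]
    rw [abs_div, abs_of_pos (by positivity : 0 < (t + ε) ^ 2), ← div_eq_mul_inv, div_div]
    gcongr
    nlinarith

lemma self_le_exp_sq (r : ℝ) : r ≤ Real.exp (r ^ 2) := by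
  nlinarith [Real.add_one_le_exp (r ^ 2), sq_nonneg (r - 1)]

lemma sq_le_exp_sq (r : ℝ) : r ^ 2 ≤ Real.exp (r ^ 2) := by
  linarith [Real.add_one_le_exp (r ^ 2)]

lemma derivBound_gauss {z y : Rn1 n} (hz : 0 < z.2) :
    DerivBound (fun s => Real.exp (-(π * (‖z.1 - s • y.1‖ ^ 2 / (z.2 - s * y.2)))))
      (Real.exp (-(2 * (‖z.1‖ ^ 2 / z.2)))) (2 * π * (‖y.1‖ / √z.2 + |y.2| / z.2)) := by
  obtain ⟨x, t⟩ := z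
  obtain ⟨v, τ⟩ := y
  simp only at hz ⊢
  have hs := Real.sqrt_pos.2 hz
  have hss : t = √t ^ 2 := (Real.sq_sqrt hz.le).symm
  set r := ‖x‖ / √t with hr
  have hr0 : 0 ≤ r := by positivity
  have hr2 : ‖x‖ ^ 2 / t = r ^ 2 := by rw [hr, div_pow, ← hss]
  have hpi := Real.pi_gt_three
  have hline : HasDerivAt (fun s : ℝ => x - s • v) (-v) 0 := by
    simpa using ((hasDerivAt_id (0:ℝ)).smul_const v).const_sub x
  have hd : HasDerivAt (fun s => Real.exp (-(π * (‖x - s • v‖ ^ 2 / (t - s * τ)))))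
      (Real.exp (-(π * (‖x - (0:ℝ) • v‖ ^ 2 / (t - 0 * τ)))) *
        -(π * ((2 * inner ℝ (x - (0:ℝ) • v) (-v) * (t - 0 * τ) - ‖x - (0:ℝ) • v‖ ^ 2 * -τ) /
          (t - 0 * τ) ^ 2))) 0 :=
    ((hline.norm_sq.div (hasDerivAt_line t τ) (by simpa using hz.ne')).const_mul π).neg.exp
  refine ⟨?_, _, hd, ?_⟩
  · simp only [zero_smul, zero_mul, sub_zero]
    rw [abs_of_pos (Real.exp_pos _), Real.exp_le_exp, hr2]
    nlinarith [sq_nonneg r]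
  · simp only [zero_smul, zero_mul, sub_zero]
    rw [abs_mul, abs_of_pos (Real.exp_pos _), hr2]
    have hin : |inner ℝ x (-v)| ≤ ‖x‖ * ‖v‖ := by
      simpa using abs_real_inner_le_norm x (-v)
    have e1 : |-(π * ((2 * inner ℝ x (-v) * t - ‖x‖ ^ 2 * -τ) / t ^ 2))| ≤
        2 * π * (r * (‖v‖ / √t)) + 2 * π * (r ^ 2 * (|τ| / t)) := by
      rw [abs_neg, abs_mul, abs_of_pos Real.pi_pos, abs_div, abs_of_pos (by positivity : 0 < t ^ 2)]
      calc _ ≤ π * ((2 * (‖x‖ * ‖v‖) * t + 2 * (‖x‖ ^ 2 * |τ|)) / t ^ 2) := by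
            gcongr
            refine (abs_sub _ _).trans (add_le_add ?_ ?_)
            · rw [abs_mul, abs_mul, abs_of_pos hz, abs_two]
              gcongr
            · rw [abs_mul, abs_neg, abs_of_nonneg (by positivity : 0 ≤ ‖x‖ ^ 2)]
              nlinarith [mul_nonneg (sq_nonneg ‖x‖) (abs_nonneg τ)]
        _ = _ := by
            rw [← hr2, hr]
            have : r * (‖v‖ / √t) = ‖x‖ * ‖v‖ / t := by
              rw [hr, div_mul_div_comm, Real.mul_self_sqrt hz.le]
            rw [← hr, this]
            field_simp
    have e2 : Real.exp (-(π * r ^ 2)) * Real.exp (r ^ 2) ≤ Real.exp (-(2 * r ^ 2)) := by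
      rw [← Real.exp_add, Real.exp_le_exp]
      nlinarith [sq_nonneg r]
    have hw : 0 ≤ 2 * π * (‖v‖ / √t + |τ| / t) := by positivity
    calc _ ≤ Real.exp (-(π * r ^ 2)) * (2 * π * (r * (‖v‖ / √t)) + 2 * π * (r ^ 2 * (|τ| / t))) := by
          gcongr
      _ ≤ Real.exp (-(π * r ^ 2)) * (2 * π * (Real.exp (r ^ 2) * (‖v‖ / √t)) +
          2 * π * (Real.exp (r ^ 2) * (|τ| / t))) := by
          have := self_le_exp_sq r
          have := sq_le_exp_sq r
          gcongr
      _ = 2 * π * (‖v‖ / √t + |τ| / t) * (Real.exp (-(π * r ^ 2)) * Real.exp (r ^ 2)) := by ring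
      _ ≤ _ := by gcongr

lemma derivBound_coord {z y : Rn1 n} (hz : 0 < z.2) (k : Fin n) :
    DerivBound (fun s => (z.1 - s • y.1) k / √(z.2 - s * y.2))
      (Real.exp (‖z.1‖ ^ 2 / z.2)) (‖y.1‖ / √z.2 + |y.2| / z.2) := by
  obtain ⟨x, t⟩ := z
  obtain ⟨v, τ⟩ := y
  simp only at hz ⊢
  have hs := Real.sqrt_pos.2 hz
  have hss : √t ^ 2 = t := Real.sq_sqrt hz.le
  set r := ‖x‖ / √t with hr
  have hr0 : 0 ≤ r := by positivity
  have hr2 : ‖x‖ ^ 2 / t = r ^ 2 := by rw [hr, div_pow, hss]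
  have hxk : |x k| ≤ ‖x‖ := by simpa using PiLp.norm_apply_le x k
  have hvk : |v k| ≤ ‖v‖ := by simpa using PiLp.norm_apply_le v k
  have hd : HasDerivAt (fun s : ℝ => (x - s • v) k) (-v k) 0 := by
    simpa using hasDerivAt_line (x k) (v k)
  have hd2 := hd.div ((hasDerivAt_line t τ).sqrt (by simpa using hz.ne')) (by simpa using hs.ne')
  have h1 : |x k / √t| ≤ r := by
    rw [abs_div, abs_of_pos hs, hr]
    gcongr
  rw [hr2]
  refine ⟨?_, _, hd2, ?_⟩
  · simp only [zero_smul, zero_mul, sub_zero]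
    exact h1.trans (self_le_exp_sq r)
  · simp only [zero_smul, zero_mul, sub_zero]
    have e : (-v k * √t - x k * (-τ / (2 * √t))) / √t ^ 2 = -(v k / √t) + x k / √t * (τ / t) / 2 := by
      rw [hss]
      field_simp
      rw [hss]
      ring
    rw [e]
    have h2 : |v k / √t| ≤ ‖v‖ / √t := by
      rw [abs_div, abs_of_pos hs]
      gcongr
    calc _ ≤ |v k / √t| + |x k / √t * (τ / t) / 2| := by
          refine (abs_add_le _ _).trans_eq ?_
          rw [abs_neg]
      _ ≤ ‖v‖ / √t * Real.exp (r ^ 2) + Real.exp (r ^ 2) * (|τ| / t) := by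
          refine add_le_add ?_ ?_
          · refine h2.trans (le_mul_of_one_le_right (by positivity) (Real.one_le_exp (sq_nonneg r)))
          · rw [abs_div, abs_mul, abs_two, abs_div τ, abs_of_pos hz]
            have h3 : |x k / √t| * (|τ| / t) ≤ Real.exp (r ^ 2) * (|τ| / t) := by
              have := h1.trans (self_le_exp_sq r)
              gcongr
            have h4 : 0 ≤ |x k / √t| * (|τ| / t) := by positivity
            linarith
      _ = _ := by ring

end HeatMult

section HeatKernel
variable {n : ℕ}

/-- Admissible spatial amplitudes in a Gaussian kernel. -/
structure IsAmplitude (P : Rn1 n → ℝ) : Prop where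
  measurable : Measurable P
  deriv : ∀ z y : Rn1 n, 0 < z.2 → DerivBound (fun s : ℝ => P (z - s • y))
    (Real.exp (‖z.1‖ ^ 2 / z.2)) (‖y.1‖ / √z.2 + |y.2| / z.2)

lemma isAmplitude_one : IsAmplitude (fun _ : Rn1 n => (1:ℝ)) := by
  refine ⟨measurable_const, fun z y hz => ⟨?_, 0, hasDerivAt_const _ _, ?_⟩⟩
  · rw [abs_one]
    exact Real.one_le_exp (by positivity)
  · rw [abs_zero]
    positivity

lemma isAmplitude_coord (k : Fin n) : IsAmplitude (fun z : Rn1 n => z.1 k / √z.2) :=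
  ⟨by fun_prop, fun _ _ hz => derivBound_coord hz k⟩

/-- The kernel of `∫ w(t) e^{-t(π|ξ|² + 2πiτ)} dt` for amplitude `1`. -/
def heatKernel (w : ℝ → ℝ) (P : Rn1 n → ℝ) : Rn1 n → ℝ :=
  {z : Rn1 n | z.2 ∈ Set.Ioi 0}.indicator fun z =>
    w z.2 * z.2 ^ (-((n:ℝ) / 2)) * P z * Real.exp (-(π * (‖z.1‖ ^ 2 / z.2)))

lemma measurableSet_posTime : MeasurableSet {z : Rn1 n | z.2 ∈ Set.Ioi (0:ℝ)} :=
  measurable_snd measurableSet_Ioi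

lemma measurable_heatKernel {w : ℝ → ℝ} {P : Rn1 n → ℝ} (hw : Measurable w) (hP : Measurable P) :
    Measurable (heatKernel w P) := by
  refine Measurable.indicator ?_ measurableSet_posTime
  fun_prop

lemma heatKernel_of_pos {w : ℝ → ℝ} {P : Rn1 n → ℝ} {z : Rn1 n} (hz : 0 < z.2) :
    heatKernel w P z =
      w z.2 * z.2 ^ (-((n:ℝ) / 2)) * P z * Real.exp (-(π * (‖z.1‖ ^ 2 / z.2))) :=
  Set.indicator_of_mem (by exact hz) _

lemma IsAmplitude.abs_le {P : Rn1 n → ℝ} (hP : IsAmplitude P) {z : Rn1 n} (hz : 0 < z.2) :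
    |P z| ≤ Real.exp (‖z.1‖ ^ 2 / z.2) := by
  simpa using (hP.deriv z 0 hz).1

lemma parGauss_eq {z : Rn1 n} (hz : 0 < z.2) :
    parGauss z = 1 * z.2⁻¹ * z.2 ^ (-((n:ℝ) / 2)) * Real.exp (‖z.1‖ ^ 2 / z.2) *
      Real.exp (-(2 * (‖z.1‖ ^ 2 / z.2))) := by
  rw [mul_assoc _ (Real.exp _), ← Real.exp_add, parGauss, sub_eq_add_neg, Real.rpow_add hz,
    Real.rpow_neg_one, one_mul]
  congr 2
  ring

lemma isHeatType_heatKernel {P : Rn1 n → ℝ} (hP : IsAmplitude P) {η ε : ℝ} (hη : 0 ≤ η)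
    (hε : 0 ≤ ε) :
    IsHeatType (heatKernel (fun t => Real.exp (-(η * t)) * (t + ε)⁻¹) P) (n + 10) := by
  have key : ∀ z y : Rn1 n, 0 < z.2 → DerivBound
      (fun s : ℝ => heatKernel (fun t => Real.exp (-(η * t)) * (t + ε)⁻¹) P (z - s • y)) (parGauss z)
      ((n + 10) * (‖y.1‖ / √z.2 + |y.2| / z.2)) := by
    intro z y hz
    obtain ⟨h1, d, h2, h3⟩ := ((((derivBound_exp (τ := y.2) hz hη).mul (derivBound_inv hz hε)).mul
      (derivBound_rpow (a := (n:ℝ) / 2) hz)).mul (hP.deriv z y hz)).mul (derivBound_gauss (y := y) hz)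
    rw [← parGauss_eq hz] at h1 h3
    have hev : ∀ᶠ s : ℝ in nhds 0, 0 < (z - s • y).2 := by
      have hc : Continuous fun s : ℝ => (z - s • y).2 := by fun_prop
      exact hc.continuousAt.eventually (lt_mem_nhds (by simpa using hz))
    refine ⟨?_, d, h2.congr_of_eventuallyEq ?_, h3.trans ?_⟩
    · simp only [zero_smul, sub_zero]
      rw [heatKernel_of_pos hz]
      simpa using h1
    · filter_upwards [hev] with s hs
      rw [heatKernel_of_pos hs]
      rfl
    · refine mul_le_mul_of_nonneg_right ?_ (parGauss_nonneg hz)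
      have e1 : 0 ≤ ‖y.1‖ / √z.2 := by positivity
      have e2 : 0 ≤ |y.2| / z.2 := by positivity
      have hn : (0:ℝ) ≤ n := n.cast_nonneg
      have hpi := Real.pi_lt_d2
      rw [abs_of_nonneg (by positivity : (0:ℝ) ≤ n / 2)]
      nlinarith [mul_nonneg hn e1, mul_nonneg hn e2, mul_nonneg (sub_nonneg.2 hpi.le) e1,
        mul_nonneg (sub_nonneg.2 hpi.le) e2]
  refine ⟨by positivity, measurable_heatKernel (by fun_prop) hP.measurable, fun z hz => ?_, fun z hz => ?_,
    fun z y hz => (key z y hz).2⟩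
  · exact Set.indicator_of_notMem (by simpa using hz) _
  · simpa using (key z 0 hz).1

lemma integrable_heatKernel {w : ℝ → ℝ} {P : Rn1 n → ℝ} (hw : Measurable w)
    (hwi : IntegrableOn w (Set.Ioi 0)) (hP : IsAmplitude P) : Integrable (heatKernel w P) := by
  have hm := measurable_heatKernel hw hP.measurable
  refine ⟨hm.aestronglyMeasurable, ?_⟩
  have hpm := measurable_parGauss (n := n)
  have h1 : ∀ z : Rn1 n, ‖heatKernel w P z‖ₑ ≤ {z : Rn1 n | z.2 ∈ Set.Ioi 0}.indicator
      (fun z => ‖w z.2‖ₑ * ENNReal.ofReal (z.2 * parGauss z)) z := by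
    intro z
    rcases le_or_gt z.2 0 with hz | hz
    · rw [heatKernel, Set.indicator_of_notMem (by simpa using hz)]
      simp
    · rw [Set.indicator_of_mem (by exact hz), heatKernel_of_pos hz, mul_assoc, mul_assoc, enorm_mul]
      refine mul_le_mul_right ?_ _
      rw [Real.enorm_eq_ofReal_abs]
      refine ENNReal.ofReal_le_ofReal ?_
      rw [parGauss_eq hz, abs_mul, abs_mul, abs_of_pos (Real.rpow_pos_of_pos hz _),
        abs_of_pos (Real.exp_pos _)]
      have h2 := hP.abs_le hz
      have hpi := Real.pi_gt_three
      calc _ ≤ z.2 ^ (-((n:ℝ) / 2)) * (Real.exp (‖z.1‖ ^ 2 / z.2) *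
            Real.exp (-(2 * (‖z.1‖ ^ 2 / z.2)))) := by
            gcongr
            linarith
        _ = _ := by field_simp
  refine (lintegral_mono h1).trans_lt ?_
  rw [lintegral_indicator measurableSet_posTime, lintegral_slab (by fun_prop)]
  have h2 : ∀ t ∈ Set.Ioi (0:ℝ), ∫⁻ x : Rn n, ‖w t‖ₑ * ENNReal.ofReal (t * parGauss (x, t)) =
      ‖w t‖ₑ * ENNReal.ofReal (π ^ ((n:ℝ) / 2)) := by
    intro t ht
    have ht0 : (0:ℝ) < t := ht
    have hmx : Measurable fun x : Rn n => ENNReal.ofReal (parGauss (x, t)) :=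
      (hpm.comp (by fun_prop : Measurable fun x : Rn n => (x, t))).ennreal_ofReal
    simp only [ENNReal.ofReal_mul ht0.le]
    rw [lintegral_const_mul _ (by fun_prop), lintegral_const_mul _ hmx, lintegral_parGauss ht0,
      ← ENNReal.ofReal_mul ht0.le]
    congr 2
    field_simp
  rw [setLIntegral_congr_fun measurableSet_Ioi h2, lintegral_mul_const _ (by fun_prop)]
  exact ENNReal.mul_lt_top hwi.2 ENNReal.ofReal_lt_top

end HeatKernel

section HeatFourier
variable {n : ℕ}

lemma norm_cexp_gauss {b : ℝ} (c : ℂ) (hc : c.re = 0) (x w : Rn n) :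
    ‖cexp (-(b:ℂ) * (‖x‖:ℂ) ^ 2 + c * ((inner ℝ w x : ℝ) : ℂ))‖ = Real.exp (-b * ‖x‖ ^ 2) := by
  rw [Complex.norm_exp]
  congr 1
  rw [Complex.add_re, ← Complex.ofReal_pow, ← Complex.ofReal_neg, ← Complex.ofReal_mul,
    Complex.ofReal_re, Complex.re_mul_ofReal, hc]
  ring

lemma integral_coord_mul_gauss {b : ℝ} (hb : 0 < b) (c : ℂ) (hc : c.re = 0) (w : Rn n) (k : Fin n) :
    ∫ x : Rn n, (x k : ℂ) * cexp (-(b:ℂ) * (‖x‖:ℂ) ^ 2 + c * ((inner ℝ w x : ℝ) : ℂ)) =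
      c * (w k : ℂ) / (2 * b) *
        ∫ x : Rn n, cexp (-(b:ℂ) * (‖x‖:ℂ) ^ 2 + c * ((inner ℝ w x : ℝ) : ℂ)) := by
  set g : Rn n → ℂ := fun x => cexp (-(b:ℂ) * (‖x‖:ℂ) ^ 2 + c * ((inner ℝ w x : ℝ) : ℂ)) with hg
  have hgi : Integrable g := GaussianFourier.integrable_cexp_neg_mul_sq_norm_add (by simpa using hb) c w
  have hgc : Continuous g := by fun_prop
  have hxk : Integrable fun x : Rn n => (x k : ℂ) * g x := by
    have h2 : Integrable fun x : Rn n => (√(b / 2))⁻¹ *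
        ‖cexp (-((b / 2 : ℝ):ℂ) * (‖x‖:ℂ) ^ 2 + 0 * ((inner ℝ w x : ℝ) : ℂ))‖ :=
      (GaussianFourier.integrable_cexp_neg_mul_sq_norm_add (V := Rn n) (b := ((b / 2 : ℝ) : ℂ))
        (by simpa using hb) 0 w).norm.const_mul _
    refine h2.mono' (by fun_prop) (Filter.Eventually.of_forall fun x => ?_)
    rw [norm_mul, hg, norm_cexp_gauss c hc, norm_cexp_gauss 0 (by simp), Complex.norm_real]
    have hs : 0 < √(b / 2) := Real.sqrt_pos.2 (by positivity)
    have h3 : ‖x k‖ ≤ ‖x‖ := PiLp.norm_apply_le x k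
    have h4 := self_le_exp_sq (√(b / 2) * ‖x‖)
    rw [mul_pow, Real.sq_sqrt (by positivity)] at h4
    calc _ ≤ (√(b / 2))⁻¹ * (√(b / 2) * ‖x‖) * Real.exp (-b * ‖x‖ ^ 2) := by
          rw [inv_mul_cancel_left₀ hs.ne']
          gcongr
      _ ≤ (√(b / 2))⁻¹ * Real.exp (b / 2 * ‖x‖ ^ 2) * Real.exp (-b * ‖x‖ ^ 2) := by gcongr
      _ = _ := by
          rw [mul_assoc, ← Real.exp_add]
          congr 2
          ring
  have hgd : ∀ x : Rn n, HasLineDerivAt ℝ g (g x * (-(b:ℂ) * (2 * (x k : ℂ)) + c * (w k : ℂ))) x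
      (EuclideanSpace.single k (1:ℝ)) := by
    intro x
    have hl : HasDerivAt (fun t : ℝ => x + t • EuclideanSpace.single k (1:ℝ))
        (EuclideanSpace.single k (1:ℝ)) 0 := by
      simpa using ((hasDerivAt_id (0:ℝ)).smul_const (EuclideanSpace.single k (1:ℝ))).const_add x
    have h1 : HasDerivAt (fun t : ℝ => ‖x + t • EuclideanSpace.single k (1:ℝ)‖ ^ 2) (2 * x k) 0 := by
      have := hl.norm_sq
      simpa [EuclideanSpace.inner_single_right] using this
    have h2 : HasDerivAt (fun t : ℝ => (inner ℝ w (x + t • EuclideanSpace.single k (1:ℝ)) : ℝ))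
        (w k) 0 := by
      have := (hasDerivAt_const (0:ℝ) w).inner ℝ hl
      simpa [EuclideanSpace.inner_single_right] using this
    have h3 := ((h1.ofReal_comp.const_mul (-(b:ℂ))).add (h2.ofReal_comp.const_mul c)).cexp
    have h4 : HasDerivAt (fun t : ℝ => g (x + t • EuclideanSpace.single k (1:ℝ)))
        (g x * (-(b:ℂ) * (2 * (x k : ℂ)) + c * (w k : ℂ))) 0 := by
      convert! h3 using 1
      · ext t
        simp [hg]
      · simp [hg]
    exact h4
  have key := integral_bilinear_hasLineDerivAt_right_eq_neg_left_of_integrable (μ := (volume : Measure (Rn n)))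
    (B := ContinuousLinearMap.mul ℝ ℂ) (f := fun _ : Rn n => (1:ℂ)) (f' := fun _ => 0) (g := g)
    (g' := fun x => g x * (-(b:ℂ) * (2 * (x k : ℂ)) + c * (w k : ℂ)))
    (v := EuclideanSpace.single k (1:ℝ)) (by simp) ?_ (by simpa using hgi)
    (fun x _ => by
      have := hasDerivAt_const (0:ℝ) (1:ℂ)
      exact this) (fun x _ => hgd x)
  · simp only [ContinuousLinearMap.mul_apply', one_mul, zero_mul, integral_zero, neg_zero] at key
    have e : (fun x => g x * (-(b:ℂ) * (2 * (x k : ℂ)) + c * (w k : ℂ))) =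
        fun x => -(2 * b : ℂ) * ((x k : ℂ) * g x) + c * (w k : ℂ) * g x := by
      ext x; ring
    rw [e, integral_add (hxk.const_mul _) (hgi.const_mul _), integral_const_mul,
      integral_const_mul] at key
    have hb' : (2 * b : ℂ) ≠ 0 := by
      simpa using hb.ne'
    rw [div_mul_eq_mul_div, eq_div_iff hb']
    linear_combination -key
  · simp only [ContinuousLinearMap.mul_apply', one_mul]
    refine ((hxk.const_mul (-(2 * b : ℂ))).add (hgi.const_mul (c * (w k : ℂ)))).congr
      (Filter.Eventually.of_forall fun x => ?_)
    simp only [Pi.add_apply]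
    ring

lemma integral_gauss_time {t : ℝ} (ht : 0 < t) (w : Rn n) :
    ∫ x : Rn n, cexp (-((π / t : ℝ):ℂ) * (‖x‖:ℂ) ^ 2 + -(2 * π * I) * ((inner ℝ w x : ℝ) : ℂ)) =
      (t ^ ((n:ℝ) / 2) : ℝ) * Real.exp (-(π * ‖w‖ ^ 2 * t)) := by
  have hpi := Real.pi_pos
  rw [GaussianFourier.integral_cexp_neg_mul_sq_norm_add (by rw [Complex.ofReal_re]; positivity),
    finrank_euclideanSpace_fin, ← Complex.ofReal_div, div_div_cancel₀ hpi.ne',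
    Complex.ofReal_cpow ht.le, Complex.ofReal_exp]
  congr 2
  · push_cast; rfl
  · push_cast
    have : (π : ℂ) ≠ 0 := by exact_mod_cast hpi.ne'
    have : (t : ℂ) ≠ 0 := by exact_mod_cast ht.ne'
    field_simp
    rw [Complex.I_sq]
    ring

lemma character_neg_prod (ξ x : Rn n) (τ t : ℝ) : character (ξ, τ) (-(x, t)) =
    cexp (-(2 * π * I * τ) * t) * cexp (-(2 * π * I) * ((inner ℝ ξ x : ℝ) : ℂ)) := by
  rw [character, ← Complex.exp_add]
  congr 1
  rw [pairing_neg, pairing, PiLp.inner_apply]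
  simp only [RCLike.inner_apply, conj_trivial]
  have : ∑ k, x k * ξ k = ∑ k, ξ k * x k := Finset.sum_congr rfl fun k _ => mul_comm _ _
  rw [this]
  push_cast
  ring

/-- The spatial Fourier transform of the amplitude `P` against the heat kernel. -/
def spatialFT (P : Rn1 n → ℝ) (ξ : Rn n) (t : ℝ) : ℂ :=
  ∫ x : Rn n, (P (x, t) : ℂ) * cexp (-((π / t : ℝ):ℂ) * (‖x‖:ℂ) ^ 2 +
    -(2 * π * I) * ((inner ℝ ξ x : ℝ) : ℂ))

lemma FT1_heatKernel {w : ℝ → ℝ} {P : Rn1 n → ℝ} (hw : Measurable w)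
    (hwi : IntegrableOn w (Set.Ioi 0)) (hP : IsAmplitude P) (ξ : Rn n) (τ : ℝ) :
    FT1 (fun z => (heatKernel w P z : ℂ)) (ξ, τ) = ∫ t in Set.Ioi (0:ℝ),
      (w t : ℂ) * cexp (-(2 * π * I * τ) * t) * ((t ^ (-((n:ℝ) / 2)) : ℝ) * spatialFT P ξ t) := by
  have hi : Integrable fun z : Rn1 n => character (ξ, τ) (-z) * (heatKernel w P z : ℂ) := by
    refine (integrable_heatKernel hw hwi hP).ofReal.bdd_mul (c := 1) ?_
      (Filter.Eventually.of_forall fun z => (norm_character _ _).le)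
    exact ((continuous_character_right (ξ, τ)).comp continuous_neg).aestronglyMeasurable
  rw [FT1_eq, Measure.volume_eq_prod, MeasureTheory.integral_prod_symm _ hi,
    ← integral_indicator measurableSet_Ioi]
  refine integral_congr_ae (Filter.Eventually.of_forall fun t => ?_)
  simp only
  rcases le_or_gt t 0 with ht | ht
  · rw [Set.indicator_of_notMem (by simpa using ht)]
    refine integral_eq_zero_of_ae (Filter.Eventually.of_forall fun x => ?_)
    simp only [heatKernel]
    rw [Set.indicator_of_notMem (by simpa using ht)]
    simp
  · rw [Set.indicator_of_mem (by exact ht), spatialFT, ← mul_assoc, ← integral_const_mul]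
    refine integral_congr_ae (Filter.Eventually.of_forall fun x => ?_)
    simp only
    rw [heatKernel_of_pos (by exact ht), character_neg_prod, Complex.exp_add]
    push_cast
    have : -((π:ℂ) * ((‖x‖:ℂ) ^ 2 / t)) = -(π / t) * (‖x‖:ℂ) ^ 2 := by ring
    rw [this]
    ring

lemma spatialFT_one {t : ℝ} (ht : 0 < t) (ξ : Rn n) :
    (t ^ (-((n:ℝ) / 2)) : ℝ) * spatialFT (fun _ : Rn1 n => (1:ℝ)) ξ t =
      (Real.exp (-(π * ‖ξ‖ ^ 2 * t)) : ℂ) := by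
  simp only [spatialFT, Complex.ofReal_one, one_mul]
  rw [integral_gauss_time ht, ← mul_assoc, ← Complex.ofReal_mul, ← Real.rpow_add ht]
  simp

lemma spatialFT_coord {t : ℝ} (ht : 0 < t) (ξ : Rn n) (k : Fin n) :
    (t ^ (-((n:ℝ) / 2)) : ℝ) * spatialFT (fun z : Rn1 n => z.1 k / √z.2) ξ t =
      -I * (ξ k : ℂ) * ((√t : ℝ) * (Real.exp (-(π * ‖ξ‖ ^ 2 * t)) : ℂ)) := by
  have hs : (√t : ℂ) ≠ 0 := by exact_mod_cast (Real.sqrt_pos.2 ht).ne'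
  have e : spatialFT (fun z : Rn1 n => z.1 k / √z.2) ξ t = (√t : ℂ)⁻¹ *
      (-I * (ξ k : ℂ) * t * ((t ^ ((n:ℝ) / 2) : ℝ) * Real.exp (-(π * ‖ξ‖ ^ 2 * t)))) := by
    have h1 : ∀ x : Rn n, ((x k / √t : ℝ) : ℂ) * cexp (-((π / t : ℝ):ℂ) * (‖x‖:ℂ) ^ 2 +
        -(2 * π * I) * ((inner ℝ ξ x : ℝ) : ℂ)) = (√t : ℂ)⁻¹ * ((x k : ℂ) *
        cexp (-((π / t : ℝ):ℂ) * (‖x‖:ℂ) ^ 2 + -(2 * π * I) * ((inner ℝ ξ x : ℝ) : ℂ))) := by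
      intro x
      push_cast
      ring
    simp only [spatialFT, h1]
    rw [integral_const_mul, integral_coord_mul_gauss (by positivity) _ (by simp), integral_gauss_time ht]
    congr 1
    have hpi : (π:ℂ) ≠ 0 := by exact_mod_cast Real.pi_pos.ne'
    have ht' : (t:ℂ) ≠ 0 := by exact_mod_cast ht.ne'
    push_cast
    field_simp
  have hst : (√t : ℂ) * (√t : ℂ) = t := by rw [← Complex.ofReal_mul, Real.mul_self_sqrt ht.le]
  have hr : ((t ^ (-((n:ℝ) / 2)) : ℝ) : ℂ) * ((t ^ ((n:ℝ) / 2) : ℝ) : ℂ) = 1 := by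
    rw [← Complex.ofReal_mul, ← Real.rpow_add ht]
    simp
  rw [e, ← hst]
  field_simp
  linear_combination (-(ξ k : ℂ)) * hr

end HeatFourier

section SquareRoots

lemma eq_of_sq_eq_of_re_pos {A B : ℂ} (h : A ^ 2 = B ^ 2) (hA : 0 < A.re) (hB : 0 < B.re) : A = B := by
  have h1 : (A - B) * (A + B) = 0 := by linear_combination h
  rcases mul_eq_zero.1 h1 with h2 | h2
  · exact sub_eq_zero.1 h2
  · have h3 : (A + B).re = 0 := by rw [h2]; rfl
    rw [Complex.add_re] at h3
    linarith

/-- The principal inverse square root. -/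
def invSqrt (μ : ℂ) : ℂ := μ ^ (((-1 : ℝ) : ℂ) / 2)

lemma cpow_ofReal_re_pos {z : ℂ} (hz : 0 < z.re) {y : ℝ} (hy : |y| ≤ 1) : 0 < (z ^ (y : ℂ)).re := by
  rw [Complex.cpow_ofReal_re]
  have hz0 : 0 < ‖z‖ := norm_pos_iff.2 fun h => by simp [h] at hz
  refine mul_pos (Real.rpow_pos_of_pos hz0 _) (Real.cos_pos_of_mem_Ioo (abs_lt.1 ?_))
  have h1 := Complex.abs_arg_lt_pi_div_two_iff.2 (Or.inl hz)
  rw [abs_mul]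
  exact (mul_le_of_le_one_right (abs_nonneg _) hy).trans_lt h1

lemma invSqrt_re_pos {μ : ℂ} (h : 0 < μ.re) : 0 < (invSqrt μ).re := by
  have := cpow_ofReal_re_pos h (y := -1 / 2) (by rw [abs_div, abs_neg, abs_one, abs_two]; norm_num)
  unfold invSqrt
  push_cast at this ⊢
  exact this

lemma invSqrt_sq {μ : ℂ} (h : 0 < μ.re) : invSqrt μ ^ 2 = μ⁻¹ := by
  have hμ : μ ≠ 0 := fun h0 => by simp [h0] at h
  rw [invSqrt, sq, ← Complex.cpow_add _ _ hμ]
  push_cast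
  norm_num [Complex.cpow_neg_one]

lemma integrableOn_rpow_mul_cexp {μ : ℂ} (h : 0 < μ.re) :
    IntegrableOn (fun t : ℝ => ((t ^ (-(1/2) : ℝ) : ℝ) : ℂ) * cexp (-μ * t)) (Set.Ioi 0) := by
  have h1 := integrableOn_rpow_mul_exp_neg_mul_rpow (p := 1) (s := -(1/2)) (b := μ.re) (by norm_num)
    one_pos h
  refine h1.mono' (by fun_prop) ((ae_restrict_iff' measurableSet_Ioi).2
    (Filter.Eventually.of_forall fun t ht => ?_))
  have ht0 : (0:ℝ) < t := ht
  rw [norm_mul, Complex.norm_real, Real.norm_of_nonneg (by positivity), Complex.norm_exp,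
    Complex.re_mul_ofReal, Complex.neg_re, Real.rpow_one]

lemma integral_rpow_mul_cexp {μ : ℂ} (h : 0 < μ.re) :
    ∫ t in Set.Ioi (0:ℝ), ((t ^ (-(1/2) : ℝ) : ℝ) : ℂ) * cexp (-μ * t) = (√π : ℂ) * invSqrt μ := by
  have hμ : μ ≠ 0 := fun h0 => by simp [h0] at h
  have hpi := Real.pi_pos
  have h1 : ∫ t in Set.Ioi (0:ℝ), ((t ^ (-(1/2) : ℝ) : ℝ) : ℂ) * cexp (-μ * t) =
      (π / μ) ^ ((1 / 2 : ℝ) : ℂ) := by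
    rw [← integral_comp_rpow_Ioi_of_pos (p := 2) two_pos]
    have h2 : ∀ x ∈ Set.Ioi (0:ℝ), (2 * x ^ ((2:ℝ) - 1)) •
        ((((x ^ (2:ℝ)) ^ (-(1/2) : ℝ) : ℝ) : ℂ) * cexp (-μ * (x ^ (2:ℝ) : ℝ))) =
        2 * cexp (-μ * (x:ℂ) ^ 2) := by
      intro x hx
      have hx0 : (0:ℝ) < x := hx
      have e1 : (x ^ (2:ℝ)) ^ (-(1/2) : ℝ) = x⁻¹ := by
        rw [← Real.rpow_mul hx0.le, ← Real.rpow_neg_one]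
        norm_num
      rw [e1, show (2:ℝ) - 1 = 1 by norm_num, Real.rpow_one, Real.rpow_two, Complex.real_smul]
      have : (x:ℂ) ≠ 0 := by exact_mod_cast hx0.ne'
      push_cast
      field_simp
    rw [setIntegral_congr_fun measurableSet_Ioi h2, integral_const_mul, integral_gaussian_complex_Ioi h]
    push_cast
    ring
  rw [h1]
  have hre : 0 < ((π:ℂ) / μ).re := by
    rw [Complex.div_re, Complex.ofReal_re, Complex.ofReal_im, zero_mul, zero_div, add_zero]
    have := Complex.normSq_pos.2 hμ
    positivity
  refine eq_of_sq_eq_of_re_pos ?_ (cpow_ofReal_re_pos hre (by rw [abs_of_pos] <;> norm_num)) ?_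
  · rw [mul_pow, invSqrt_sq h, ← Complex.ofReal_pow, Real.sq_sqrt hpi.le, ← div_eq_mul_inv, sq,
      ← Complex.cpow_add _ _ (by intro h0; simp [h0] at hre)]
    push_cast
    norm_num
  · rw [Complex.re_ofReal_mul]
    exact mul_pos (Real.sqrt_pos.2 hpi) (invSqrt_re_pos h)

lemma measurable_invSqrt : Measurable invSqrt := by
  unfold invSqrt
  fun_prop

end SquareRoots

section Resolvent
variable {n : ℕ}

namespace LpMult
variable {p : ℝ} {m m₁ m₂ : Rn1 n → ℂ}

lemma congr (h : LpMult p m₁) (e : ∀ q, m q = m₁ q) : LpMult p m := (funext e : m = m₁) ▸ h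

lemma const (p : ℝ) (c : ℂ) : LpMult (n := n) p fun _ => c := ⟨_, IsLpMult.const c⟩

lemma mul (h₁ : LpMult p m₁) (h₂ : LpMult p m₂) : LpMult p fun q => m₁ q * m₂ q :=
  h₁.elim fun _ h₁ => h₂.elim fun _ h₂ => ⟨_, h₁.mul h₂⟩

lemma const_mul (c : ℂ) (h : LpMult p m) : LpMult p fun q => c * m q := (const p c).mul h

lemma add (hp : 1 ≤ p) (h₁ : LpMult p m₁) (h₂ : LpMult p m₂) : LpMult p fun q => m₁ q + m₂ q :=
  h₁.elim fun _ h₁ => h₂.elim fun _ h₂ => ⟨_, h₁.add hp h₂⟩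

lemma sum (hp : 1 ≤ p) {ι : Type*} (s : Finset ι) {M : ι → Rn1 n → ℂ} (h : ∀ i ∈ s, LpMult p (M i)) :
    LpMult p fun q => ∑ i ∈ s, M i q := by
  classical
  induction s using Finset.induction_on with
  | empty => simpa using const p 0
  | insert i s hi ih =>
    simp only [Finset.sum_insert hi]
    exact (h i (Finset.mem_insert_self i s)).add hp
      (ih fun j hj => h j (Finset.mem_insert_of_mem hj))

lemma dilate (hp : 1 ≤ p) (h : LpMult p m) {a b : ℝ} (ha : 0 < a) (hb : 0 < b) :
    LpMult p fun q => m (a • q.1, b * q.2) :=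
  h.elim fun _ h => ⟨_, h.dilate hp ha hb⟩

end LpMult

/-- The exponent of the heat semigroup on the Fourier side. -/
def heatExponent (q : Rn1 n) : ℂ := (π * ‖q.1‖ ^ 2 : ℝ) + 2 * π * I * q.2

lemma heatExponent_re (q : Rn1 n) : (heatExponent q).re = π * ‖q.1‖ ^ 2 := by
  simp [heatExponent, -ofReal_mul, -ofReal_pow]

lemma measurable_heatExponent : Measurable (heatExponent (n := n)) := by
  unfold heatExponent
  fun_prop

lemma FT1_heatKernel_one {w : ℝ → ℝ} (hw : Measurable w) (hwi : IntegrableOn w (Set.Ioi 0))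
    (q : Rn1 n) : FT1 (fun z => (heatKernel w (fun _ => 1) z : ℂ)) q =
      ∫ t in Set.Ioi (0:ℝ), (w t : ℂ) * cexp (-heatExponent q * t) := by
  obtain ⟨ξ, τ⟩ := q
  rw [FT1_heatKernel hw hwi isAmplitude_one]
  refine setIntegral_congr_fun measurableSet_Ioi fun t ht => ?_
  rw [spatialFT_one ht, Complex.ofReal_exp, mul_assoc, ← Complex.exp_add, heatExponent]
  congr 2
  push_cast
  ring

lemma FT1_heatKernel_coord {w : ℝ → ℝ} (hw : Measurable w) (hwi : IntegrableOn w (Set.Ioi 0))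
    (k : Fin n) (q : Rn1 n) : FT1 (fun z => (heatKernel w (fun z => z.1 k / √z.2) z : ℂ)) q =
      -I * (q.1 k : ℂ) * ∫ t in Set.Ioi (0:ℝ), ((w t * √t : ℝ) : ℂ) * cexp (-heatExponent q * t) := by
  obtain ⟨ξ, τ⟩ := q
  rw [FT1_heatKernel hw hwi (isAmplitude_coord k), ← integral_const_mul]
  refine setIntegral_congr_fun measurableSet_Ioi fun t ht => ?_
  have : -heatExponent (ξ, τ) * t = -(2 * π * I * τ) * t + (-(π * ‖ξ‖ ^ 2 * t) : ℝ) := by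
    rw [heatExponent]
    push_cast
    ring
  rw [spatialFT_coord ht, this, Complex.exp_add, Complex.ofReal_exp]
  push_cast
  ring

lemma lpMult_invSqrt_heat {p : ℝ} (hp : 1 ≤ p) :
    LpMult p (fun q : Rn1 n => invSqrt (1 + heatExponent q)) := by
  set w : ℝ → ℝ := fun t => t ^ (-(1/2) : ℝ) * Real.exp (-t) with hw
  have hwm : Measurable w := by fun_prop
  have hwi : IntegrableOn w (Set.Ioi 0) := by
    have := integrableOn_rpow_mul_exp_neg_mul_rpow (p := 1) (s := -(1/2)) (b := 1) (by norm_num)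
      one_pos one_pos
    simpa only [Real.rpow_one, neg_one_mul] using this
  have hk := (integrable_heatKernel (n := n) hwm hwi isAmplitude_one).ofReal (𝕜 := ℂ)
  have hkm : Measurable fun z : Rn1 n => (heatKernel w (fun _ => 1) z : ℂ) :=
    Complex.measurable_ofReal.comp (measurable_heatKernel hwm measurable_const)
  have h1 : LpMult p (FT1 fun z : Rn1 n => (heatKernel w (fun _ => 1) z : ℂ)) :=
    ⟨_, IsLpMult.FT1 hp hk hkm⟩
  refine (h1.const_mul ((√π : ℂ)⁻¹)).congr fun q => ?_
  have hre : 0 < (1 + heatExponent q).re := by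
    rw [Complex.add_re, heatExponent_re, Complex.one_re]
    positivity
  have hs : (√π : ℂ) ≠ 0 := by exact_mod_cast (Real.sqrt_pos.2 Real.pi_pos).ne'
  rw [FT1_heatKernel_one hwm hwi, eq_inv_mul_iff_mul_eq₀ hs, ← integral_rpow_mul_cexp hre]
  refine integral_congr_ae (Filter.Eventually.of_forall fun t => ?_)
  simp only [hw]
  push_cast
  rw [mul_assoc, ← Complex.exp_add]
  congr 2
  ring

end Resolvent

section Riesz
variable {n : ℕ}

lemma integrableOn_regularized {η ε : ℝ} (hη : 0 < η) (hε : 0 < ε) :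
    IntegrableOn (fun t : ℝ => Real.exp (-(η * t)) * (t + ε)⁻¹) (Set.Ioi 0) := by
  have h1 := (integrableOn_exp_mul_Ioi (neg_lt_zero.2 hη) 0).mul_const ε⁻¹
  refine h1.mono' (by fun_prop) ((ae_restrict_iff' measurableSet_Ioi).2
    (Filter.Eventually.of_forall fun t ht => ?_))
  have ht0 : (0:ℝ) < t := ht
  rw [Real.norm_of_nonneg (by positivity), neg_mul]
  gcongr
  linarith

lemma tendsto_inv_succ : Filter.Tendsto (fun j : ℕ => ((j:ℝ) + 1)⁻¹) Filter.atTop (nhds 0) := by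
  simpa using tendsto_one_div_add_atTop_nhds_zero_nat (𝕜 := ℝ)

lemma abs_coord_mul_integral_le (q : Rn1 n) (k : Fin n) :
    |q.1 k| * ∫ t in Set.Ioi (0:ℝ), t ^ (-(1/2) : ℝ) * Real.exp (-((1 + π * ‖q.1‖ ^ 2) * t)) ≤ 1 := by
  have hpi := Real.pi_pos
  have hr : 0 < 1 + π * ‖q.1‖ ^ 2 := by positivity
  have h1 := Real.integral_rpow_mul_exp_neg_mul_Ioi (a := 1 / 2) (by norm_num) hr
  rw [show (1/2 - 1 : ℝ) = -(1/2) by norm_num, Real.Gamma_one_half_eq, ← Real.sqrt_eq_rpow] at h1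
  rw [h1, ← Real.sqrt_mul (by positivity)]
  have h2 : |q.1 k| ≤ ‖q.1‖ := PiLp.norm_apply_le q.1 k
  calc _ ≤ ‖q.1‖ * √(1 / (1 + π * ‖q.1‖ ^ 2) * π) := by gcongr
    _ = √(‖q.1‖ ^ 2 * (1 / (1 + π * ‖q.1‖ ^ 2) * π)) := by
        rw [Real.sqrt_mul (sq_nonneg ‖q.1‖), Real.sqrt_sq (norm_nonneg _)]
    _ ≤ 1 := by
        rw [Real.sqrt_le_one, one_div, mul_left_comm, inv_mul_le_iff₀ hr]
        linarith

lemma lpMult_coord_mul_invSqrt_heat {p : ℝ} (hp : 1 < p) (k : Fin n) :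
    LpMult p (fun q : Rn1 n => (q.1 k : ℂ) * invSqrt (1 + heatExponent q)) := by
  obtain ⟨D, hD⟩ := exists_isLpMult_of_heatType n hp (n + 10) 1 one_pos
  set w : ℕ → ℝ → ℝ := fun j t => Real.exp (-(1 * t)) * (t + ((j:ℝ) + 1)⁻¹)⁻¹ with hw
  have hε : ∀ j : ℕ, (0:ℝ) < ((j:ℝ) + 1)⁻¹ := fun j => by positivity
  have hwm : ∀ j, Measurable (w j) := fun j => by fun_prop
  have hwi : ∀ j, IntegrableOn (w j) (Set.Ioi 0) := fun j => integrableOn_regularized one_pos (hε j)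
  set M : ℕ → Rn1 n → ℂ := fun j => FT1 fun z => (heatKernel (w j) (fun z => z.1 k / √z.2) z : ℂ) with hM
  have hMe : ∀ j q, M j q = -I * (q.1 k : ℂ) *
      ∫ t in Set.Ioi (0:ℝ), ((w j t * √t : ℝ) : ℂ) * cexp (-heatExponent q * t) :=
    fun j q => FT1_heatKernel_coord (hwm j) (hwi j) k q
  have hg : ∀ q : Rn1 n, IntegrableOn (fun t : ℝ => t ^ (-(1/2) : ℝ) *
      Real.exp (-((1 + π * ‖q.1‖ ^ 2) * t))) (Set.Ioi 0) := by
    intro q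
    have hr : 0 < 1 + π * ‖q.1‖ ^ 2 := by positivity
    have := integrableOn_rpow_mul_exp_neg_mul_rpow (p := 1) (s := -(1/2)) (by norm_num) one_pos hr
    simpa only [Real.rpow_one, neg_mul] using this
  have hle : ∀ j (q : Rn1 n), ∀ t ∈ Set.Ioi (0:ℝ),
      ‖((w j t * √t : ℝ) : ℂ) * cexp (-heatExponent q * t)‖ ≤
        t ^ (-(1/2) : ℝ) * Real.exp (-((1 + π * ‖q.1‖ ^ 2) * t)) := by
    intro j q t ht
    have ht0 : (0:ℝ) < t := ht
    have hj := hε j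
    rw [norm_mul, Complex.norm_real, Real.norm_of_nonneg (by positivity), Complex.norm_exp,
      Complex.re_mul_ofReal, Complex.neg_re, heatExponent_re]
    have e1 : t ^ (-(1/2) : ℝ) = t⁻¹ * √t := by
      rw [Real.sqrt_eq_rpow, ← Real.rpow_neg_one, ← Real.rpow_add ht0]
      norm_num
    have e2 : Real.exp (-((1 + π * ‖q.1‖ ^ 2) * t)) =
        Real.exp (-(1 * t)) * Real.exp (-(π * ‖q.1‖ ^ 2) * t) := by
      rw [← Real.exp_add]
      congr 1
      ring
    have e3 : (t + ((j:ℝ) + 1)⁻¹)⁻¹ ≤ t⁻¹ := by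
      gcongr
      linarith
    rw [e1, e2]
    calc _ ≤ Real.exp (-(1 * t)) * t⁻¹ * √t * Real.exp (-(π * ‖q.1‖ ^ 2) * t) := by
          simp only [hw]
          gcongr
      _ = _ := by ring
  have hB : ∀ j q, ‖M j q‖ ≤ 1 := by
    intro j q
    rw [hMe, norm_mul, norm_mul, norm_neg, Complex.norm_I, one_mul, Complex.norm_real, Real.norm_eq_abs]
    refine le_trans ?_ (abs_coord_mul_integral_le q k)
    refine mul_le_mul_of_nonneg_left ?_ (abs_nonneg _)
    exact norm_integral_le_of_norm_le (hg q) ((ae_restrict_iff' measurableSet_Ioi).2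
      (Filter.Eventually.of_forall (hle j q)))
  have hlim : ∀ q, Filter.Tendsto (fun j => M j q) Filter.atTop
      (nhds (-I * (q.1 k : ℂ) * ((√π : ℂ) * invSqrt (1 + heatExponent q)))) := by
    intro q
    have hre : 0 < (1 + heatExponent q).re := by
      rw [Complex.add_re, heatExponent_re, Complex.one_re]
      positivity
    simp only [hMe]
    refine Filter.Tendsto.const_mul _ ?_
    rw [← integral_rpow_mul_cexp hre]
    refine tendsto_integral_of_dominated_convergence _ (fun j => by fun_prop) (hg q)
      (fun j => (ae_restrict_iff' measurableSet_Ioi).2 (Filter.Eventually.of_forall (hle j q)))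
      ((ae_restrict_iff' measurableSet_Ioi).2 (Filter.Eventually.of_forall fun t ht => ?_))
    have ht0 : (0:ℝ) < t := ht
    have e1 : t ^ (-(1/2) : ℝ) = (t + 0)⁻¹ * √t := by
      rw [Real.sqrt_eq_rpow, add_zero, ← Real.rpow_neg_one, ← Real.rpow_add ht0]
      norm_num
    have e2 : ((t ^ (-(1/2) : ℝ) : ℝ) : ℂ) * cexp (-(1 + heatExponent q) * t) =
        ((Real.exp (-(1 * t)) * (t + 0)⁻¹ * √t : ℝ) : ℂ) * cexp (-heatExponent q * t) := by
      rw [e1, neg_add, add_mul, Complex.exp_add]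
      push_cast
      rw [neg_mul]
      ring
    rw [e2]
    refine Filter.Tendsto.mul_const _ ?_
    refine (Complex.continuous_ofReal.tendsto _).comp ?_
    refine Filter.Tendsto.mul_const _ (Filter.Tendsto.const_mul _ ?_)
    refine Filter.Tendsto.inv₀ (tendsto_inv_succ.const_add t) (by rw [add_zero]; exact ht0.ne')
  have hmain : LpMult p fun q : Rn1 n => -I * (q.1 k : ℂ) * ((√π : ℂ) * invSqrt (1 + heatExponent q)) := by
    refine ⟨D, IsLpMult.of_tendsto (B := 1) ?_ (M := M) (fun j => ?_) hB (fun q => ?_)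
      (Filter.Eventually.of_forall hlim)⟩
    · have := measurable_invSqrt
      have := measurable_heatExponent (n := n)
      fun_prop
    · refine hD _ (isHeatType_heatKernel (isAmplitude_coord k) zero_le_one (hε j).le)
        (integrable_heatKernel (hwm j) (hwi j) (isAmplitude_coord k)) (hB j)
    · exact le_of_tendsto' (hlim q).norm fun j => hB j q
  refine (hmain.const_mul (I * (√π : ℂ)⁻¹)).congr fun q => ?_
  have hs : (√π : ℂ) ≠ 0 := by exact_mod_cast (Real.sqrt_pos.2 Real.pi_pos).ne'
  field_simp
  rw [Complex.I_sq]
  ring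

end Riesz

section Sign
variable {n : ℕ}

lemma integral_inv_add_mul_cexp {μ : ℂ} (hμ : 0 < μ.re) {ε : ℝ} (hε : 0 < ε) :
    ∫ t in Set.Ioi (0:ℝ), (((t + ε)⁻¹ : ℝ) : ℂ) * cexp (-μ * t) =
      ∫ u in Set.Ioi (0:ℝ), ((Real.exp (-ε * u) : ℝ) : ℂ) * (μ + u)⁻¹ := by
  have hint : Integrable (Function.uncurry fun (t u : ℝ) => cexp (-μ * t) * cexp (-((t + ε : ℝ) : ℂ) * u))
      ((volume.restrict (Set.Ioi (0:ℝ))).prod (volume.restrict (Set.Ioi (0:ℝ)))) := by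
    have h1 := (integrableOn_exp_mul_Ioi (neg_lt_zero.2 hμ) 0)
    have h2 := (integrableOn_exp_mul_Ioi (neg_lt_zero.2 hε) 0)
    refine (Integrable.mul_prod h1 h2).mono' (by fun_prop) ?_
    rw [Measure.prod_restrict, ae_restrict_iff' (measurableSet_Ioi.prod measurableSet_Ioi)]
    refine Filter.Eventually.of_forall fun z hz => ?_
    have h1 : (0:ℝ) < z.1 := hz.1
    have h2 : (0:ℝ) < z.2 := hz.2
    simp only [Function.uncurry, norm_mul, Complex.norm_exp]
    simp only [Complex.mul_re, Complex.neg_re, Complex.ofReal_re, Complex.ofReal_im, Complex.neg_im, mul_zero,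
      sub_zero]
    gcongr
    nlinarith [mul_pos h1 h2]
  have e1 : ∀ t ∈ Set.Ioi (0:ℝ), (((t + ε)⁻¹ : ℝ) : ℂ) * cexp (-μ * t) =
      ∫ u in Set.Ioi (0:ℝ), cexp (-μ * t) * cexp (-((t + ε : ℝ) : ℂ) * u) := by
    intro t ht
    have ht0 : (0:ℝ) < t := ht
    rw [integral_const_mul, integral_exp_mul_complex_Ioi (by simp; linarith) 0]
    have e : ((t:ℂ) + ε)⁻¹ = -1 / (-ε + -t) := by
      rw [← neg_add, neg_div_neg_eq, one_div, add_comm]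
    simp [mul_comm, e]
  have e2 : ∀ u ∈ Set.Ioi (0:ℝ), ((Real.exp (-ε * u) : ℝ) : ℂ) * (μ + u)⁻¹ =
      ∫ t in Set.Ioi (0:ℝ), cexp (-μ * t) * cexp (-((t + ε : ℝ) : ℂ) * u) := by
    intro u hu
    have hu0 : (0:ℝ) < u := hu
    have e : ∀ t : ℝ, cexp (-μ * t) * cexp (-((t + ε : ℝ) : ℂ) * u) =
        cexp (-(ε:ℂ) * u) * cexp (-(μ + u) * t) := by
      intro t
      rw [← Complex.exp_add, ← Complex.exp_add]
      congr 1
      push_cast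
      ring
    simp only [e]
    rw [integral_const_mul, integral_exp_mul_complex_Ioi (by simp; linarith) 0]
    have e' : (μ + u)⁻¹ = -1 / (-u + -μ) := by
      rw [← neg_add, neg_div_neg_eq, one_div, add_comm]
    simp [e']
  rw [setIntegral_congr_fun measurableSet_Ioi e1, setIntegral_congr_fun measurableSet_Ioi e2]
  exact integral_integral_swap hint

lemma integral_poisson_half (b : ℝ) :
    IntegrableOn (fun u : ℝ => 2 * b / (u ^ 2 + b ^ 2)) (Set.Ioi 0) ∧
    ∫ u in Set.Ioi (0:ℝ), 2 * b / (u ^ 2 + b ^ 2) = π * SignType.sign b := by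
  rcases eq_or_ne b 0 with rfl | hb
  · simp
  have hb' : 0 < |b|⁻¹ := by positivity
  have e : ∀ u : ℝ, 2 * b / (u ^ 2 + b ^ 2) = 2 * b * (b ^ 2)⁻¹ * (1 + (|b|⁻¹ * u) ^ 2)⁻¹ := by
    intro u
    rw [mul_pow, inv_pow, sq_abs]
    have : u ^ 2 + b ^ 2 ≠ 0 := by positivity
    have : b ^ 2 + u ^ 2 ≠ 0 := by positivity
    field_simp
    ring
  simp only [e]
  constructor
  · refine Integrable.const_mul ?_ _
    exact (integrable_inv_one_add_sq.comp_mul_left' hb'.ne').integrableOn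
  · rw [integral_const_mul, integral_comp_mul_left_Ioi (fun x => (1 + x ^ 2)⁻¹) 0 hb', mul_zero,
      integral_Ioi_inv_one_add_sq]
    rcases lt_or_gt_of_ne hb with h | h
    · rw [abs_of_neg h, sign_neg h]
      simp
      field_simp
    · rw [abs_of_pos h, sign_pos h]
      simp
      field_simp

lemma integral_poisson_half_abs_le (b : ℝ) : ∫ u in Set.Ioi (0:ℝ), 2 * |b| / (u ^ 2 + b ^ 2) ≤ π := by
  have h := (integral_poisson_half |b|).2
  simp only [sq_abs] at h
  rw [h]
  rcases eq_or_ne b 0 with rfl | hb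
  · simp [Real.pi_pos.le]
  · rw [sign_pos (abs_pos.2 hb)]
    simp

def signKernelFT (ε a b : ℝ) : ℂ :=
  (∫ t in Set.Ioi (0:ℝ), (((t + ε)⁻¹ : ℝ) : ℂ) * cexp (-(a + b * I) * t)) -
    ∫ t in Set.Ioi (0:ℝ), (((t + ε)⁻¹ : ℝ) : ℂ) * cexp (-(a - b * I) * t)

lemma integrableOn_exp_mul_inv {μ : ℂ} (hμ : 0 < μ.re) {ε : ℝ} (hε : 0 < ε) :
    IntegrableOn (fun u : ℝ => ((Real.exp (-ε * u) : ℝ) : ℂ) * (μ + u)⁻¹) (Set.Ioi 0) := by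
  have h2 := (integrableOn_exp_mul_Ioi (neg_lt_zero.2 hε) 0).mul_const μ.re⁻¹
  refine h2.mono' (by fun_prop) ((ae_restrict_iff' measurableSet_Ioi).2
    (Filter.Eventually.of_forall fun u hu => ?_))
  have hu0 : (0:ℝ) < u := hu
  rw [norm_mul, Complex.norm_real, Real.norm_of_nonneg (by positivity), norm_inv]
  gcongr
  refine le_trans ?_ (Complex.re_le_norm _)
  simp
  exact hu0.le

lemma signKernelFT_eq {ε a : ℝ} (hε : 0 < ε) (ha : 0 < a) (b : ℝ) :
    signKernelFT ε a b =
      -I * ∫ u in Set.Ioi (0:ℝ), ((Real.exp (-ε * u) * (2 * b / ((a + u) ^ 2 + b ^ 2)) : ℝ) : ℂ) := by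
  have h1 : 0 < ((a:ℂ) + b * I).re := by simpa using ha
  have h2 : 0 < ((a:ℂ) - b * I).re := by simpa using ha
  rw [signKernelFT, integral_inv_add_mul_cexp h1 hε, integral_inv_add_mul_cexp h2 hε,
    ← integral_sub (integrableOn_exp_mul_inv h1 hε) (integrableOn_exp_mul_inv h2 hε), ← integral_const_mul]
  refine setIntegral_congr_fun measurableSet_Ioi fun u hu => ?_
  have hu0 : (0:ℝ) < u := hu
  have n1 : ((a:ℂ) + b * I + u) ≠ 0 := fun h => by
    have := congrArg Complex.re h
    simp at this
    linarith
  have n2 : ((a:ℂ) - b * I + u) ≠ 0 := fun h => by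
    have := congrArg Complex.re h
    simp at this
    linarith
  have e : ((a:ℂ) + u) ^ 2 + b ^ 2 = ((a:ℂ) + b * I + u) * ((a:ℂ) - b * I + u) := by
    ring_nf
    rw [Complex.I_sq]
    ring
  push_cast
  rw [e]
  field_simp
  ring

lemma norm_poisson_le {ε a : ℝ} (hε : 0 ≤ ε) (ha : 0 ≤ a) (b : ℝ) {u : ℝ} (hu : 0 < u) :
    ‖((Real.exp (-ε * u) * (2 * b / ((a + u) ^ 2 + b ^ 2)) : ℝ) : ℂ)‖ ≤ 2 * |b| / (u ^ 2 + b ^ 2) := by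
  rw [Complex.norm_real, norm_mul, Real.norm_of_nonneg (Real.exp_pos _).le, norm_div, norm_mul,
    Real.norm_of_nonneg (by positivity : 0 ≤ (a + u) ^ 2 + b ^ 2), Real.norm_eq_abs b, Real.norm_two]
  rw [← one_mul (2 * |b| / (u ^ 2 + b ^ 2))]
  have : Real.exp (-ε * u) ≤ 1 := Real.exp_le_one_iff.2 (by nlinarith)
  gcongr
  linarith

lemma integrableOn_poisson_abs (b : ℝ) :
    IntegrableOn (fun u : ℝ => 2 * |b| / (u ^ 2 + b ^ 2)) (Set.Ioi 0) := by
  have h := (integral_poisson_half |b|).1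
  simpa only [sq_abs] using h

lemma norm_signKernelFT_le {ε a : ℝ} (hε : 0 < ε) (ha : 0 < a) (b : ℝ) : ‖signKernelFT ε a b‖ ≤ 4 := by
  rw [signKernelFT_eq hε ha, norm_mul, norm_neg, Complex.norm_I, one_mul]
  refine le_trans ?_ ((integral_poisson_half_abs_le b).trans Real.pi_le_four)
  exact norm_integral_le_of_norm_le (integrableOn_poisson_abs b) ((ae_restrict_iff' measurableSet_Ioi).2
    (Filter.Eventually.of_forall fun u hu => norm_poisson_le hε.le ha.le b hu))

lemma tendsto_signKernelFT {ε a : ℕ → ℝ} (hε : ∀ j, 0 < ε j) (ha : ∀ j, 0 < a j)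
    (hε0 : Filter.Tendsto ε Filter.atTop (nhds 0)) (ha0 : Filter.Tendsto a Filter.atTop (nhds 0)) (b : ℝ) :
    Filter.Tendsto (fun j => signKernelFT (ε j) (a j) b) Filter.atTop
      (nhds (-I * ((π * SignType.sign b : ℝ) : ℂ))) := by
  simp only [signKernelFT_eq (hε _) (ha _)]
  refine Filter.Tendsto.const_mul _ ?_
  rw [← (integral_poisson_half b).2, ← integral_complex_ofReal]
  refine tendsto_integral_of_dominated_convergence _ (fun j => by fun_prop) (integrableOn_poisson_abs b)
      (fun j => (ae_restrict_iff' measurableSet_Ioi).2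
        (Filter.Eventually.of_forall fun u hu => norm_poisson_le (hε j).le (ha j).le b hu))
      ((ae_restrict_iff' measurableSet_Ioi).2 (Filter.Eventually.of_forall fun u hu => ?_))
  have hu0 : (0:ℝ) < u := hu
  refine (Complex.continuous_ofReal.tendsto _).comp ?_
  have h1 : Filter.Tendsto (fun j => Real.exp (-ε j * u)) Filter.atTop (nhds 1) := by
    have := (Real.continuous_exp.tendsto _).comp ((hε0.neg).mul_const u)
    simpa [Function.comp_def] using this
  have h2 : Filter.Tendsto (fun j => 2 * b / ((a j + u) ^ 2 + b ^ 2)) Filter.atTop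
      (nhds (2 * b / ((0 + u) ^ 2 + b ^ 2))) :=
    Filter.Tendsto.div tendsto_const_nhds (((ha0.add_const u).pow 2).add_const _) (by positivity)
  simpa using h1.mul h2

lemma FT1_comp_neg (f : Rn1 n → ℂ) (q : Rn1 n) : FT1 (fun z => f (-z)) q = FT1 f (-q) := by
  simp only [FT1_eq]
  rw [← integral_neg_eq_self]
  refine integral_congr_ae (Filter.Eventually.of_forall fun y => ?_)
  simp only [neg_neg]
  congr 1
  simp [character, pairing]

lemma FT1_sub {f g : Rn1 n → ℂ} (hf : Integrable f) (hg : Integrable g) (q : Rn1 n) :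
    FT1 (fun z => f z - g z) q = FT1 f q - FT1 g q := by
  simp only [FT1_eq, mul_sub]
  have key : ∀ {h : Rn1 n → ℂ}, Integrable h → Integrable fun y => character q (-y) * h y := fun hh =>
    hh.bdd_mul (c := 1) ((continuous_character_right q).comp continuous_neg).aestronglyMeasurable
      (Filter.Eventually.of_forall fun y => (norm_character q _).le)
  exact integral_sub (key hf) (key hg)

lemma FT1_signKernel {η ε : ℝ} (hη : 0 < η) (hε : 0 < ε) (q : Rn1 n) :
    FT1 (fun z => (heatKernel (fun t => Real.exp (-(η * t)) * (t + ε)⁻¹) (fun _ => 1) z : ℂ) -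
      (heatKernel (fun t => Real.exp (-(η * t)) * (t + ε)⁻¹) (fun _ => 1) (-z) : ℂ)) q =
      signKernelFT ε (η + π * ‖q.1‖ ^ 2) (2 * π * q.2) := by
  have hwm : Measurable fun t => Real.exp (-(η * t)) * (t + ε)⁻¹ := by fun_prop
  have hi : Integrable fun z : Rn1 n =>
      (heatKernel (fun t => Real.exp (-(η * t)) * (t + ε)⁻¹) (fun _ => 1) z : ℂ) :=
    (integrable_heatKernel hwm (integrableOn_regularized hη hε) isAmplitude_one).ofReal
  have hi' : Integrable fun z : Rn1 n =>
      (heatKernel (fun t => Real.exp (-(η * t)) * (t + ε)⁻¹) (fun _ => 1) (-z) : ℂ) := hi.comp_neg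
  rw [FT1_sub hi hi', FT1_comp_neg (fun z => ((heatKernel _ _ z : ℝ) : ℂ)),
    FT1_heatKernel_one hwm (integrableOn_regularized hη hε),
    FT1_heatKernel_one hwm (integrableOn_regularized hη hε), signKernelFT]
  congr 1
  all_goals
    refine setIntegral_congr_fun measurableSet_Ioi fun t ht => ?_
    simp only [heatExponent, Prod.fst_neg, Prod.snd_neg, norm_neg]
    push_cast
    rw [mul_comm (cexp _) _, mul_assoc, ← Complex.exp_add]
    congr 2
    ring

lemma lpMult_sign {p : ℝ} (hp : 1 < p) :
    LpMult p (fun q : Rn1 n => ((SignType.sign q.2 : ℝ) : ℂ)) := by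
  obtain ⟨D, hD⟩ := exists_isLpMult_of_heatType_odd n hp (n + 10) 4 (by norm_num)
  set δ : ℕ → ℝ := fun j => ((j:ℝ) + 1)⁻¹ with hδ
  have hδ0 : ∀ j, 0 < δ j := fun j => by simp only [hδ]; positivity
  set M : ℕ → Rn1 n → ℂ := fun j q => signKernelFT (δ j) (δ j + π * ‖q.1‖ ^ 2) (2 * π * q.2) with hM
  have hpos : ∀ j (x : ℝ), 0 < δ j + π * x ^ 2 := fun j x => by
    have := hδ0 j
    have := Real.pi_pos
    positivity
  have hB : ∀ j q, ‖M j q‖ ≤ 4 := fun j q => norm_signKernelFT_le (hδ0 j) (hpos j _) _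
  have hMD : ∀ j, IsLpMult p (M j) D := by
    intro j
    have hk := isHeatType_heatKernel (n := n) isAmplitude_one (hδ0 j).le (hδ0 j).le
    have := hD _ hk (integrable_heatKernel (by fun_prop) (integrableOn_regularized (hδ0 j) (hδ0 j)) isAmplitude_one)
    rw [show FT1 (fun z : Rn1 n => (heatKernel (fun t => Real.exp (-(δ j * t)) * (t + δ j)⁻¹) (fun _ => 1) z : ℂ) -
      (heatKernel (fun t => Real.exp (-(δ j * t)) * (t + δ j)⁻¹) (fun _ => 1) (-z) : ℂ)) = M j from
      funext fun q => FT1_signKernel (hδ0 j) (hδ0 j) q] at this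
    exact this (hB j)
  have hs : Measurable fun q : Rn1 n => ((SignType.sign q.2 : ℝ) : ℂ) := by
    have : Measurable fun x : ℝ => (SignType.sign x : ℝ) := by
      have e : (fun x : ℝ => (SignType.sign x : ℝ)) = fun x => if 0 < x then 1 else if x < 0 then -1 else 0 := by
        funext x
        rcases lt_trichotomy x 0 with h | h | h
        · simp [h, h.not_gt]
        · simp [h]
        · simp [h]
      rw [e]
      exact Measurable.ite measurableSet_Ioi measurable_const
        (Measurable.ite measurableSet_Iio measurable_const measurable_const)
    exact Complex.measurable_ofReal.comp (this.comp measurable_snd)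
  have hlim : ∀ q : Rn1 n, Filter.Tendsto (fun j => M j (δ j • q.1, 1 * q.2)) Filter.atTop
      (nhds (-I * ((π * SignType.sign q.2 : ℝ) : ℂ))) := by
    intro q
    have h0 : Filter.Tendsto δ Filter.atTop (nhds 0) := tendsto_inv_succ
    have h1 : Filter.Tendsto (fun j => δ j + π * ‖δ j • q.1‖ ^ 2) Filter.atTop (nhds 0) := by
      have := h0.add ((((h0.smul_const q.1).norm).pow 2).const_mul π)
      simpa using this
    have := tendsto_signKernelFT hδ0 (fun j => hpos j ‖δ j • q.1‖) h0 h1 (2 * π * q.2)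
    rw [sign_mul, sign_pos (by positivity : 0 < 2 * π), one_mul] at this
    simpa only [hM, one_mul] using this
  have hmain : LpMult p fun q : Rn1 n => -I * ((π * SignType.sign q.2 : ℝ) : ℂ) := by
    refine ⟨D, IsLpMult.of_tendsto (B := 4) ?_ (M := fun j q => M j (δ j • q.1, 1 * q.2))
      (fun j => (hMD j).dilate hp.le (hδ0 j) one_pos) (fun j q => hB j _) (fun q => ?_)
      (Filter.Eventually.of_forall hlim)⟩
    · simp only [Complex.ofReal_mul]
      exact (hs.const_mul _).const_mul _
    · exact le_of_tendsto' (hlim q).norm fun j => hB j _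
  refine (hmain.const_mul (I * (π : ℂ)⁻¹)).congr fun q => ?_
  have hs : (π : ℂ) ≠ 0 := by exact_mod_cast Real.pi_ne_zero
  push_cast
  field_simp
  rw [Complex.I_sq]
  ring

end Sign

section HalfDerivative
variable {n : ℕ}

lemma integrable_rpow_mul_cexp_prod {ζ : ℂ} (h : 0 < ζ.re) :
    Integrable (Function.uncurry fun (s v : ℝ) => ((v ^ (-(1/2) : ℝ) : ℝ) : ℂ) * cexp (-(ζ + v) * s))
      ((volume.restrict (Set.Ioi (0:ℝ))).prod (volume.restrict (Set.Ioi (0:ℝ)))) := by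
  have hm : Measurable (Function.uncurry fun (s v : ℝ) =>
      ((v ^ (-(1/2) : ℝ) : ℝ) : ℂ) * cexp (-(ζ + v) * s)) := by
    simp only [Function.uncurry_def]
    fun_prop
  have e : ∀ s v : ℝ, ((v ^ (-(1/2) : ℝ) : ℝ) : ℂ) * cexp (-(ζ + v) * s) =
      cexp (-ζ * s) * (((v ^ (-(1/2) : ℝ) : ℝ) : ℂ) * cexp (-(s:ℂ) * v)) := by
    intro s v
    rw [mul_left_comm, ← Complex.exp_add]
    congr 2
    ring
  rw [integrable_prod_iff hm.aestronglyMeasurable]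
  constructor
  · refine (ae_restrict_iff' measurableSet_Ioi).2 (Filter.Eventually.of_forall fun s hs => ?_)
    simp only [Function.uncurry, e]
    exact (integrableOn_rpow_mul_cexp (μ := (s:ℂ)) (by simpa using hs)).const_mul _
  · have h1 := ((integrableOn_rpow_mul_cexp h).norm.mul_const √π)
    refine h1.congr ((ae_restrict_iff' measurableSet_Ioi).2 (Filter.Eventually.of_forall fun s hs => ?_))
    have hs0 : (0:ℝ) < s := hs
    have h2 := Real.integral_rpow_mul_exp_neg_mul_Ioi (a := 1 / 2) (by norm_num) hs0
    rw [show (1/2 - 1 : ℝ) = -(1/2) by norm_num, Real.Gamma_one_half_eq] at h2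
    have h3 : ∀ v ∈ Set.Ioi (0:ℝ), ‖((v ^ (-(1/2) : ℝ) : ℝ) : ℂ) * cexp (-(ζ + v) * s)‖ =
        ‖cexp (-ζ * s)‖ * (v ^ (-(1/2) : ℝ) * Real.exp (-(s * v))) := by
      intro v hv
      have hv0 : (0:ℝ) < v := hv
      rw [e, norm_mul, norm_mul, Complex.norm_real, Real.norm_of_nonneg (by positivity), Complex.norm_exp (-(s:ℂ) * v)]
      simp
    simp only [Function.uncurry]
    have h4 : (1 / s) ^ (1 / 2 : ℝ) = s ^ (-(1/2) : ℝ) := by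
      rw [one_div s, Real.inv_rpow hs0.le, ← Real.rpow_neg hs0.le]
    rw [setIntegral_congr_fun measurableSet_Ioi h3, integral_const_mul, h2, h4, norm_mul, Complex.norm_real,
      Real.norm_of_nonneg (by positivity)]
    ring

lemma integral_cexp_neg {μ : ℂ} (h : 0 < μ.re) : ∫ s in Set.Ioi (0:ℝ), cexp (-μ * s) = μ⁻¹ := by
  rw [integral_exp_mul_complex_Ioi (by simpa using h) 0]
  simp

lemma integral_rpow_mul_cexp_prod_left {ζ : ℂ} (h : 0 < ζ.re) {v : ℝ} (hv : 0 < v) :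
    ∫ s in Set.Ioi (0:ℝ), ((v ^ (-(1/2) : ℝ) : ℝ) : ℂ) * cexp (-(ζ + v) * s) =
      ((v ^ (-(1/2) : ℝ) : ℝ) : ℂ) * (ζ + v)⁻¹ := by
  rw [integral_const_mul, integral_cexp_neg (by simp; linarith)]

lemma integrableOn_rpow_mul_inv_add {ζ : ℂ} (h : 0 < ζ.re) :
    IntegrableOn (fun v : ℝ => ((v ^ (-(1/2) : ℝ) : ℝ) : ℂ) * (ζ + v)⁻¹) (Set.Ioi 0) :=
  ((integrable_rpow_mul_cexp_prod h).integral_prod_right).congr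
    ((ae_restrict_iff' measurableSet_Ioi).2 (Filter.Eventually.of_forall fun _ hv =>
      integral_rpow_mul_cexp_prod_left h hv))

lemma integral_rpow_mul_inv_add {ζ : ℂ} (h : 0 < ζ.re) :
    ∫ v in Set.Ioi (0:ℝ), ((v ^ (-(1/2) : ℝ) : ℝ) : ℂ) * (ζ + v)⁻¹ = π * invSqrt ζ := by
  rw [← setIntegral_congr_fun measurableSet_Ioi (fun v hv => integral_rpow_mul_cexp_prod_left h hv),
    ← integral_integral_swap (integrable_rpow_mul_cexp_prod h)]
  have e : ∀ s ∈ Set.Ioi (0:ℝ), ∫ v in Set.Ioi (0:ℝ), ((v ^ (-(1/2) : ℝ) : ℝ) : ℂ) * cexp (-(ζ + v) * s) =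
      (√π : ℂ) * (((s ^ (-(1/2) : ℝ) : ℝ) : ℂ) * cexp (-ζ * s)) := by
    intro s hs
    have hs0 : (0:ℝ) < s := hs
    have e1 : ∀ v : ℝ, ((v ^ (-(1/2) : ℝ) : ℝ) : ℂ) * cexp (-(ζ + v) * s) =
        cexp (-ζ * s) * (((v ^ (-(1/2) : ℝ) : ℝ) : ℂ) * cexp (-(s:ℂ) * v)) := by
      intro v
      rw [mul_left_comm, ← Complex.exp_add]
      congr 2
      ring
    simp only [e1]
    rw [integral_const_mul, integral_rpow_mul_cexp (by simpa using hs0), invSqrt, Complex.ofReal_cpow hs0.le]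
    push_cast
    rw [show (-(1/2) : ℂ) = -1/2 by ring]
    ring
  rw [setIntegral_congr_fun measurableSet_Ioi e, integral_const_mul, integral_rpow_mul_cexp h, ← mul_assoc,
    ← Complex.ofReal_mul, Real.mul_self_sqrt Real.pi_pos.le]

/-- The parabolic symbol `1 + 4π²|ξ|² + iτ`. -/
def parSymbol (q : Rn1 n) : ℂ := 1 + 4 * (π : ℂ) ^ 2 * (‖q.1‖ : ℂ) ^ 2 + I * (q.2 : ℂ)

lemma parSymbol_re (q : Rn1 n) : (parSymbol q).re = 1 + 4 * π ^ 2 * ‖q.1‖ ^ 2 := by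
  have : parSymbol q = ((1 + 4 * π ^ 2 * ‖q.1‖ ^ 2 : ℝ) : ℂ) + I * (q.2 : ℂ) := by
    rw [parSymbol]
    push_cast
    ring
  rw [this, Complex.add_re, Complex.ofReal_re, mul_comm I, Complex.re_ofReal_mul, Complex.I_re, mul_zero, add_zero]

lemma parSymbol_re_pos (q : Rn1 n) : 0 < (parSymbol q).re := by
  rw [parSymbol_re]
  positivity

lemma parSymbol_ne_zero (q : Rn1 n) : parSymbol q ≠ 0 := fun h => by
  have := parSymbol_re_pos q
  simp [h] at this

lemma heatExponent_dilate (q : Rn1 n) :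
    1 + heatExponent ((2 * √π) • q.1, (2 * π)⁻¹ * q.2) = parSymbol q := by
  have hp : (π : ℂ) ≠ 0 := by exact_mod_cast Real.pi_ne_zero
  have hs : ((√π : ℝ) : ℂ) ^ 2 = π := by exact_mod_cast Real.sq_sqrt Real.pi_pos.le
  simp only [heatExponent, parSymbol, norm_smul, Real.norm_of_nonneg (by positivity : 0 ≤ 2 * √π)]
  push_cast
  rw [mul_pow, mul_pow, hs]
  field_simp
  ring

lemma lpMult_invSqrt_parSymbol {p : ℝ} (hp : 1 ≤ p) : LpMult p fun q : Rn1 n => invSqrt (parSymbol q) :=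
  ((lpMult_invSqrt_heat hp).dilate hp (a := 2 * √π) (b := (2 * π)⁻¹) (by positivity) (by positivity)).congr
    fun q => by rw [heatExponent_dilate]

lemma lpMult_coord_mul_invSqrt_parSymbol {p : ℝ} (hp : 1 < p) (k : Fin n) :
    LpMult p fun q : Rn1 n => (q.1 k : ℂ) * invSqrt (parSymbol q) := by
  refine (((lpMult_coord_mul_invSqrt_heat hp k).dilate hp.le (a := 2 * √π) (b := (2 * π)⁻¹)
    (by positivity) (by positivity)).const_mul ((2 * √π : ℝ) : ℂ)⁻¹).congr fun q => ?_
  have hs : ((2 * √π : ℝ) : ℂ) ≠ 0 := by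
    exact_mod_cast (by positivity : (0:ℝ) < 2 * √π).ne'
  rw [heatExponent_dilate]
  simp only [PiLp.smul_apply, smul_eq_mul]
  rw [Complex.ofReal_mul (2 * √π), mul_assoc, inv_mul_cancel_left₀ hs]

lemma sum_coord_sq (q : Rn1 n) : ∑ k, (q.1 k : ℂ) ^ 2 = (‖q.1‖ : ℂ) ^ 2 := by
  have := EuclideanSpace.real_norm_sq_eq q.1
  rw [← Complex.ofReal_pow, this]
  push_cast
  rfl

lemma lpMult_time_div_parSymbol {p : ℝ} (hp : 1 < p) :
    LpMult p fun q : Rn1 n => I * (q.2 : ℂ) / parSymbol q := by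
  have hL := lpMult_invSqrt_parSymbol (n := n) hp.le
  have hR := lpMult_coord_mul_invSqrt_parSymbol (n := n) hp
  have hS := LpMult.sum hp.le Finset.univ fun k _ => (hR k).mul (hR k)
  refine (((LpMult.const p 1).add hp.le ((hL.mul hL).const_mul (-1))).add hp.le
    (hS.const_mul (-(4 * π ^ 2)))).congr fun q => ?_
  have hsq : invSqrt (parSymbol q) * invSqrt (parSymbol q) = (parSymbol q)⁻¹ := by
    rw [← sq, invSqrt_sq (parSymbol_re_pos q)]
  have e : ∀ k, (q.1 k : ℂ) * invSqrt (parSymbol q) * ((q.1 k : ℂ) * invSqrt (parSymbol q)) =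
      (q.1 k : ℂ) ^ 2 * (parSymbol q)⁻¹ := fun k => by
    rw [← hsq]
    ring
  have hne := parSymbol_ne_zero q
  simp only [e, hsq]
  rw [← Finset.sum_mul, sum_coord_sq]
  field_simp
  simp only [parSymbol]
  ring

lemma parSymbol_div_time_re (q : Rn1 n) (hq : q.2 ≠ 0) : (parSymbol q / (I * q.2)).re = 1 := by
  have hτ : (q.2 : ℂ) ≠ 0 := by exact_mod_cast hq
  have : parSymbol q / (I * q.2) = 1 + ((-(1 + 4 * π ^ 2 * ‖q.1‖ ^ 2) / q.2 : ℝ) : ℂ) * I := by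
    simp only [parSymbol]
    push_cast
    field_simp
    ring_nf
    rw [Complex.I_sq]
    ring
  rw [this, Complex.add_re, Complex.re_ofReal_mul, Complex.I_re, Complex.one_re, mul_zero, add_zero]

lemma integral_halfDeriv (q : Rn1 n) (hq : q.2 ≠ 0) :
    ∫ v in Set.Ioi (0:ℝ), (((v ^ (-(1/2) : ℝ) : ℝ) : ℂ) * (1 + (v:ℂ))⁻¹) *
      (I * (((1 + |v|) * q.2 : ℝ) : ℂ) / parSymbol ((1:ℝ) • q.1, (1 + |v|) * q.2)) =
      π * invSqrt (parSymbol q / (I * q.2)) := by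
  have hτ : (q.2 : ℂ) ≠ 0 := by exact_mod_cast hq
  rw [← integral_rpow_mul_inv_add (by rw [parSymbol_div_time_re q hq]; exact one_pos)]
  refine setIntegral_congr_fun measurableSet_Ioi fun v hv => ?_
  have hv0 : (0:ℝ) < v := hv
  have h1 : (1 + v : ℂ) ≠ 0 := by exact_mod_cast (by positivity : 1 + v ≠ 0)
  have e : parSymbol ((1:ℝ) • q.1, (1 + v) * q.2) = parSymbol q + v * (I * q.2) := by
    simp only [parSymbol, one_smul]
    push_cast
    ring
  have h2 : parSymbol q + v * (I * q.2) ≠ 0 := e ▸ parSymbol_ne_zero _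
  have e3 : (parSymbol q / (I * q.2) + v)⁻¹ = I * q.2 / (parSymbol q + v * (I * q.2)) := by
    rw [div_add' _ _ _ (mul_ne_zero I_ne_zero hτ), inv_div]
  simp only [abs_of_pos hv0]
  rw [e, e3]
  push_cast
  field_simp

lemma abs_im_lt_re_invSqrt {μ : ℂ} (h : 0 < μ.re) : |(invSqrt μ).im| < (invSqrt μ).re := by
  have h1 := congrArg Complex.re (invSqrt_sq h)
  have h2 : 0 < (μ⁻¹).re := by
    rw [Complex.inv_re]
    exact div_pos h (Complex.normSq_pos.2 fun h' => by simp [h'] at h)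
  rw [sq, Complex.mul_re] at h1
  refine abs_lt_of_sq_lt_sq ?_ (invSqrt_re_pos h).le
  nlinarith

lemma invSqrt_time (q : Rn1 n) (hq : q.2 ≠ 0) :
    invSqrt (parSymbol q / (I * q.2)) =
      (√2 : ℂ)⁻¹ * (1 + I * ((SignType.sign q.2 : ℝ) : ℂ)) *
        (((|q.2| ^ ((1:ℝ)/2) : ℝ) : ℂ) * invSqrt (parSymbol q)) := by
  have hτ : (q.2 : ℂ) ≠ 0 := by exact_mod_cast hq
  have hL := abs_lt.1 (abs_im_lt_re_invSqrt (parSymbol_re_pos q))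
  have hr : 0 < |q.2| ^ ((1:ℝ)/2) := Real.rpow_pos_of_pos (abs_pos.2 hq) _
  have hr2 : (((|q.2| ^ ((1:ℝ)/2) : ℝ) : ℂ)) ^ 2 = (|q.2| : ℝ) := by
    rw [← Complex.ofReal_pow, ← Real.sqrt_eq_rpow, Real.sq_sqrt (abs_nonneg _)]
  have hs2 : ((√2 : ℝ) : ℂ) ^ 2 = 2 := by exact_mod_cast Real.sq_sqrt zero_le_two
  have hσ : (SignType.sign q.2 : ℝ) = 1 ∨ (SignType.sign q.2 : ℝ) = -1 := by
    rcases lt_or_gt_of_ne hq with h | h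
    · right
      simp [sign_neg h]
    · left
      simp [sign_pos h]
  have hσ2 : ((SignType.sign q.2 : ℝ) : ℂ) * (|q.2| : ℝ) = q.2 := by
    exact_mod_cast sign_mul_abs q.2
  set σ : ℝ := (SignType.sign q.2 : ℝ)
  have hσsq : (σ : ℂ) ^ 2 = 1 := by
    rcases hσ with h | h <;> simp [h]
  refine eq_of_sq_eq_of_re_pos ?_ (invSqrt_re_pos ?_) ?_
  · rw [invSqrt_sq (by rw [parSymbol_div_time_re q hq]; exact one_pos), mul_pow, mul_pow, mul_pow,
      invSqrt_sq (parSymbol_re_pos q), hr2, inv_pow, hs2, inv_div]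
    have : (1 + I * σ) ^ 2 = 2 * I * σ := by
      linear_combination (σ:ℂ) ^ 2 * Complex.I_sq - hσsq
    rw [this, ← hσ2]
    ring
  · rw [parSymbol_div_time_re q hq]
    exact one_pos
  · have e : (√2 : ℂ)⁻¹ * (1 + I * (σ : ℂ)) * (((|q.2| ^ ((1:ℝ)/2) : ℝ) : ℂ) * invSqrt (parSymbol q)) =
        (((√2)⁻¹ * |q.2| ^ ((1:ℝ)/2) : ℝ) : ℂ) * ((1 + I * (σ : ℂ)) * invSqrt (parSymbol q)) := by
      push_cast
      ring
    rw [e, Complex.re_ofReal_mul]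
    refine mul_pos (by positivity) ?_
    rcases hσ with h | h
    · simp [h]
      linarith
    · simp [h]
      linarith

lemma measurable_parSymbol : Measurable (parSymbol (n := n)) := by
  unfold parSymbol
  fun_prop

lemma exists_lpMult_average {p : ℝ} (hp : 1 < p) :
    LpMult p fun q : Rn1 n => ∫ v in Set.Ioi (0:ℝ), (((v ^ (-(1/2) : ℝ) : ℝ) : ℂ) * (1 + (v:ℂ))⁻¹) *
      (I * (((1 + |v|) * q.2 : ℝ) : ℂ) / parSymbol ((1:ℝ) • q.1, (1 + |v|) * q.2)) := by
  obtain ⟨C, hC⟩ := lpMult_time_div_parSymbol (n := n) hp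
  obtain ⟨B, hB⟩ := hC.bounded
  have hw := integrableOn_rpow_mul_inv_add (ζ := 1) (by simp)
  have hwm : Measurable fun v : ℝ => ((v ^ (-(1/2) : ℝ) : ℝ) : ℂ) * (1 + (v:ℂ))⁻¹ := by fun_prop
  refine ⟨_, IsLpMult.average (μ := volume.restrict (Set.Ioi (0:ℝ))) hp.le hw hwm
    (M := fun v q => I * (((1 + |v|) * q.2 : ℝ) : ℂ) / parSymbol ((1:ℝ) • q.1, (1 + |v|) * q.2))
    (B := B) ?_ (fun v q => hB ((1:ℝ) • q.1, (1 + |v|) * q.2))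
    (fun v => hC.dilate hp.le one_pos (by positivity : 0 < 1 + |v|))⟩
  have h1 : Measurable fun z : ℝ × Rn1 n => (((1:ℝ) • z.2.1, (1 + |z.1|) * z.2.2) : Rn1 n) := by
    have : Measurable fun z : ℝ × Rn1 n => |z.1| := measurable_fst.abs
    fun_prop
  have h2 := measurable_parSymbol.comp h1
  have h3 : Measurable fun z : ℝ × Rn1 n => I * (((1 + |z.1|) * z.2.2 : ℝ) : ℂ) :=
    (Complex.measurable_ofReal.comp h1.snd).const_mul I
  exact h3.div h2

lemma lpMult_halfDeriv {p : ℝ} (hp : 1 < p) :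
    LpMult p fun q : Rn1 n => ((|q.2| ^ ((1:ℝ)/2) : ℝ) : ℂ) * invSqrt (parSymbol q) := by
  refine (((exists_lpMult_average hp).const_mul (π : ℂ)⁻¹).mul ((((lpMult_sign hp).const_mul (-I)).add hp.le
      (LpMult.const p 1)).const_mul (√2 : ℂ)⁻¹)).congr fun q => ?_
  rcases eq_or_ne q.2 0 with hq | hq
  · simp [hq]
  · have hπ : (π : ℂ) ≠ 0 := by exact_mod_cast Real.pi_ne_zero
    have hs : ((√2 : ℝ) : ℂ)⁻¹ ^ 2 = 2⁻¹ := by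
      rw [inv_pow, ← Complex.ofReal_pow, Real.sq_sqrt zero_le_two, Complex.ofReal_ofNat]
    have hσ : ((SignType.sign q.2 : ℝ) : ℂ) ^ 2 = 1 := by
      rcases lt_or_gt_of_ne hq with h | h
      · simp [sign_neg h]
      · simp [sign_pos h]
    rw [integral_halfDeriv q hq, invSqrt_time q hq, inv_mul_cancel_left₀ hπ]
    generalize ((SignType.sign q.2 : ℝ) : ℂ) = σ at *
    generalize ((|q.2| ^ ((1:ℝ)/2) : ℝ) : ℂ) * invSqrt (parSymbol q) = W
    have : (1 + I * σ) * (-I * σ + 1) = 2 := by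
      linear_combination hσ - σ ^ 2 * Complex.I_sq
    calc W = (2⁻¹ * 2) * W := by norm_num
      _ = _ := by
        rw [← hs, ← this]
        ring

end HalfDerivative

section ParabolicSobolev
variable {n : ℕ}

lemma mSym_sub_one (α : ℝ) (q : Rn1 n) : mSym (α - 1) q = invSqrt (parSymbol q) * mSym α q := by
  change parSymbol q ^ _ = parSymbol q ^ _ * parSymbol q ^ _
  rw [← Complex.cpow_add _ _ (parSymbol_ne_zero q)]
  congr 1
  push_cast
  ring

lemma measurable_mSym (α : ℝ) : Measurable (mSym (n := n) α) :=
  (measurable_parSymbol (n := n)).pow_const _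

lemma one_le_norm_parSymbol (q : Rn1 n) : 1 ≤ ‖parSymbol q‖ := by
  refine le_trans ?_ (Complex.re_le_norm _)
  rw [parSymbol_re]
  nlinarith [sq_nonneg (π * ‖q.1‖)]

lemma norm_parSymbol_le (q : Rn1 n) : ‖parSymbol q‖ ≤ 4 * π ^ 2 * (1 + ‖q‖) ^ 2 := by
  have h1 : ‖parSymbol q‖ ≤ 1 + 4 * π ^ 2 * ‖q.1‖ ^ 2 + |q.2| := by
    refine (norm_add_le _ _).trans (add_le_add ((norm_add_le _ _).trans (le_of_eq ?_)) (le_of_eq ?_))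
    · simp
    · simp
  have h2 : ‖q.1‖ ≤ ‖q‖ := norm_fst_le q
  have h3 : |q.2| ≤ ‖q‖ := norm_snd_le q
  have h4 : (1:ℝ) ≤ 4 * π ^ 2 := by nlinarith [Real.pi_gt_three]
  have h5 : ‖q.1‖ ^ 2 ≤ ‖q‖ ^ 2 := by gcongr
  have h0 := norm_nonneg q
  nlinarith

lemma norm_mSym_le (α : ℝ) (N : ℕ) (hN : α / 2 ≤ N) (q : Rn1 n) :
    ‖mSym α q‖ ≤ (4 * π ^ 2) ^ N * (2 ^ (2 * N - 1) * (1 + ‖q‖ ^ (2 * N))) := by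
  have e : mSym α q = parSymbol q ^ ((α / 2 : ℝ) : ℂ) := by
    change parSymbol q ^ _ = _
    congr 1
    push_cast
    ring
  rw [e, Complex.norm_cpow_real]
  calc ‖parSymbol q‖ ^ (α / 2) ≤ ‖parSymbol q‖ ^ (N : ℝ) :=
        Real.rpow_le_rpow_of_exponent_le (one_le_norm_parSymbol q) hN
    _ = ‖parSymbol q‖ ^ N := Real.rpow_natCast _ _
    _ ≤ (4 * π ^ 2 * (1 + ‖q‖) ^ 2) ^ N := by
        gcongr
        exact norm_parSymbol_le q
    _ = (4 * π ^ 2) ^ N * (1 + ‖q‖) ^ (2 * N) := by rw [mul_pow, ← pow_mul]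
    _ ≤ _ := by
        gcongr
        simpa using add_pow_le zero_le_one (norm_nonneg q) (2 * N)

lemma integrable_mSym_mul_FT1 (α : ℝ) (f : SchwartzMap (Rn1 n) ℂ) :
    Integrable fun q : Rn1 n => mSym α q * FT1 f q := by
  obtain ⟨N, hN⟩ := exists_nat_ge (α / 2)
  rw [← coe_schwartzFT]
  set g := schwartzFT f
  have h1 := (g.integrable_pow_mul volume 0).add (g.integrable_pow_mul volume (2 * N))
  refine (h1.const_mul ((4 * π ^ 2) ^ N * 2 ^ (2 * N - 1))).mono'
    ((measurable_mSym α).mul g.continuous.measurable).aestronglyMeasurable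
    (Filter.Eventually.of_forall fun q => ?_)
  rw [norm_mul]
  refine (mul_le_mul_of_nonneg_right (norm_mSym_le α N hN q) (norm_nonneg _)).trans (le_of_eq ?_)
  simp only [Pi.add_apply]
  ring

lemma differentiable_character_neg (q : Rn1 n) : Differentiable ℝ fun y : Rn1 n => character q (-y) := by
  unfold character pairing
  have : ∀ k, Differentiable ℝ fun y : Rn1 n => y.1 k := fun k => by fun_prop
  simp only [Prod.fst_neg, Prod.snd_neg, PiLp.neg_apply]
  fun_prop

lemma fderiv_character_neg (q y : Rn1 n) (k : Fin n) :
    fderiv ℝ (fun y : Rn1 n => character q (-y)) y (EuclideanSpace.single k 1, 0) =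
      -(2 * π * I * q.1 k) * character q (-y) := by
  rw [← (differentiable_character_neg q y).lineDeriv_eq_fderiv]
  refine HasLineDerivAt.lineDeriv ?_
  have e : ∀ s : ℝ, character q (-(y + s • ((EuclideanSpace.single k 1, 0) : Rn1 n))) =
      cexp (2 * π * I * ((pairing q (-y) : ℝ) : ℂ) - s * (2 * π * I * q.1 k)) := by
    intro s
    rw [character]
    congr 1
    have : pairing q (-(y + s • ((EuclideanSpace.single k 1, 0) : Rn1 n))) = pairing q (-y) - s * q.1 k := by
      simp [pairing, mul_add, Finset.sum_add_distrib]
      ring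
    rw [this]
    push_cast
    ring
  rw [HasLineDerivAt]
  simp only [e]
  have h := (((hasDerivAt_id (0:ℝ)).ofReal_comp.mul_const (2 * π * I * q.1 k)).const_sub
    (2 * π * I * ((pairing q (-y) : ℝ) : ℂ))).cexp
  convert! h using 1
  simp [character]
  ring

lemma FT1_dX (k : Fin n) (f : SchwartzMap (Rn1 n) ℂ) (q : Rn1 n) :
    FT1 (dX k f) q = 2 * π * I * q.1 k * FT1 f q := by
  have hch : ∀ {h : Rn1 n → ℂ}, Integrable h → Integrable fun y => character q (-y) * h y := fun hh =>
    hh.bdd_mul (c := 1) ((continuous_character_right q).comp continuous_neg).aestronglyMeasurable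
      (Filter.Eventually.of_forall fun y => (norm_character q _).le)
  have hd : Integrable (dX k f) := by
    have := (LineDeriv.lineDerivOp (EuclideanSpace.single k (1:ℝ), (0:ℝ)) f).integrable (μ := volume)
    exact this.congr (Filter.Eventually.of_forall fun x => SchwartzMap.lineDerivOp_apply_eq_fderiv _ _ _)
  have h := integral_mul_fderiv_eq_neg_fderiv_mul_of_integrable (μ := (volume : Measure (Rn1 n)))
    (f := fun y => character q (-y)) (g := f) (v := (EuclideanSpace.single k 1, 0)) ?_ (hch hd)
    (hch f.integrable) (fun y _ => differentiable_character_neg q y) (fun y _ => f.differentiableAt)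
  · rw [FT1_eq, FT1_eq]
    refine h.trans ?_
    rw [← integral_neg, ← integral_const_mul]
    refine integral_congr_ae (Filter.Eventually.of_forall fun y => ?_)
    simp only [fderiv_character_neg]
    ring
  · simp only [fderiv_character_neg, mul_assoc _ (character q _)]
    exact (hch f.integrable).const_mul _

lemma parSymbol_decomposition (q : Rn1 n) (z : ℂ) :
    z = (invSqrt (parSymbol q) * (invSqrt (parSymbol q) * z) +
      ∑ k, -1 * (2 * π * I * ((q.1 k : ℂ) * invSqrt (parSymbol q)) *
        (2 * π * I * ((q.1 k : ℂ) * invSqrt (parSymbol q)) * z))) +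
      I * ((SignType.sign q.2 : ℝ) : ℂ) * (((|q.2| ^ ((1:ℝ)/2) : ℝ) : ℂ) * invSqrt (parSymbol q)) *
        (((|q.2| ^ ((1:ℝ)/2) : ℝ) : ℂ) * invSqrt (parSymbol q) * z) := by
  have hL := invSqrt_sq (parSymbol_re_pos q)
  have hr2 : (((|q.2| ^ ((1:ℝ)/2) : ℝ) : ℂ)) ^ 2 = (|q.2| : ℝ) := by
    rw [← Complex.ofReal_pow, ← Real.sqrt_eq_rpow, Real.sq_sqrt (abs_nonneg _)]
  have hσ : ((SignType.sign q.2 : ℝ) : ℂ) * (|q.2| : ℝ) = q.2 := by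
    exact_mod_cast sign_mul_abs q.2
  have e : ∀ k, -1 * (2 * π * I * ((q.1 k : ℂ) * invSqrt (parSymbol q)) *
      (2 * π * I * ((q.1 k : ℂ) * invSqrt (parSymbol q)) * z)) =
      (q.1 k : ℂ) ^ 2 * (4 * π ^ 2 * (parSymbol q)⁻¹ * z) := by
    intro k
    rw [← hL]
    linear_combination (-4 * π ^ 2 * (q.1 k : ℂ) ^ 2 * invSqrt (parSymbol q) ^ 2 * z) * Complex.I_sq
  simp only [e]
  rw [← Finset.sum_mul, sum_coord_sq]
  have e2 : z = parSymbol q * ((parSymbol q)⁻¹ * z) := (mul_inv_cancel_left₀ (parSymbol_ne_zero q) z).symm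
  have e3 : parSymbol q * ((parSymbol q)⁻¹ * z) =
      (1 + 4 * (π : ℂ) ^ 2 * (‖q.1‖ : ℂ) ^ 2 + I * (q.2 : ℂ)) * ((parSymbol q)⁻¹ * z) := rfl
  refine e2.trans (e3.trans ?_)
  rw [← hσ, ← hr2, ← hL]
  ring

lemma pNorm_IFT1_add_le {p : ℝ} (hp : 1 ≤ p) {F G : Rn1 n → ℂ} (hF : Integrable F) (hG : Integrable G) :
    pNorm p (IFT1 fun q => F q + G q) ≤ pNorm p (IFT1 F) + pNorm p (IFT1 G) := by
  rw [IFT1_add hF hG]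
  exact pNorm_add_le hp (continuous_IFT1 hF) (continuous_IFT1 hG)

lemma pNorm_IFT1_sum_le {p : ℝ} (hp : 1 ≤ p) {ι : Type*} (s : Finset ι) {F : ι → Rn1 n → ℂ}
    (hF : ∀ i, Integrable (F i)) :
    pNorm p (IFT1 fun q => ∑ i ∈ s, F i q) ≤ ∑ i ∈ s, pNorm p (IFT1 (F i)) := by
  classical
  induction s using Finset.induction_on with
  | empty =>
    have : (IFT1 fun _ : Rn1 n => (0:ℂ)) = fun _ => 0 := by
      funext x
      simp [IFT1_eq]
    simp [this, pNorm]
  | insert i s hi ih =>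
    simp only [Finset.sum_insert hi]
    exact (pNorm_IFT1_add_le hp (hF i) (integrable_finsetSum _ fun j _ => hF j)).trans (by gcongr)

end ParabolicSobolev

/-- Parabolic Sobolev equivalence
`‖f‖_{𝓛^p_α} ≈ ‖f‖_{𝓛^p_{α−1}} + Σ_k ‖D_{X_k}f‖_{𝓛^p_{α−1}} + ‖D_t^{1/2}f‖_{𝓛^p_{α−1}}`. -/
theorem stmt0 (n : ℕ) (hn : 1 ≤ n) (p : ℝ) (hp : 1 < p) (α : ℝ) :
    ∃ c C : ℝ, 0 < c ∧ 0 < C ∧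
      ∀ f : SchwartzMap (Rn1 n) ℂ,
        ENNReal.ofReal c * pNorm p (MOp (mSym α) ⇑f) ≤
            pNorm p (MOp (mSym (α - 1)) ⇑f)
            + ∑ k : Fin n, pNorm p (MOp (mSym (α - 1)) (dX k ⇑f))
            + pNorm p (MOp (fun q => mSym (α - 1) q * ((|q.2| ^ ((1 : ℝ) / 2) : ℝ) : ℂ)) ⇑f)
          ∧
          pNorm p (MOp (mSym (α - 1)) ⇑f)
            + ∑ k : Fin n, pNorm p (MOp (mSym (α - 1)) (dX k ⇑f))
            + pNorm p (MOp (fun q => mSym (α - 1) q * ((|q.2| ^ ((1 : ℝ) / 2) : ℝ) : ℂ)) ⇑f)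
            ≤ ENNReal.ofReal C * pNorm p (MOp (mSym α) ⇑f) := by
  obtain ⟨C₀, h₀⟩ := lpMult_invSqrt_parSymbol (n := n) hp.le
  choose C₁ h₁ using fun k => (lpMult_coord_mul_invSqrt_parSymbol (n := n) hp k).const_mul (2 * π * I)
  obtain ⟨C₂, h₂⟩ := lpMult_halfDeriv (n := n) hp
  obtain ⟨C₃, h₃⟩ := ((lpMult_sign (n := n) hp).const_mul I).mul (lpMult_halfDeriv hp)
  set K : ℝ≥0 := C₀ + ∑ k, C₁ k + C₂ + C₃ + 1 with hK
  have hK0 : 0 < K := by positivity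
  have hle₀ : C₀ ≤ K := by rw [hK, add_assoc, add_assoc, add_assoc]; exact le_self_add
  have hle₁ : ∀ k, C₁ k ≤ K := fun k =>
    (Finset.single_le_sum (fun _ _ => zero_le) (Finset.mem_univ k)).trans <| by
      rw [hK, add_comm C₀, add_assoc, add_assoc, add_assoc]; exact le_self_add
  have hle₃ : C₃ ≤ K := by rw [hK, add_right_comm]; exact le_add_self
  refine ⟨(K⁻¹ : ℝ≥0), K, by positivity, by positivity, fun f => ?_⟩
  set F : Rn1 n → ℂ := fun q => mSym α q * FT1 f q with hFdef
  have hF : Integrable F := integrable_mSym_mul_FT1 α f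
  have hFm : Measurable F := (measurable_mSym α).mul (measurable_FT1 f.integrable)
  set G₀ : Rn1 n → ℂ := fun q => invSqrt (parSymbol q) * F q with hG₀
  set G₁ : Fin n → Rn1 n → ℂ := fun k q => 2 * π * I * ((q.1 k : ℂ) * invSqrt (parSymbol q)) * F q with hG₁
  set G₂ : Rn1 n → ℂ := fun q => ((|q.2| ^ ((1:ℝ)/2) : ℝ) : ℂ) * invSqrt (parSymbol q) * F q with hG₂
  have e₀ : MOp (mSym (α - 1)) ⇑f = IFT1 G₀ := by
    rw [MOp]
    congr 1
    funext q
    rw [mSym_sub_one, mul_assoc]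
  have e₁ : ∀ k, MOp (mSym (α - 1)) (dX k ⇑f) = IFT1 (G₁ k) := by
    intro k
    rw [MOp]
    congr 1
    funext q
    rw [mSym_sub_one, FT1_dX]
    ring
  have e₂ : MOp (fun q => mSym (α - 1) q * ((|q.2| ^ ((1 : ℝ) / 2) : ℝ) : ℂ)) ⇑f = IFT1 G₂ := by
    rw [MOp]
    congr 1
    funext q
    rw [mSym_sub_one]
    ring
  have e : MOp (mSym α) ⇑f = IFT1 F := rfl
  have i₀ : Integrable G₀ := h₀.integrable_mul hF
  have i₁ : ∀ k, Integrable (G₁ k) := fun k => (h₁ k).integrable_mul hF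
  have i₂ : Integrable G₂ := h₂.integrable_mul hF
  have m₀ : Measurable G₀ := h₀.measurable.mul hFm
  have m₁ : ∀ k, Measurable (G₁ k) := fun k => (h₁ k).measurable.mul hFm
  have m₂ : Measurable G₂ := h₂.measurable.mul hFm
  rw [e₀, e₂, e]
  simp only [e₁, ENNReal.ofReal_coe_nnreal]
  constructor
  · rw [ENNReal.coe_inv hK0.ne', ENNReal.inv_mul_le_iff (by exact_mod_cast hK0.ne') ENNReal.coe_ne_top]
    have hdec : F = fun q => (invSqrt (parSymbol q) * G₀ q +
        ∑ k, -1 * (2 * π * I * ((q.1 k : ℂ) * invSqrt (parSymbol q)) * G₁ k q)) +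
        I * ((SignType.sign q.2 : ℝ) : ℂ) * (((|q.2| ^ ((1:ℝ)/2) : ℝ) : ℂ) * invSqrt (parSymbol q)) * G₂ q := by
      funext q
      exact parSymbol_decomposition q (F q)
    calc pNorm p (IFT1 F) ≤ pNorm p (IFT1 fun q => invSqrt (parSymbol q) * G₀ q) +
          ∑ k, pNorm p (IFT1 fun q => -1 * (2 * π * I * ((q.1 k : ℂ) * invSqrt (parSymbol q)) * G₁ k q)) +
          pNorm p (IFT1 fun q => I * ((SignType.sign q.2 : ℝ) : ℂ) *
            (((|q.2| ^ ((1:ℝ)/2) : ℝ) : ℂ) * invSqrt (parSymbol q)) * G₂ q) := by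
          have j₁ : ∀ k, Integrable fun q => -1 * (2 * π * I * ((q.1 k : ℂ) * invSqrt (parSymbol q)) * G₁ k q) :=
            fun k => ((h₁ k).integrable_mul (i₁ k)).const_mul _
          have js := integrable_finsetSum Finset.univ fun k _ => j₁ k
          rw [hdec]
          refine (pNorm_IFT1_add_le hp.le ((h₀.integrable_mul i₀).add js) (h₃.integrable_mul i₂)).trans ?_
          gcongr
          refine (pNorm_IFT1_add_le hp.le (h₀.integrable_mul i₀) js).trans ?_
          gcongr
          exact pNorm_IFT1_sum_le hp.le _ j₁
      _ ≤ K * pNorm p (IFT1 G₀) + ∑ k, K * pNorm p (IFT1 (G₁ k)) + K * pNorm p (IFT1 G₂) := by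
          gcongr with k
          · exact (h₀.mono hle₀).le _ m₀ i₀
          · rw [IFT1_const_mul, pNorm_const_smul, enorm_neg, enorm_one, one_mul]
            exact ((h₁ k).mono (hle₁ k)).le _ (m₁ k) (i₁ k)
          · exact (h₃.mono hle₃).le _ m₂ i₂
      _ = _ := by rw [← Finset.mul_sum, mul_add, mul_add]
  · calc _ ≤ C₀ * pNorm p (IFT1 F) + ∑ k, C₁ k * pNorm p (IFT1 F) + C₂ * pNorm p (IFT1 F) := by
          gcongr with k
          · exact h₀.le _ hFm hF
          · exact (h₁ k).le _ hFm hF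
          · exact h₂.le _ hFm hF
      _ = ((C₀ + ∑ k, C₁ k + C₂ : ℝ≥0) : ℝ≥0∞) * pNorm p (IFT1 F) := by
          push_cast
          rw [← Finset.sum_mul, add_mul, add_mul]
      _ ≤ _ := by
          gcongr
          rw [hK, add_assoc _ C₃]
          exact le_self_add
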